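/- Let H be an N×N GOE matrix and let M be obtained from H by setting the diagonal entries to zero (so M_ij = H_ij for i≠j and M_ii = 0). Let ε>0. Then with overwhelming probability (i.e., for every D>0 the complementary probability is at most N^{−D} for N large enough), for all indices i ≤ N^{1/20}, the ordered eigenvalues satisfy |λ_i(H) − λ_i(M)| ≤ N^{ε}/N. -/

import Mathlib

open MeasureTheory Complex ProbabilityTheory
open scoped RealInnerProductSpace BigOperators

noncomputable section

abbrev ESp (N : ℕ) := EuclideanSpace ℝ (Fin N)

/-- Surface (uniform, up to normalization) measure on the unit sphere of `ℝ^N`. -/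
def sphereMeas (N : ℕ) : Measure (Metric.sphere (0 : ESp N) 1) :=
  (volume : Measure (ESp N)).toSphere

/-- Gibbs weight `exp((β/2)⟨σ, Mσ⟩)` where `σ = √N · x` and `x` is on the unit sphere. -/
def gibbsWeight (N : ℕ) (β : ℝ) (M : Matrix (Fin N) (Fin N) ℝ)
    (x : Metric.sphere (0 : ESp N) 1) : ℝ :=
  Real.exp ((β * N / 2) * ⟪(x : ESp N), Matrix.toEuclideanLin M (x : ESp N)⟫)

/-- Gibbs expectation of a two-replica observable `φ` (in unit-sphere coordinates). -/
def gibbsExpect (N : ℕ) (β : ℝ) (M : Matrix (Fin N) (Fin N) ℝ)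
    (φ : ESp N → ESp N → ℝ) : ℝ :=
  (∫ x, ∫ y, gibbsWeight N β M x * gibbsWeight N β M y * φ (x : ESp N) (y : ESp N)
      ∂(sphereMeas N) ∂(sphereMeas N))
   / (∫ x, gibbsWeight N β M x ∂(sphereMeas N)) ^ 2

/-- Overlap `R₁₂ = σ⁽¹⁾·σ⁽²⁾/N` in unit-sphere coordinates. -/
def overlapFn (N : ℕ) (x y : ESp N) : ℝ := ⟪x, y⟫

/-- The function `G(z) = βz - N⁻¹ ∑ log(z - λᵢ)` (principal branch). -/
def Gfn (N : ℕ) (β : ℝ) (lam : Fin N → ℝ) (z : ℂ) : ℂ :=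
  β * z - (1 / (N : ℂ)) * ∑ i, Complex.log (z - lam i)

/-- `∫_{γ-i∞}^{γ+i∞} f(z) dz` parametrized as `i ∫_ℝ f(γ+it) dt`. -/
def lineInt (γ : ℝ) (f : ℂ → ℂ) : ℂ := Complex.I * ∫ t : ℝ, f (γ + t * Complex.I)

def lineInt2 (γ : ℝ) (F : ℂ → ℂ → ℂ) : ℂ :=
  Complex.I * Complex.I * ∫ t : ℝ, ∫ s : ℝ, F (γ + t * Complex.I) (γ + s * Complex.I)

/-- Semicircle density. -/
def rhoSC (x : ℝ) : ℝ := Real.sqrt (max (4 - x ^ 2) 0) / (2 * Real.pi)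

/-- iid standard Gaussian coefficients `g_{ij}`. -/
def gMeasure (N : ℕ) : Measure (Fin N → Fin N → ℝ) :=
  Measure.pi fun _ => Measure.pi fun _ => gaussianReal 0 1

/-- GOE matrix built from iid standard Gaussians. -/
def Hmat (N : ℕ) (g : Fin N → Fin N → ℝ) : Matrix (Fin N) (Fin N) ℝ :=
  fun i j => if i = j then Real.sqrt (2 / N) * g i i else (g i j + g j i) / Real.sqrt (2 * N)

/-- GOE matrix with zero diagonal. -/
def Mmat (N : ℕ) (g : Fin N → Fin N → ℝ) : Matrix (Fin N) (Fin N) ℝ :=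
  fun i j => if i = j then 0 else (g i j + g j i) / Real.sqrt (2 * N)

lemma Hmat_isHermitian (N : ℕ) (g : Fin N → Fin N → ℝ) : (Hmat N g).IsHermitian := by
  unfold Matrix.IsHermitian
  ext i j
  simp only [Matrix.conjTranspose_apply, star_trivial, Hmat]
  by_cases h : i = j
  · subst h; rfl
  · rw [if_neg fun hh => h hh.symm, if_neg h]; ring

lemma Mmat_isHermitian (N : ℕ) (g : Fin N → Fin N → ℝ) : (Mmat N g).IsHermitian := by
  unfold Matrix.IsHermitian
  ext i j
  simp only [Matrix.conjTranspose_apply, star_trivial, Mmat]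
  by_cases h : i = j
  · subst h; rfl
  · rw [if_neg fun hh => h hh.symm, if_neg h]; ring

/-- Eigenvalues of a real symmetric matrix, in decreasing order. -/
def evalsDesc {N : ℕ} {A : Matrix (Fin N) (Fin N) ℝ} (hA : A.IsHermitian) : Fin N → ℝ :=
  fun i => - (fun j => - hA.eigenvalues j) ((Tuple.sort fun j => - hA.eigenvalues j) i)

/-- Decreasing eigenvalues of the GOE matrix. -/
def evalsH (N : ℕ) (g : Fin N → Fin N → ℝ) : Fin N → ℝ := evalsDesc (Hmat_isHermitian N g)

/-- Decreasing eigenvalues of the zero-diagonal GOE matrix. -/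
def evalsM (N : ℕ) (g : Fin N → Fin N → ℝ) : Fin N → ℝ := evalsDesc (Mmat_isHermitian N g)

/-- `m̃_N(w) = N⁻¹ ∑_{j≥2} (λ_j - w)⁻¹`. -/
def mtil (N : ℕ) (lam : Fin N → ℝ) (w : ℝ) : ℝ :=
  (1 / (N:ℝ)) * ∑ j ∈ Finset.univ.filter (fun j : Fin N => (j : ℕ) ≠ 0), 1 / (lam j - w)

/-- `m̃_N'(w) = N⁻¹ ∑_{j≥2} (λ_j - w)⁻²`. -/
def mtil' (N : ℕ) (lam : Fin N → ℝ) (w : ℝ) : ℝ :=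
  (1 / (N:ℝ)) * ∑ j ∈ Finset.univ.filter (fun j : Fin N => (j : ℕ) ≠ 0), 1 / (lam j - w) ^ 2

/-- Rigidity: `|λ_i - γ_i| ≤ N^{ε₁/10} min(i, N+1-i)^{-1/3} N^{-2/3}` (1-based `i`). -/
def rigidityCond (N : ℕ) (ε₁ : ℝ) (lam γcl : Fin N → ℝ) : Prop :=
  ∀ i : Fin N, |lam i - γcl i| ≤
    (N:ℝ) ^ (ε₁ / 10) * ((min ((i:ℕ)+1) (N - (i:ℕ)) : ℕ) : ℝ) ^ (-(1:ℝ)/3) * (N:ℝ) ^ (-(2:ℝ)/3)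

/-- Classical locations: `∫_{-2}^{γ_i} ρ_sc = i/N` (1-based `i`). -/
def classicalLoc (N : ℕ) (γcl : Fin N → ℝ) : Prop :=
  ∀ i : Fin N, ∫ x in (-2:ℝ)..(γcl i), rhoSC x = (((i:ℕ) + 1 : ℕ) : ℝ) / N

/-- Keyhole contour integral around `-b`: rays below/above `(-∞, -b-r)` plus the
counterclockwise circle of radius `r`, for an integrand `f(z)·(z+b)^s`
(principal branch, boundary values on the rays). -/
def keyholeInt (b r : ℝ) (s : ℂ) (f : ℂ → ℂ) : ℂ :=
  (∫ x in Set.Iio (-b - r),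
      f x * Complex.exp (s * Real.log (-(x + b))) * Complex.exp (-(Real.pi:ℂ) * s * Complex.I))
  + (∫ θ in (-Real.pi)..Real.pi,
      f (-b + r * Complex.exp (θ * Complex.I)) *
        Complex.exp (s * ((Real.log r : ℂ) + θ * Complex.I)) *
        (Complex.I * r * Complex.exp (θ * Complex.I)))
  - (∫ x in Set.Iio (-b - r),
      f x * Complex.exp (s * Real.log (-(x + b))) * Complex.exp ((Real.pi:ℂ) * s * Complex.I))

/-- Integral over the contour `Γ̂ = Γ₁ ∪ Γ₃` (counterclockwise around the branch cut). -/
def hatInt (X η₀ : ℝ) (ηf ηf' : ℝ → ℝ) (F : ℂ → ℂ) : ℂ :=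
  (-Complex.I) * (∫ t in (0:ℝ)..η₀, F (-X - t * Complex.I))
  + (∫ E in (-X)..(0:ℝ), F (E - ηf E * Complex.I) * (1 - ηf' E * Complex.I))
  - (∫ E in (-X)..(0:ℝ), F (E + ηf E * Complex.I) * (1 + ηf' E * Complex.I))
  - Complex.I * (∫ t in (0:ℝ)..η₀, F (-X + t * Complex.I))

def hatInt2 (X η₀ : ℝ) (ηf ηf' : ℝ → ℝ) (F : ℂ → ℂ → ℂ) : ℂ :=
  hatInt X η₀ ηf ηf' fun z => hatInt X η₀ ηf ηf' fun w => F z w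

/-- Resolvent of a real matrix at complex spectral parameter. -/
def resolventM (N : ℕ) (A : Matrix (Fin N) (Fin N) ℝ) (z : ℂ) : Matrix (Fin N) (Fin N) ℂ :=
  (A.map (fun x => (x : ℂ)) - z • (1 : Matrix (Fin N) (Fin N) ℂ))⁻¹

/-- Empirical Stieltjes transform `N⁻¹ tr (A - z)⁻¹`. -/
def stTrans (N : ℕ) (A : Matrix (Fin N) (Fin N) ℝ) (z : ℂ) : ℂ :=
  (1 / (N:ℂ)) * Matrix.trace (resolventM N A z)

/-- Stieltjes transform of the semicircle law. -/
def mSC (z : ℂ) : ℂ := ∫ x in (-2:ℝ)..2, (rhoSC x : ℂ) / ((x:ℂ) - z)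


section Resolvent

variable {N : ℕ} {A : Matrix (Fin N) (Fin N) ℝ} {z : ℂ}

/-- The matrix `A - z` whose inverse is the resolvent. -/
def shiftM (N : ℕ) (A : Matrix (Fin N) (Fin N) ℝ) (z : ℂ) : Matrix (Fin N) (Fin N) ℂ :=
  A.map (fun x => (x : ℂ)) - z • (1 : Matrix (Fin N) (Fin N) ℂ)

lemma resolventM_eq : resolventM N A z = (shiftM N A z)⁻¹ := rfl

lemma shiftM_apply (i j : Fin N) :
    shiftM N A z i j = (A i j : ℂ) - if i = j then z else 0 := by
  simp [shiftM, Matrix.one_apply]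

lemma det_shiftM (hA : A.IsHermitian) :
    (shiftM N A z).det = ∏ j, ((hA.eigenvalues j : ℂ) - z) := by
  have h1 := congrArg (fun p : Polynomial ℝ => Polynomial.eval₂ Complex.ofRealHom z p)
    hA.charpoly_eq
  have h2 : Polynomial.eval₂ Complex.ofRealHom z A.charpoly
      = (z • (1 : Matrix (Fin N) (Fin N) ℂ) - A.map (fun x => (x : ℂ))).det := by
    rw [← Polynomial.eval_map, ← Matrix.charpoly_map, Matrix.eval_charpoly]
    congr 1
    ext i j
    simp [Matrix.scalar_apply, Matrix.one_apply, Matrix.diagonal_apply]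
  simp only [h2, Polynomial.eval₂_finsetProd, Polynomial.eval₂_sub, Polynomial.eval₂_X,
    Polynomial.eval₂_C] at h1
  have h3 : shiftM N A z = -(z • (1 : Matrix (Fin N) (Fin N) ℂ) - A.map (fun x => (x : ℂ))) := by
    simp [shiftM]
  rw [h3, Matrix.det_neg, h1, ← Finset.card_univ, ← Finset.prod_const, ← Finset.prod_mul_distrib]
  refine Finset.prod_congr rfl fun j _ => ?_
  simp

lemma shiftM_isUnit_det (hA : A.IsHermitian) (hz : 0 < z.im) : IsUnit (shiftM N A z).det := by
  rw [isUnit_iff_ne_zero, det_shiftM hA, Finset.prod_ne_zero_iff]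
  intro j _ h
  have := congrArg Complex.im h
  simp at this
  exact hz.ne' this

lemma shiftM_mul_resolventM (hA : A.IsHermitian) (hz : 0 < z.im) :
    shiftM N A z * resolventM N A z = 1 :=
  Matrix.mul_nonsing_inv _ (shiftM_isUnit_det hA hz)

lemma resolventM_mul_shiftM (hA : A.IsHermitian) (hz : 0 < z.im) :
    resolventM N A z * shiftM N A z = 1 :=
  Matrix.nonsing_inv_mul _ (shiftM_isUnit_det hA hz)

lemma resolventM_transpose (hA : A.IsHermitian) :
    (resolventM N A z).transpose = resolventM N A z := by
  rw [resolventM_eq, Matrix.transpose_nonsing_inv]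
  congr 1
  ext i j
  have : A j i = A i j := by simpa using hA.apply i j
  simp only [Matrix.transpose_apply, shiftM_apply, this, eq_comm]

lemma resolventM_symm (hA : A.IsHermitian) (i j : Fin N) :
    resolventM N A z i j = resolventM N A z j i := by
  conv_lhs => rw [← resolventM_transpose hA]
  rfl

lemma resolventM_sub_conjTranspose (hA : A.IsHermitian) (hz : 0 < z.im) :
    resolventM N A z - (resolventM N A z).conjTranspose
      = (z - (starRingEnd ℂ) z) • (resolventM N A z * (resolventM N A z).conjTranspose) := by
  set G := resolventM N A z
  have h1 : G * shiftM N A z = 1 := resolventM_mul_shiftM hA hz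
  have h2 : (shiftM N A z).conjTranspose * G.conjTranspose = 1 := by
    rw [← Matrix.conjTranspose_mul, h1, Matrix.conjTranspose_one]
  have h3 : (shiftM N A z).conjTranspose
      = shiftM N A z + (z - (starRingEnd ℂ) z) • (1 : Matrix (Fin N) (Fin N) ℂ) := by
    ext i j
    have : A j i = A i j := by simpa using hA.apply i j
    by_cases hij : i = j
    · subst hij; simp [shiftM_apply]
    · simp [shiftM_apply, this, hij, Ne.symm hij]
  calc G - G.conjTranspose = G * ((shiftM N A z).conjTranspose * G.conjTranspose)
        - (G * shiftM N A z) * G.conjTranspose := by rw [h1, h2]; simp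
    _ = _ := by
      rw [h3]
      simp only [Matrix.add_mul, Matrix.mul_add, Matrix.mul_assoc, Matrix.smul_mul, Matrix.one_mul,
        Matrix.mul_smul]
      abel

lemma im_resolventM_diag (hA : A.IsHermitian) (hz : 0 < z.im) (k : Fin N) :
    (resolventM N A z k k).im = z.im * ∑ j, ‖resolventM N A z k j‖ ^ 2 := by
  have h := congrFun (congrFun (resolventM_sub_conjTranspose hA hz) k) k
  simp only [Matrix.sub_apply, Matrix.conjTranspose_apply, Matrix.smul_apply, Matrix.mul_apply,
    RCLike.star_def, Complex.mul_conj, smul_eq_mul] at h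
  rw [Complex.sub_conj, Complex.sub_conj] at h
  have h4 := congrArg Complex.im h
  rw [← Complex.ofReal_sum] at h4
  have h5 : (2 : ℝ) * (resolventM N A z k k).im
      = 2 * z.im * ∑ j, Complex.normSq (resolventM N A z k j) := by
    simpa using h4
  simp only [Complex.normSq_eq_norm_sq] at h5
  linarith

lemma im_resolventM_diag_nonneg (hA : A.IsHermitian) (hz : 0 < z.im) (k : Fin N) :
    0 ≤ (resolventM N A z k k).im := by
  rw [im_resolventM_diag hA hz]; positivity

lemma norm_resolventM_diag_le (hA : A.IsHermitian) (hz : 0 < z.im) (k : Fin N) :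
    ‖resolventM N A z k k‖ ≤ 1 / z.im := by
  have h1 := im_resolventM_diag hA hz k
  have h2 : ‖resolventM N A z k k‖ ^ 2 ≤ ∑ j, ‖resolventM N A z k j‖ ^ 2 :=
    Finset.single_le_sum (f := fun j => ‖resolventM N A z k j‖ ^ 2)
      (fun j _ => by positivity) (Finset.mem_univ k)
  have h3 := (le_abs_self _).trans (Complex.abs_im_le_norm (resolventM N A z k k))
  rcases (norm_nonneg (resolventM N A z k k)).eq_or_lt with h0 | h0
  · rw [← h0]; positivity
  · rw [le_div_iff₀ hz]
    have h6 : z.im * ‖resolventM N A z k k‖ ^ 2 ≤ ‖resolventM N A z k k‖ := by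
      calc _ ≤ z.im * ∑ j, ‖resolventM N A z k j‖ ^ 2 := by gcongr
        _ = _ := h1.symm
        _ ≤ _ := h3
    nlinarith

lemma trace_resolventM (hA : A.IsHermitian) (hz : 0 < z.im) :
    (resolventM N A z).trace = ∑ j, 1 / ((hA.eigenvalues j : ℂ) - z) := by
  set U : Matrix (Fin N) (Fin N) ℝ := hA.eigenvectorUnitary.1 with hU
  have hUU : U * star U = 1 := Unitary.mul_star_self_of_mem hA.eigenvectorUnitary.2
  have hUU' : star U * U = 1 := Unitary.star_mul_self_of_mem hA.eigenvectorUnitary.2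
  have hspec : A = U * Matrix.diagonal hA.eigenvalues * star U := by
    have := hA.spectral_theorem
    rw [Unitary.conjStarAlgAut_apply] at this
    exact this
  set V : Matrix (Fin N) (Fin N) ℂ := U.map Complex.ofRealHom
  set W : Matrix (Fin N) (Fin N) ℂ := (star U).map Complex.ofRealHom
  have hVW : V * W = 1 := by
    rw [← Matrix.map_mul, hUU]; simp
  have hWV : W * V = 1 := by
    rw [← Matrix.map_mul, hUU']; simp
  have hAc : A.map (fun x => (x : ℂ))
      = V * Matrix.diagonal (fun j => (hA.eigenvalues j : ℂ)) * W := by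
    have : A.map (fun x => (x : ℂ)) = A.map Complex.ofRealHom := rfl
    rw [this]
    conv_lhs => rw [hspec]
    rw [Matrix.map_mul, Matrix.map_mul, Matrix.diagonal_map (by simp)]
    rfl
  have hne : ∀ j, (hA.eigenvalues j : ℂ) - z ≠ 0 := by
    intro j h
    have := congrArg Complex.im h
    simp at this
    exact hz.ne' this
  set D := Matrix.diagonal (fun j => (hA.eigenvalues j : ℂ) - z)
  set D' := Matrix.diagonal (fun j => 1 / ((hA.eigenvalues j : ℂ) - z))
  have hDD : D * D' = 1 := by
    rw [Matrix.diagonal_mul_diagonal, ← Matrix.diagonal_one]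
    congr 1; ext j; exact mul_one_div_cancel (hne j)
  have hs : shiftM N A z = V * D * W := by
    have hD : D = Matrix.diagonal (fun j => (hA.eigenvalues j : ℂ))
        - z • (1 : Matrix (Fin N) (Fin N) ℂ) := by
      ext i j
      by_cases hij : i = j
      · subst hij; simp [D]
      · simp [D, hij]
    rw [hD, shiftM, hAc, Matrix.mul_sub, Matrix.sub_mul, Matrix.mul_smul, Matrix.mul_one,
      Matrix.smul_mul, hVW]
  have hG : resolventM N A z = V * D' * W := by
    rw [resolventM_eq]
    apply Matrix.inv_eq_right_inv
    rw [hs]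
    calc V * D * W * (V * D' * W) = V * D * (W * V) * D' * W := by
          simp only [Matrix.mul_assoc]
      _ = V * (D * D') * W := by rw [hWV]; simp only [Matrix.mul_assoc, Matrix.one_mul]
      _ = 1 := by rw [hDD, Matrix.mul_one, hVW]
  rw [hG, Matrix.trace_mul_comm, ← Matrix.mul_assoc, hWV, Matrix.one_mul, Matrix.trace_diagonal]

end Resolvent

section Schur

variable {N : ℕ} {A : Matrix (Fin N) (Fin N) ℝ} {z : ℂ} {k : Fin N}

/-- `A` with row and column `k` set to zero. -/
def minorM (A : Matrix (Fin N) (Fin N) ℝ) (k : Fin N) : Matrix (Fin N) (Fin N) ℝ :=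
  fun i j => if i = k ∨ j = k then 0 else A i j

lemma minorM_isHermitian (hA : A.IsHermitian) (k : Fin N) : (minorM A k).IsHermitian := by
  ext i j
  have : A j i = A i j := by simpa using hA.apply i j
  simp only [minorM, Matrix.conjTranspose_apply, star_trivial, this, or_comm]

/-- The resolvent of the minor obtained by deleting row and column `k`, padded by zeros. -/
def minorRes (N : ℕ) (A : Matrix (Fin N) (Fin N) ℝ) (z : ℂ) (k : Fin N) :
    Matrix (Fin N) (Fin N) ℂ :=
  fun i j => if i = k ∨ j = k then 0 else resolventM N (minorM A k) z i j

lemma resolventM_minorM_row (hA : A.IsHermitian) (hz : 0 < z.im) (j : Fin N) :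
    z * resolventM N (minorM A k) z k j = if k = j then -1 else 0 := by
  have h := congrFun (congrFun (shiftM_mul_resolventM (minorM_isHermitian hA k) hz) k) j
  rw [Matrix.mul_apply, Finset.sum_eq_single k] at h
  · simp only [shiftM_apply, minorM, true_or, if_true, Matrix.one_apply] at h
    split_ifs at h ⊢ <;> (push_cast at h; linear_combination -h)
  · intro l _ hl
    simp [shiftM_apply, minorM, Ne.symm hl]
  · simp

lemma minorRes_symm (hA : A.IsHermitian) (i j : Fin N) :
    minorRes N A z k i j = minorRes N A z k j i := by
  simp only [minorRes, or_comm, resolventM_symm (minorM_isHermitian hA k) i j]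

/-- The `k`-th column of the resolvent, normalised to be `1` at `k`. -/
def schurVec (N : ℕ) (A : Matrix (Fin N) (Fin N) ℝ) (z : ℂ) (k : Fin N) : Fin N → ℂ :=
  fun i => (if i = k then 1 else 0) - ∑ j, minorRes N A z k i j * (A k j : ℂ)

lemma schurVec_self : schurVec N A z k k = 1 := by
  simp [schurVec, minorRes]

lemma shiftM_mul_minorRes (hA : A.IsHermitian) (hz : 0 < z.im) (i j : Fin N) :
    (shiftM N A z * minorRes N A z k) i j
      = (if i = j then 1 else 0) - (if i = k then 1 else 0) * schurVec N A z k j := by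
  have hz0 : z ≠ 0 := by rintro rfl; simp at hz
  rw [Matrix.mul_apply]
  by_cases hj : j = k
  · subst hj
    simp [minorRes, schurVec_self]
  by_cases hi : i = k
  · subst hi
    have : schurVec N A z i j = - ∑ l, minorRes N A z i j l * (A i l : ℂ) := by
      simp [schurVec, hj]
    rw [this, if_neg (Ne.symm hj)]
    simp only [if_true, one_mul, zero_sub, neg_neg]
    refine Finset.sum_congr rfl fun l _ => ?_
    rw [minorRes_symm hA j l, shiftM_apply]
    by_cases hl : i = l
    · subst hl; simp [minorRes]
    · simp [hl, mul_comm]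
  · have h := congrFun (congrFun (shiftM_mul_resolventM (minorM_isHermitian hA k) hz) i) j
    rw [Matrix.mul_apply, Matrix.one_apply] at h
    rw [if_neg hi, zero_mul, sub_zero, ← h]
    refine Finset.sum_congr rfl fun l _ => ?_
    by_cases hl : l = k
    · subst hl
      simp [minorRes, shiftM_apply, minorM, hi]
    · simp [minorRes, shiftM_apply, minorM, hi, hj, hl]

/-- The Schur complement, i.e. the reciprocal of the `k`-th diagonal resolvent entry. -/
def schurC (N : ℕ) (A : Matrix (Fin N) (Fin N) ℝ) (z : ℂ) (k : Fin N) : ℂ :=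
  (A k k : ℂ) - z - ∑ i, ∑ j, minorRes N A z k i j * ((A k i : ℂ) * (A k j : ℂ))

lemma shiftM_mulVec_schurVec (hA : A.IsHermitian) (hz : 0 < z.im) (i : Fin N) :
    (shiftM N A z).mulVec (schurVec N A z k) i = if i = k then schurC N A z k else 0 := by
  have h1 : (shiftM N A z).mulVec (schurVec N A z k) i
      = shiftM N A z i k - ∑ j, (shiftM N A z * minorRes N A z k) i j * (A k j : ℂ) := by
    simp only [Matrix.mulVec, dotProduct, schurVec, mul_sub, Finset.sum_sub_distrib, mul_ite,
      mul_one, mul_zero, Finset.sum_ite_eq', Finset.mem_univ, if_true, Matrix.mul_apply,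
      Finset.mul_sum, Finset.sum_mul]
    rw [Finset.sum_comm]
    simp only [mul_assoc]
  rw [h1]
  simp only [shiftM_mul_minorRes hA hz, sub_mul, Finset.sum_sub_distrib, ite_mul, one_mul, zero_mul,
    Finset.sum_ite_eq, Finset.mem_univ, if_true, shiftM_apply]
  have hik : A k i = A i k := by simpa using hA.apply i k
  by_cases hi : i = k
  · subst hi
    simp only [if_true, schurC, schurVec, sub_mul, Finset.sum_sub_distrib, ite_mul, one_mul,
      zero_mul, Finset.sum_ite_eq', Finset.mem_univ, Finset.sum_mul]
    rw [sub_sub_cancel]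
    congr 1
    refine Finset.sum_congr rfl fun a _ => Finset.sum_congr rfl fun b _ => ?_
    ring
  · simp [hi, hik]

lemma resolventM_diag_mul_schurC (hA : A.IsHermitian) (hz : 0 < z.im) (i : Fin N) :
    resolventM N A z i k * schurC N A z k = schurVec N A z k i := by
  have h1 : (shiftM N A z).mulVec (schurVec N A z k) = Pi.single k (schurC N A z k) := by
    ext i; rw [shiftM_mulVec_schurVec hA hz, Pi.single_apply]
  have h2 := congrArg (fun v => (resolventM N A z).mulVec v i) h1
  simp only [Matrix.mulVec_mulVec, resolventM_mul_shiftM hA hz, Matrix.one_mulVec,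
    Matrix.mulVec_single] at h2
  simpa using h2.symm

lemma resolventM_diag_ne_zero (hA : A.IsHermitian) (hz : 0 < z.im) : resolventM N A z k k ≠ 0 := by
  intro h
  have := resolventM_diag_mul_schurC hA hz (k := k) k
  rw [h, schurVec_self] at this
  simp at this

lemma inv_resolventM_diag (hA : A.IsHermitian) (hz : 0 < z.im) :
    (resolventM N A z k k)⁻¹ = schurC N A z k := by
  have := resolventM_diag_mul_schurC hA hz (k := k) k
  rw [schurVec_self] at this
  exact inv_eq_of_mul_eq_one_right this

lemma resolventM_eq_minorRes_add (hA : A.IsHermitian) (hz : 0 < z.im) (i j : Fin N) :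
    resolventM N A z i j = minorRes N A z k i j
      + resolventM N A z k k * (schurVec N A z k i * schurVec N A z k j) := by
  set g := resolventM N A z k k
  have hg : g * schurC N A z k = 1 := by
    rw [resolventM_diag_mul_schurC hA hz, schurVec_self]
  have : resolventM N A z = minorRes N A z k
      + g • Matrix.vecMulVec (schurVec N A z k) (schurVec N A z k) := by
    rw [resolventM_eq]
    apply Matrix.inv_eq_right_inv
    rw [Matrix.mul_add, Matrix.mul_smul, Matrix.mul_vecMulVec]
    ext a b
    rw [Matrix.add_apply, shiftM_mul_minorRes hA hz, Matrix.smul_apply, Matrix.vecMulVec_apply,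
      shiftM_mulVec_schurVec hA hz, Matrix.one_apply, smul_eq_mul]
    by_cases ha : a = k
    · simp only [ha, if_true, ← mul_assoc, hg]; ring
    · simp [ha]
  rw [this]
  simp [Matrix.vecMulVec_apply]

lemma norm_trace_sub_minorRes_le (hA : A.IsHermitian) (hz : 0 < z.im) :
    ‖(resolventM N A z).trace - (minorRes N A z k).trace‖ ≤ 1 / z.im := by
  set g := resolventM N A z k k with hg
  have hgs : g * schurC N A z k = 1 := by
    rw [resolventM_diag_mul_schurC hA hz, schurVec_self]
  have hg0 : g ≠ 0 := resolventM_diag_ne_zero hA hz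
  have h1 : (resolventM N A z).trace - (minorRes N A z k).trace
      = g * ∑ i, schurVec N A z k i * schurVec N A z k i := by
    simp only [Matrix.trace, Matrix.diag_apply]
    rw [← Finset.sum_sub_distrib, Finset.mul_sum]
    refine Finset.sum_congr rfl fun i _ => ?_
    rw [resolventM_eq_minorRes_add hA hz (k := k) i i]; ring
  have h2 : ∀ i, resolventM N A z k i = g * schurVec N A z k i := by
    intro i
    rw [resolventM_symm hA, ← resolventM_diag_mul_schurC hA hz i]
    linear_combination - (resolventM N A z i k) * hgs
  have h3 := im_resolventM_diag hA hz k
  simp only [h2, norm_mul, mul_pow, ← Finset.mul_sum] at h3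
  rw [schurVec_self, mul_one] at h3
  have h4 := (le_abs_self _).trans (Complex.abs_im_le_norm g)
  have hgp : 0 < ‖g‖ := norm_pos_iff.mpr hg0
  rw [h1, norm_mul]
  have h5 : ‖∑ i, schurVec N A z k i * schurVec N A z k i‖ ≤ ∑ i, ‖schurVec N A z k i‖ ^ 2 := by
    refine (norm_sum_le _ _).trans (le_of_eq ?_)
    refine Finset.sum_congr rfl fun i _ => ?_
    rw [norm_mul, sq]
  rw [le_div_iff₀ hz]
  rw [h3] at h4
  have h6 : z.im * (‖g‖ * ∑ i, ‖schurVec N A z k i‖ ^ 2) ≤ 1 := by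
    by_contra! hlt
    nlinarith
  calc _ ≤ ‖g‖ * (∑ i, ‖schurVec N A z k i‖ ^ 2) * z.im := by gcongr
    _ ≤ 1 := by linarith

lemma frob_minorRes (hA : A.IsHermitian) (hz : 0 < z.im) :
    z.im * ∑ i, ∑ j, ‖minorRes N A z k i j‖ ^ 2 = (minorRes N A z k).trace.im := by
  have hz0 : z ≠ 0 := by rintro rfl; simp at hz
  simp only [Matrix.trace, Matrix.diag_apply, Complex.im_sum, Finset.mul_sum]
  refine Finset.sum_congr rfl fun i _ => ?_
  by_cases hi : i = k
  · simp [minorRes, hi]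
  · have h0 : resolventM N (minorM A k) z i k = 0 := by
      have := resolventM_minorM_row hA hz (k := k) i
      rw [if_neg (Ne.symm hi)] at this
      rw [resolventM_symm (minorM_isHermitian hA k)]
      exact (mul_eq_zero.mp this).resolve_left hz0
    have h1 : minorRes N A z k i i = resolventM N (minorM A k) z i i := by simp [minorRes, hi]
    rw [h1, im_resolventM_diag (minorM_isHermitian hA k) hz, Finset.mul_sum]
    refine Finset.sum_congr rfl fun j _ => ?_
    by_cases hj : j = k
    · subst hj; simp [minorRes, h0]
    · simp [minorRes, hi, hj]

lemma det_shiftM_add_single (hA : A.IsHermitian) (hz : 0 < z.im) (d : ℝ)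
    {A' : Matrix (Fin N) (Fin N) ℝ} (hA' : ∀ i j, A' i j = A i j + if i = k ∧ j = k then d else 0) :
    (shiftM N A' z).det = (shiftM N A z).det * (1 + d * resolventM N A z k k) := by
  have h1 : shiftM N A' z = shiftM N A z
      + Matrix.replicateCol Unit (Pi.single k (d : ℂ)) *
        Matrix.replicateRow Unit (Pi.single k (1 : ℂ)) := by
    ext i j
    rw [Matrix.add_apply, shiftM_apply, shiftM_apply, hA', Matrix.mul_apply]
    by_cases hi : i = k <;> by_cases hj : j = k <;> simp [hi, hj] <;> ring
  rw [h1, Matrix.det_add_replicateCol_mul_replicateRow (shiftM_isUnit_det hA hz)]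
  congr 1
  rw [Matrix.det_unique, Matrix.add_apply, Matrix.one_apply_eq, ← resolventM_eq]
  congr 1
  simp [Matrix.mul_apply, Matrix.replicateRow_apply, Matrix.replicateCol_apply, Pi.single_apply,
    mul_comm]

end Schur

section SelfConsistent

lemma sq_im_mul_sq_im_add (x η : ℝ) (s : ℂ) :
    (s.im + η / 2) ^ 2 * ((s.im + η / 2) ^ 2
        + ((x ^ 2 - η ^ 2) / 4 - 1 + (s * (⟨x, η⟩ + s) + 1).re))
      = (x * η / 2 + (s * (⟨x, η⟩ + s) + 1).im) ^ 2 / 4 := by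
  simp only [Complex.add_re, Complex.mul_re, Complex.add_im, Complex.mul_im, Complex.one_re,
    Complex.one_im]
  ring

lemma sq_lt_mul_of_outside_edge {x η u v B β δ : ℝ} (hβ : 0 < β) (hβ1 : β ≤ 1 / 100) (hδ : 0 < δ)
    (hδβ : δ ≤ β * (1 / 100)) (hx2 : 4 - 4 * δ ≤ x ^ 2) (hη2 : η ^ 2 ≤ δ / 100)
    (hη2' : η ^ 2 ≤ β ^ 2 / 100) (hv2 : v ^ 2 ≤ β ^ 2 / 100) (hu : -δ ≤ u)
    (hB : β ≤ B) :
    (x * η / 2 + v) ^ 2 / 4 < B * (B + ((x ^ 2 - η ^ 2) / 4 - 1 + u)) := by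
  set R := (x ^ 2 - η ^ 2) / 4 - 1 + u with hR
  have hRlo : -(3 * δ) ≤ R := by linarith
  have hmono : β * (β + R) ≤ B * (B + R) :=
    mul_le_mul hB (by linarith) (by linarith) (by linarith)
  have hI : (x * η / 2 + v) ^ 2 / 4 ≤ x ^ 2 * η ^ 2 / 8 + v ^ 2 / 2 := by
    have := sq_nonneg (x * η / 2 - v)
    linarith
  have hxx : x ^ 2 ≤ 4 * R + 5 := by linarith
  have h1 : x ^ 2 * η ^ 2 ≤ (4 * R + 5) * (β ^ 2 / 100) := by gcongr; linarith
  have h2 : (4 * R + 9) * β ^ 2 / 800 < β * (β + R) := by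
    have h3 : β * (4 * R + 9) / 800 < β + R := by
      have h4 : -(3 * δ) * (1 - β / 200) ≤ R * (1 - β / 200) := by
        gcongr; linarith
      have h5 : 0 ≤ δ * β := by positivity
      linarith
    calc (4 * R + 9) * β ^ 2 / 800 = β * (β * (4 * R + 9) / 800) := by ring
      _ < _ := by gcongr
  linarith

/-- Outside the bulk, an approximate solution of `s (z + s) = -1` has small imaginary part. -/
lemma im_le_of_selfConsistent {x η t : ℝ} {s : ℂ} (ht : 0 < t) (ht1 : t ≤ 1 / 100)
    (hη : 0 < η) (hη1 : η ≤ t ^ 20) (hx : 2 - t ^ 20 ≤ x)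
    (he : ‖s * (⟨x, η⟩ + s) + 1‖ ≤ t ^ 20) : s.im ≤ t ^ 8 := by
  by_contra! hlt
  have key := sq_im_mul_sq_im_add x η s
  set e := s * (⟨x, η⟩ + s) + 1
  have h1 := abs_le.mp ((Complex.abs_re_le_norm e).trans he)
  have h2 := abs_le.mp ((Complex.abs_im_le_norm e).trans he)
  set u := e.re
  set v := e.im
  set b := s.im + η / 2
  have hb : t ^ 8 ≤ b := by simp only [b]; linarith
  have hb2 : t ^ 16 ≤ b ^ 2 := by
    calc t ^ 16 = (t ^ 8) ^ 2 := by ring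
      _ ≤ b ^ 2 := by gcongr
  set B := b ^ 2
  have ht4 : t ^ 4 ≤ 1 / 100 := by
    calc t ^ 4 ≤ (1 / 100) ^ 4 := by gcongr
      _ ≤ _ := by norm_num
  have h16 : 0 < t ^ 16 := by positivity
  have h20 : t ^ 20 ≤ t ^ 16 * (1 / 100) := by
    calc t ^ 20 = t ^ 16 * t ^ 4 := by ring
      _ ≤ _ := by gcongr
  have h16' : t ^ 16 ≤ 1 / 100 := by
    calc t ^ 16 ≤ (1 / 100) ^ 16 := by gcongr
      _ ≤ _ := by norm_num
  set β := t ^ 16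
  set δ := t ^ 20
  have hδ : 0 < δ := by positivity
  have hx2 : 4 - 4 * δ ≤ x ^ 2 := by nlinarith
  have hη2 : η ^ 2 ≤ δ / 100 := by nlinarith
  have hη2' : η ^ 2 ≤ β ^ 2 / 100 := by nlinarith
  have hv2 : v ^ 2 ≤ β ^ 2 / 100 := by nlinarith
  exact absurd key (sq_lt_mul_of_outside_edge h16 h16' hδ h20 hx2 hη2 hη2' hv2 h1.1 hb2).ne'

/-- Inside the bulk, an approximate solution of `s (z + s) = -1` has large imaginary part. -/
lemma le_im_of_selfConsistent {x η t : ℝ} {s : ℂ} (ht : 0 < t) (ht1 : t ≤ 1 / 100)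
    (hη : 0 < η) (hη1 : η ≤ t ^ 30) (hx : x = 2 - t ^ 20 / 2) (hs : 0 ≤ s.im)
    (he : ‖s * (⟨x, η⟩ + s) + 1‖ ≤ t ^ 30) : t ^ 11 ≤ s.im := by
  have key := sq_im_mul_sq_im_add x η s
  set e := s * (⟨x, η⟩ + s) + 1
  have h1 := abs_le.mp ((Complex.abs_re_le_norm e).trans he)
  set u := e.re
  set v := e.im
  have hb : 0 < s.im + η / 2 := by linarith
  set b := s.im + η / 2 with hbdef
  have hb2 : -((x ^ 2 - η ^ 2) / 4 - 1 + u) ≤ b ^ 2 := by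
    by_contra! hlt
    have : b ^ 2 * (b ^ 2 + ((x ^ 2 - η ^ 2) / 4 - 1 + u)) < 0 :=
      mul_neg_of_pos_of_neg (by positivity) (by linarith)
    have h' : 0 ≤ (x * η / 2 + v) ^ 2 / 4 := by positivity
    linarith
  have h30 : t ^ 30 ≤ t ^ 20 / 100 := by
    calc t ^ 30 = t ^ 20 * t ^ 10 := by ring
      _ ≤ t ^ 20 * (1 / 100) ^ 10 := by gcongr
      _ ≤ _ := by nlinarith [pow_pos ht 20]
  have h30' : t ^ 30 ≤ t ^ 11 := pow_le_pow_of_le_one ht.le (by linarith) (by norm_num)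
  have h22 : t ^ 22 ≤ t ^ 20 / 100 := by
    calc t ^ 22 = t ^ 20 * t ^ 2 := by ring
      _ ≤ t ^ 20 * (1 / 100) ^ 2 := by gcongr
      _ ≤ _ := by nlinarith [pow_pos ht 20]
  have h20 : t ^ 20 ≤ 1 := pow_le_one₀ ht.le (by linarith)
  by_contra! hlt
  have hb3 : b ≤ 2 * t ^ 11 := by rw [hbdef]; linarith
  have hb4 : b ^ 2 ≤ 4 * t ^ 22 := by
    calc b ^ 2 ≤ (2 * t ^ 11) ^ 2 := by gcongr
      _ = _ := by ring
  have hη2 : 0 ≤ η ^ 2 := by positivity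
  have : x ^ 2 = 4 - 2 * t ^ 20 + (t ^ 20) ^ 2 / 4 := by rw [hx]; ring
  nlinarith [pow_pos ht 20]

/-- An approximate solution of `s (z + s) = -1` in the upper half plane is bounded by one. -/
lemma norm_le_one_of_selfConsistent {z s : ℂ} (hs : 0 ≤ s.im)
    (he : ‖s * (z + s) + 1‖ < z.im) : ‖s‖ ≤ 1 := by
  by_contra! hlt
  set e := s * (z + s) + 1
  have h0 : Complex.normSq s * (z + s).im = (e * (starRingEnd ℂ) s).im + s.im := by
    simp only [e, Complex.normSq_apply, Complex.add_im, Complex.mul_im, Complex.add_re,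
      Complex.mul_re, Complex.one_re, Complex.one_im, Complex.conj_re, Complex.conj_im]
    ring
  have h1 : (e * (starRingEnd ℂ) s).im ≤ ‖e‖ * ‖s‖ := by
    refine (le_abs_self _).trans ((Complex.abs_im_le_norm _).trans ?_)
    rw [norm_mul, RCLike.norm_conj]
  rw [Complex.normSq_eq_norm_sq, Complex.add_im] at h0
  have h2 : 0 < z.im := (norm_nonneg _).trans_lt he
  have h3 : ‖e‖ * ‖s‖ < z.im * ‖s‖ := by gcongr
  have h4 : ‖s‖ ≤ ‖s‖ ^ 2 := by nlinarith
  have h5 : z.im * ‖s‖ ≤ z.im * ‖s‖ ^ 2 := by gcongr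
  have h6 : s.im * 1 ≤ s.im * ‖s‖ ^ 2 := by gcongr; linarith
  linarith

end SelfConsistent

section Stieltjes

variable {N : ℕ} {A : Matrix (Fin N) (Fin N) ℝ} {z : ℂ}

lemma stTrans_eq_sum (hA : A.IsHermitian) (hz : 0 < z.im) :
    stTrans N A z = (1 / (N : ℂ)) * ∑ j, 1 / ((hA.eigenvalues j : ℂ) - z) := by
  rw [stTrans, trace_resolventM hA hz]

lemma im_one_div_sub (l x η : ℝ) :
    (1 / ((l : ℂ) - ⟨x, η⟩)).im = η / ((l - x) ^ 2 + η ^ 2) := by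
  rw [one_div, Complex.inv_im, Complex.normSq_apply]
  simp [sq]

lemma im_stTrans (hA : A.IsHermitian) {x η : ℝ} (hη : 0 < η) :
    (stTrans N A ⟨x, η⟩).im = (1 / (N : ℝ)) * ∑ j, η / ((hA.eigenvalues j - x) ^ 2 + η ^ 2) := by
  rw [stTrans_eq_sum hA hη]
  have : (1 / (N : ℂ)) = ((1 / (N : ℝ) : ℝ) : ℂ) := by push_cast; rfl
  rw [this, Complex.im_ofReal_mul, Complex.im_sum]
  simp only [im_one_div_sub]

lemma im_stTrans_nonneg (hA : A.IsHermitian) (hz : 0 < z.im) : 0 ≤ (stTrans N A z).im := by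
  obtain ⟨x, η⟩ := z
  rw [im_stTrans hA hz]
  have : 0 < η := hz
  positivity

lemma norm_stTrans_sub_le (hA : A.IsHermitian) {x η : ℝ} (hη : 0 < η) :
    ‖stTrans N A ⟨x, η⟩ - stTrans N A ⟨x, 2 * η⟩‖ ≤ (stTrans N A ⟨x, η⟩).im := by
  have hη2 : 0 < 2 * η := by linarith
  rw [im_stTrans hA hη, stTrans_eq_sum hA hη, stTrans_eq_sum hA (z := ⟨x, 2 * η⟩) hη2, ← mul_sub,
    norm_mul, ← Finset.sum_sub_distrib]
  have : ‖1 / (N : ℂ)‖ = 1 / (N : ℝ) := by simp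
  rw [this]
  gcongr
  refine (norm_sum_le _ _).trans (Finset.sum_le_sum fun j _ => ?_)
  set l := hA.eigenvalues j
  have n1 : ‖(l : ℂ) - ⟨x, η⟩‖ ^ 2 = (l - x) ^ 2 + η ^ 2 := by
    rw [← Complex.normSq_eq_norm_sq, Complex.normSq_apply]; simp [sq]
  have n2 : ‖(l : ℂ) - ⟨x, 2 * η⟩‖ ^ 2 = (l - x) ^ 2 + (2 * η) ^ 2 := by
    rw [← Complex.normSq_eq_norm_sq, Complex.normSq_apply]; simp [sq]
  have p1 : 0 < ‖(l : ℂ) - ⟨x, η⟩‖ := by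
    by_contra! h
    nlinarith [norm_nonneg ((l : ℂ) - ⟨x, η⟩), sq_nonneg (l - x)]
  have p12 : ‖(l : ℂ) - ⟨x, η⟩‖ ≤ ‖(l : ℂ) - ⟨x, 2 * η⟩‖ := by
    apply le_of_sq_le_sq _ (norm_nonneg _)
    rw [n1, n2]; nlinarith
  have p2 := p1.trans_le p12
  have e : 1 / ((l : ℂ) - ⟨x, η⟩) - 1 / ((l : ℂ) - ⟨x, 2 * η⟩)
      = (-(η : ℂ) * I) / (((l : ℂ) - ⟨x, η⟩) * ((l : ℂ) - ⟨x, 2 * η⟩)) := by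
    rw [div_sub_div _ _ (norm_pos_iff.mp p1) (norm_pos_iff.mp p2)]
    congr 1
    apply Complex.ext <;> simp <;> ring
  rw [e, norm_div, norm_mul, norm_mul, norm_neg, Complex.norm_real, Complex.norm_I, mul_one,
    Real.norm_of_nonneg hη.le, ← n1, sq]
  gcongr

/-- The local law at `z`: every reciprocal diagonal entry of the resolvent is close to
`-z - s(z)`. -/
def LocalLaw (N : ℕ) (A : Matrix (Fin N) (Fin N) ℝ) (T : ℝ) (z : ℂ) : Prop :=
  ∀ k, ‖(resolventM N A z k k)⁻¹ + z + stTrans N A z‖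
    ≤ 8 * T / √(N * z.im) * (1 + √(stTrans N A z).im)

lemma LocalLaw.selfConsistent {T r : ℝ} (hN : 0 < N) (hA : A.IsHermitian) (hz : 0 < z.im)
    (h : LocalLaw N A T z) (hT : 0 ≤ T) (hr : 0 < r) (hr1 : r ≤ 1)
    (hq : r ≤ ‖z + stTrans N A z‖) (hρ : 8 * T / √(N * z.im) ≤ r / 8) :
    ‖stTrans N A z * (z + stTrans N A z) + 1‖ ≤ 4 * (8 * T / √(N * z.im)) / r := by
  set ρ := 8 * T / √(N * z.im) with hρdef
  have hρ0 : 0 ≤ ρ := by positivity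
  set s := stTrans N A z with hs
  set q := z + s with hqdef
  have hy : 0 ≤ s.im := im_stTrans_nonneg hA hz
  have hyq : s.im ≤ ‖q‖ := by
    refine le_trans ?_ ((le_abs_self _).trans (Complex.abs_im_le_norm q))
    rw [hqdef, Complex.add_im]; linarith
  have hq0 : 0 < ‖q‖ := hr.trans_le hq
  have hek : ∀ k, ‖(resolventM N A z k k)⁻¹ + z + s‖ ≤ 2 * ρ / r * ‖q‖ := by
    intro k
    refine (h k).trans ?_
    have h1 : √s.im ≤ ‖q‖ / r := by
      rw [Real.sqrt_le_left (by positivity), div_pow, le_div_iff₀ (by positivity)]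
      have : s.im * r ^ 2 ≤ ‖q‖ * r := by
        have : r ^ 2 ≤ r := by nlinarith
        exact mul_le_mul hyq this (by positivity) (by positivity)
      nlinarith
    have h2 : 1 ≤ ‖q‖ / r := by rwa [le_div_iff₀ hr, one_mul]
    calc ρ * (1 + √s.im) ≤ ρ * (‖q‖ / r + ‖q‖ / r) := by gcongr
      _ = _ := by ring
  have hρr : 2 * ρ / r ≤ 1 / 4 := by rw [div_le_iff₀ hr]; linarith
  have hterm : ∀ k, ‖resolventM N A z k k * q + 1‖ ≤ 4 * ρ / r := by
    intro k
    have hg := resolventM_diag_ne_zero hA hz (k := k)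
    set g := resolventM N A z k k
    have e1 : g * q + 1 = g * (g⁻¹ + z + s) := by
      rw [hqdef, mul_add, mul_add g (g⁻¹ + z), mul_add, mul_inv_cancel₀ hg]; ring
    have hgn : 0 < ‖g‖ := norm_pos_iff.mpr hg
    have h3 : ‖q‖ / 2 ≤ ‖g‖⁻¹ := by
      have h4 : ‖q‖ ≤ ‖g⁻¹ + z + s‖ + ‖g⁻¹‖ := by
        have : q = (g⁻¹ + z + s) - g⁻¹ := by rw [hqdef]; ring
        calc ‖q‖ = ‖(g⁻¹ + z + s) - g⁻¹‖ := by rw [← this]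
          _ ≤ _ := norm_sub_le _ _
      have h5 := hek k
      rw [norm_inv] at h4
      nlinarith
    have h6 : ‖g‖ * ‖q‖ ≤ 2 := by
      have := mul_le_mul_of_nonneg_left h3 hgn.le
      rw [mul_inv_cancel₀ hgn.ne'] at this
      linarith
    rw [e1, norm_mul]
    calc ‖g‖ * ‖g⁻¹ + z + s‖ ≤ ‖g‖ * (2 * ρ / r * ‖q‖) := by gcongr; exact hek k
      _ = 2 * ρ / r * (‖g‖ * ‖q‖) := by ring
      _ ≤ 2 * ρ / r * 2 := by gcongr
      _ = _ := by ring
  have hN0 : (N : ℂ) ≠ 0 := by exact_mod_cast hN.ne'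
  have e2 : s * q + 1 = (1 / (N : ℂ)) * ∑ k, (resolventM N A z k k * q + 1) := by
    rw [Finset.sum_add_distrib, ← Finset.sum_mul]
    simp only [Finset.sum_const, Finset.card_univ, Fintype.card_fin, nsmul_eq_mul, mul_one]
    have e3 : s = 1 / (N : ℂ) * ∑ k, resolventM N A z k k := rfl
    rw [e3]
    field_simp
  rw [e2, norm_mul]
  have hN' : (0 : ℝ) < N := by exact_mod_cast hN
  calc ‖1 / (N : ℂ)‖ * ‖∑ k, (resolventM N A z k k * q + 1)‖
      ≤ 1 / N * ∑ _k : Fin N, 4 * ρ / r := by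
        gcongr
        · simp
        · exact (norm_sum_le _ _).trans (Finset.sum_le_sum fun k _ => hterm k)
    _ = _ := by simp; field_simp

end Stieltjes

section Scales

variable {N : ℕ} {A : Matrix (Fin N) (Fin N) ℝ}

lemma localLaw_error_le {t Q : ℝ} {m : ℕ} (ht : 0 < t) (h : 1 ≤ t ^ (2 * (m + 1)) * Q) :
    8 * t⁻¹ / √Q ≤ 8 * t ^ m := by
  have hQ : 0 < Q := by
    by_contra! hQ
    have : t ^ (2 * (m + 1)) * Q ≤ 0 := mul_nonpos_of_nonneg_of_nonpos (by positivity) hQ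
    linarith
  have h1 : 1 ≤ t ^ (m + 1) * √Q := by
    rw [← Real.sqrt_one, ← Real.sqrt_sq (by positivity : 0 ≤ t ^ (m + 1)),
      ← Real.sqrt_mul (by positivity)]
    apply Real.sqrt_le_sqrt
    rw [← pow_mul, mul_comm (m + 1) 2]; exact h
  have hs : 0 < √Q := Real.sqrt_pos.mpr hQ
  rw [div_le_iff₀ hs]
  have h2 : t⁻¹ ≤ t ^ m * √Q := by
    rw [inv_le_iff_one_le_mul₀ ht]
    calc (1 : ℝ) ≤ t ^ (m + 1) * √Q := h1
      _ = _ := by ring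
  linarith

lemma pow_le_pow_mul_of_le {t : ℝ} (ht : 0 < t) (ht1 : t ≤ 1 / 100) (a b : ℕ) :
    t ^ (a + b) ≤ t ^ a * (1 / 100) ^ b := by
  rw [pow_add]; gcongr

lemma le_norm_add_of_im_nonneg {z s : ℂ} (hz : 0 ≤ z.im) (hs : 0 ≤ s.im) :
    z.im ≤ ‖z + s‖ ∧ s.im ≤ ‖z + s‖ := by
  have := (le_abs_self _).trans (Complex.abs_im_le_norm (z + s))
  rw [Complex.add_im] at this
  constructor <;> linarith

lemma LocalLaw.im_stTrans_le {t x η : ℝ} (hN : 0 < N) (hA : A.IsHermitian) (ht : 0 < t)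
    (ht1 : t ≤ 1 / 100) (hη : 0 < η) (hη1 : η ≤ t ^ 20) (hx : 2 - t ^ 20 ≤ x)
    (hQ : 1 ≤ t ^ 64 * (N * η)) (h : LocalLaw N A t⁻¹ ⟨x, η⟩) :
    (stTrans N A ⟨x, η⟩).im ≤ t ^ 8 := by
  by_contra! hlt
  have hy := im_stTrans_nonneg hA (z := ⟨x, η⟩) hη
  have hρ : 8 * t⁻¹ / √(N * η) ≤ 8 * t ^ 31 := localLaw_error_le ht hQ
  have hq := (le_norm_add_of_im_nonneg (z := ⟨x, η⟩) hη.le hy).2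
  have h8 : 0 < t ^ 8 := by positivity
  have e1 := pow_le_pow_mul_of_le ht ht1 8 23
  have e2 := pow_le_pow_mul_of_le ht ht1 20 3
  have h20 : 0 < t ^ 20 := by positivity
  have hsc := h.selfConsistent (r := t ^ 8) hN hA hη (by positivity) h8
    (pow_le_one₀ ht.le (by linarith)) (hlt.le.trans hq) (hρ.trans (by norm_num at e1; linarith))
  refine hlt.not_ge (im_le_of_selfConsistent ht ht1 hη hη1 hx (hsc.trans ?_))
  rw [div_le_iff₀ h8]
  calc 4 * (8 * t⁻¹ / √(N * η)) ≤ 4 * (8 * t ^ 31) := by gcongr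
    _ = 32 * t ^ (20 + 3) * t ^ 8 := by ring
    _ ≤ 32 * (t ^ 20 * (1 / 100) ^ 3) * t ^ 8 := by gcongr
    _ ≤ t ^ 20 * t ^ 8 := by gcongr; linarith

lemma LocalLaw.half_le_norm {t x η : ℝ} (hN : 0 < N) (hA : A.IsHermitian) (ht : 0 < t)
    (ht1 : t ≤ 1 / 100) (hη : t ^ 20 / 2 ≤ η)
    (hQ : 1 ≤ t ^ 400 * (N * η)) (h : LocalLaw N A t⁻¹ ⟨x, η⟩) :
    1 / 2 ≤ ‖(⟨x, η⟩ : ℂ) + stTrans N A ⟨x, η⟩‖ := by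
  have h20 : 0 < t ^ 20 := by positivity
  have h20' : t ^ 20 ≤ 1 := pow_le_one₀ ht.le (by linarith)
  have hη0 : 0 < η := by linarith
  have hy := im_stTrans_nonneg hA (z := ⟨x, η⟩) hη0
  have hρ : 8 * t⁻¹ / √(N * η) ≤ 8 * t ^ 199 := localLaw_error_le ht hQ
  have hq := (le_norm_add_of_im_nonneg (z := ⟨x, η⟩) hη0.le hy).1
  have e1 : t ^ 199 ≤ t ^ 40 * (1 / 100) ^ 3 :=
    (pow_le_pow_of_le_one ht.le (by linarith) (by norm_num)).trans
      (pow_le_pow_mul_of_le ht ht1 40 3)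
  have e2 : t ^ 40 = t ^ 20 * t ^ 20 := by ring
  have e3 : t ^ 40 ≤ t ^ 20 := by nlinarith
  have hsc := h.selfConsistent (r := t ^ 20 / 2) hN hA hη0 (by positivity) (by positivity)
    (by linarith) (hη.trans hq) (hρ.trans (by norm_num at e1; linarith))
  have hsc2 : ‖stTrans N A ⟨x, η⟩ * (⟨x, η⟩ + stTrans N A ⟨x, η⟩) + 1‖ ≤ t ^ 20 / 4 := by
    refine hsc.trans ?_
    rw [div_le_iff₀ (by positivity)]
    calc 4 * (8 * t⁻¹ / √(N * η)) ≤ 4 * (8 * t ^ 199) := by gcongr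
      _ ≤ 4 * (8 * (t ^ 40 * (1 / 100) ^ 3)) := by gcongr
      _ ≤ _ := by rw [e2]; nlinarith
  have h1 := norm_le_one_of_selfConsistent (z := ⟨x, η⟩) hy (by
    refine hsc2.trans_lt ?_; show _ < η; linarith)
  set s := stTrans N A ⟨x, η⟩
  set q := (⟨x, η⟩ : ℂ) + s
  have h2 : (1 : ℝ) ≤ ‖s * q + 1‖ + ‖s * q‖ := by
    have : (1 : ℂ) = (s * q + 1) - s * q := by ring
    calc (1 : ℝ) = ‖(1 : ℂ)‖ := by simp
      _ = ‖(s * q + 1) - s * q‖ := by rw [← this]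
      _ ≤ _ := norm_sub_le _ _
  rw [norm_mul] at h2
  have h3 : ‖s‖ * ‖q‖ ≤ 1 * ‖q‖ := by gcongr
  linarith

lemma LocalLaw.diag_bounds {t x η : ℝ} (hA : A.IsHermitian) (ht : 0 < t)
    (ht1 : t ≤ 1 / 100) (hη : 0 < η) (hη1 : η ≤ t ^ 20)
    (hQ : 1 ≤ t ^ 64 * (N * η)) (h : LocalLaw N A t⁻¹ ⟨x, η⟩)
    (hy : (stTrans N A ⟨x, η⟩).im ≤ t ^ 8)
    (hq : 1 / 4 ≤ ‖(⟨x, η⟩ : ℂ) + stTrans N A ⟨x, η⟩‖) (k : Fin N) :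
    ‖resolventM N A ⟨x, η⟩ k k‖ ≤ 8 ∧ (resolventM N A ⟨x, η⟩ k k).im ≤ t ^ 6 := by
  have hρ : 8 * t⁻¹ / √(N * η) ≤ 8 * t ^ 31 := localLaw_error_le ht hQ
  have hk := h k
  have hg := resolventM_diag_ne_zero hA (z := ⟨x, η⟩) hη (k := k)
  set g := resolventM N A ⟨x, η⟩ k k
  set s := stTrans N A ⟨x, η⟩
  have h8 : 0 < t ^ 8 := by positivity
  have h8' : t ^ 8 ≤ 1 := pow_le_one₀ ht.le (by linarith)
  have e1 := pow_le_pow_mul_of_le ht ht1 8 23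
  have e2 := pow_le_pow_mul_of_le ht ht1 8 12
  have e3 := pow_le_pow_mul_of_le ht ht1 6 2
  norm_num at e1 e2 e3
  have hek : ‖g⁻¹ + ⟨x, η⟩ + s‖ ≤ 16 * t ^ 31 := by
    refine hk.trans ?_
    have : √s.im ≤ 1 := by
      rw [← Real.sqrt_one]; exact Real.sqrt_le_sqrt (hy.trans h8')
    calc _ ≤ 8 * t ^ 31 * (1 + 1) := by gcongr
      _ = _ := by ring
  rw [add_assoc] at hek
  set q := (⟨x, η⟩ : ℂ) + s with hqd
  have hgn : 0 < ‖g‖ := norm_pos_iff.mpr hg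
  have h1 : 1 / 8 ≤ ‖g‖⁻¹ := by
    have : ‖q‖ ≤ ‖g⁻¹ + q‖ + ‖g⁻¹‖ := by
      calc ‖q‖ = ‖(g⁻¹ + q) - g⁻¹‖ := by congr 1; ring
        _ ≤ _ := norm_sub_le _ _
    rw [norm_inv] at this
    linarith
  have h2 : ‖g‖ ≤ 8 := by
    have := mul_le_mul_of_nonneg_left h1 hgn.le
    rw [mul_inv_cancel₀ hgn.ne'] at this
    linarith
  refine ⟨h2, ?_⟩
  have h3 : g.im = (-(g⁻¹).im) * ‖g‖ ^ 2 := by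
    rw [Complex.inv_im, Complex.normSq_eq_norm_sq]
    field_simp
  have h4 : -(g⁻¹).im ≤ 2 * t ^ 8 := by
    have := (neg_le_abs _).trans ((Complex.abs_im_le_norm (g⁻¹ + q)).trans hek)
    rw [hqd, Complex.add_im, Complex.add_im] at this
    have e : (⟨x, η⟩ : ℂ).im = η := rfl
    have hup := (le_abs_self _).trans ((Complex.abs_im_le_norm (g⁻¹ + q)).trans hek)
    rw [hqd, Complex.add_im, Complex.add_im, e] at hup
    rw [e] at this
    linarith
  rw [h3]
  calc (-(g⁻¹).im) * ‖g‖ ^ 2 ≤ (2 * t ^ 8) * 8 ^ 2 := by gcongr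
    _ ≤ t ^ 6 := by linarith [pow_pos ht 6]

/-- Consequences, near and outside the edge, of the local law on a dyadic sequence of scales. -/
lemma LocalLaw.bounds_of_scales {t x η : ℝ} {J : ℕ} (hN : 0 < N) (hA : A.IsHermitian)
    (ht : 0 < t) (ht1 : t ≤ 1 / 100) (hη : 0 < η) (hx : 2 - t ^ 20 ≤ x)
    (hQ : 1 ≤ t ^ 64 * (N * η)) (hQ' : 1 ≤ t ^ 500 * N) (hJ : J * t ^ 7 ≤ 1)
    (hJ1 : 2 ^ J * η ≤ t ^ 20) (hJ2 : t ^ 20 / 2 ≤ 2 ^ J * η)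
    (h : ∀ j ≤ J, LocalLaw N A t⁻¹ ⟨x, 2 ^ j * η⟩) :
    ∀ j ≤ J, (stTrans N A ⟨x, 2 ^ j * η⟩).im ≤ t ^ 8 ∧
      ∀ k, ‖resolventM N A ⟨x, 2 ^ j * η⟩ k k‖ ≤ 8 ∧
        (resolventM N A ⟨x, 2 ^ j * η⟩ k k).im ≤ t ^ 6 := by
  have hpos : ∀ j : ℕ, 0 < 2 ^ j * η := fun j => by positivity
  have hle : ∀ j ≤ J, 2 ^ j * η ≤ t ^ 20 := fun j hj => by
    refine le_trans ?_ hJ1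
    gcongr
    norm_num
  have hQj : ∀ j : ℕ, 1 ≤ t ^ 64 * (N * (2 ^ j * η)) := fun j => by
    refine hQ.trans ?_
    gcongr
    exact le_mul_of_one_le_left hη.le (one_le_pow₀ (by norm_num))
  have hy : ∀ j ≤ J, (stTrans N A ⟨x, 2 ^ j * η⟩).im ≤ t ^ 8 := fun j hj =>
    (h j hj).im_stTrans_le hN hA ht ht1 (hpos j) (hle j hj) hx (hQj j)
  have h8 : 0 < t ^ 8 := by positivity
  have h12 : t ^ 20 ≤ t ^ 8 := pow_le_pow_of_le_one ht.le (by linarith) (by norm_num)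
  have hNt : 1 ≤ t ^ 400 * (N * (2 ^ J * η)) := by
    have e1 : t ^ 500 ≤ t ^ 420 / 2 := by
      have := pow_le_pow_mul_of_le ht ht1 420 80
      have h420 : 0 < t ^ 420 := by positivity
      norm_num at this
      linarith
    calc (1 : ℝ) ≤ t ^ 500 * N := hQ'
      _ ≤ t ^ 420 / 2 * N := by gcongr
      _ = t ^ 400 * (N * (t ^ 20 / 2)) := by ring
      _ ≤ _ := by gcongr
  have hq : ∀ i ≤ J, 1 / 2 - i * (2 * t ^ 8) ≤
      ‖(⟨x, 2 ^ (J - i) * η⟩ : ℂ) + stTrans N A ⟨x, 2 ^ (J - i) * η⟩‖ := by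
    intro i
    induction i with
    | zero =>
      intro _
      simpa using (h J le_rfl).half_le_norm hN hA ht ht1 hJ2 hNt
    | succ i ih =>
      intro hi
      have ih' := ih (by omega)
      set j := J - (i + 1) with hj
      have hj1 : J - i = j + 1 := by omega
      have hdbl : (2 : ℝ) ^ (J - i) * η = 2 * (2 ^ j * η) := by rw [hj1]; ring
      rw [hdbl] at ih'
      have hs := norm_stTrans_sub_le hA (x := x) (hpos j)
      have hyj := hy j (by omega)
      have hlej := hle j (by omega)
      set s1 := stTrans N A ⟨x, 2 ^ j * η⟩
      set s2 := stTrans N A ⟨x, 2 * (2 ^ j * η)⟩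
      have hz : ‖(⟨x, 2 * (2 ^ j * η)⟩ : ℂ) - ⟨x, 2 ^ j * η⟩‖ ≤ 2 ^ j * η := by
        have : ∀ w : ℝ, (⟨x, 2 * w⟩ : ℂ) - ⟨x, w⟩ = (w : ℂ) * I := fun w => by
          apply Complex.ext
          · simp
          · simp; ring
        rw [this, norm_mul, Complex.norm_real, Complex.norm_I, mul_one,
          Real.norm_of_nonneg (hpos j).le]
      have htri : ‖(⟨x, 2 * (2 ^ j * η)⟩ : ℂ) + s2‖ ≤ ‖(⟨x, 2 ^ j * η⟩ : ℂ) + s1‖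
          + ‖(⟨x, 2 * (2 ^ j * η)⟩ : ℂ) - ⟨x, 2 ^ j * η⟩‖ + ‖s1 - s2‖ := by
        calc _ = ‖((⟨x, 2 ^ j * η⟩ : ℂ) + s1) + ((⟨x, 2 * (2 ^ j * η)⟩ : ℂ) - ⟨x, 2 ^ j * η⟩)
              - (s1 - s2)‖ := by congr 1; ring
          _ ≤ _ := (norm_sub_le _ _).trans (by gcongr; exact norm_add_le _ _)
      push_cast
      linarith
  intro j hj
  refine ⟨hy j hj, (h j hj).diag_bounds hA ht ht1 (hpos j) (hle j hj) (hQj j) (hy j hj) ?_⟩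
  have hqj := hq (J - j) (by omega)
  rw [show J - (J - j) = j by omega] at hqj
  refine le_trans ?_ hqj
  have h1 : ((J - j : ℕ) : ℝ) ≤ J := by exact_mod_cast Nat.sub_le _ _
  have h2 : ((J - j : ℕ) : ℝ) * (2 * t ^ 8) ≤ 2 * t := by
    calc _ ≤ (J : ℝ) * (2 * t ^ 8) := by gcongr
      _ = (J * t ^ 7) * (2 * t) := by ring
      _ ≤ 1 * (2 * t) := by gcongr
      _ = _ := by ring
  linarith

/-- The local law slightly inside the bulk produces many eigenvalues above `2 - t ^ 20`. -/
lemma LocalLaw.le_card_edge {t : ℝ} (hN : 0 < N) (hA : A.IsHermitian) (ht : 0 < t)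
    (ht1 : t ≤ 1 / 100) (hQ : 1 ≤ t ^ 500 * N)
    (h : LocalLaw N A t⁻¹ ⟨2 - t ^ 20 / 2, t ^ 60⟩) :
    N * t ^ 72 ≤ ((Finset.univ.filter fun j => 2 - t ^ 20 ≤ hA.eigenvalues j).card : ℝ) := by
  set x := 2 - t ^ 20 / 2 with hx
  set η := t ^ 60 with hηd
  have hη : 0 < η := by positivity
  have hy := im_stTrans_nonneg hA (z := ⟨x, η⟩) hη
  have hQ2 : 1 ≤ t ^ 440 * (N * η) := by
    calc (1 : ℝ) ≤ t ^ 500 * N := hQ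
      _ = _ := by rw [hηd]; ring
  have hρ : 8 * t⁻¹ / √(N * η) ≤ 8 * t ^ 219 := localLaw_error_le ht hQ2
  have hq := (le_norm_add_of_im_nonneg (z := ⟨x, η⟩) hη.le hy).1
  have e1 : t ^ 219 ≤ t ^ 90 * (1 / 100) ^ 3 :=
    (pow_le_pow_of_le_one ht.le (by linarith) (by norm_num)).trans
      (pow_le_pow_mul_of_le ht ht1 90 3)
  have e1' : t ^ 90 ≤ t ^ 60 := pow_le_pow_of_le_one ht.le (by linarith) (by norm_num)
  norm_num at e1
  have hsc := h.selfConsistent (r := t ^ 60) hN hA hη (by positivity) hη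
    (pow_le_one₀ ht.le (by linarith)) hq (hρ.trans (by linarith))
  have hlow : t ^ 11 ≤ (stTrans N A ⟨x, η⟩).im := by
    refine le_im_of_selfConsistent ht ht1 hη
      (pow_le_pow_of_le_one ht.le (by linarith) (by norm_num)) hx hy (hsc.trans ?_)
    rw [div_le_iff₀ hη]
    calc 4 * (8 * t⁻¹ / √(N * η)) ≤ 4 * (8 * t ^ 219) := by gcongr
      _ ≤ t ^ 90 := by linarith [pow_pos ht 90]
      _ = _ := by ring
  rw [im_stTrans hA hη] at hlow
  set S := Finset.univ.filter fun j => 2 - t ^ 20 ≤ hA.eigenvalues j with hS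
  have hN' : (0 : ℝ) < N := by exact_mod_cast hN
  have hterm : ∀ j, η / ((hA.eigenvalues j - x) ^ 2 + η ^ 2)
      ≤ (if 2 - t ^ 20 ≤ hA.eigenvalues j then 1 / η else 0) + 4 * t ^ 20 := by
    intro j
    have h20 : 0 < t ^ 20 := by positivity
    split_ifs with hc
    · have : η / ((hA.eigenvalues j - x) ^ 2 + η ^ 2) ≤ 1 / η := by
        rw [div_le_div_iff₀ (by positivity) hη]
        nlinarith [sq_nonneg (hA.eigenvalues j - x)]
      linarith
    · rw [zero_add, div_le_iff₀ (by positivity)]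
      have h1 : t ^ 20 / 2 ≤ x - hA.eigenvalues j := by rw [hx]; linarith
      have h2 : (t ^ 20 / 2) ^ 2 ≤ (hA.eigenvalues j - x) ^ 2 := by
        rw [← neg_sub, neg_sq]
        exact pow_le_pow_left₀ (by positivity) (by simpa using h1) 2
      have h3 : 4 * t ^ 20 * (t ^ 20 / 2) ^ 2 = η := by rw [hηd]; ring
      nlinarith [sq_nonneg η]
  have hsum : ∑ j, η / ((hA.eigenvalues j - x) ^ 2 + η ^ 2) ≤ S.card * (1 / η) + N * (4 * t ^ 20) := by
    refine (Finset.sum_le_sum fun j _ => hterm j).trans (le_of_eq ?_)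
    rw [Finset.sum_add_distrib, ← Finset.sum_filter, Finset.sum_const, Finset.sum_const]
    simp [hS]
  have h5 : t ^ 11 * N ≤ S.card * (1 / η) + N * (4 * t ^ 20) := by
    refine le_trans ?_ hsum
    rw [one_div, inv_mul_eq_div, le_div_iff₀ hN'] at hlow
    exact hlow
  have h6 : 4 * t ^ 20 ≤ t ^ 11 / 2 := by
    have := pow_le_pow_mul_of_le ht ht1 11 9
    norm_num at this
    linarith [pow_pos ht 11]
  have h7 : t ^ 12 ≤ t ^ 11 / 2 := by
    have := pow_le_pow_mul_of_le ht ht1 11 1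
    norm_num at this
    linarith [pow_pos ht 11]
  have h8 : N * t ^ 12 ≤ S.card * (1 / η) := by nlinarith
  rw [mul_one_div, le_div_iff₀ hη] at h8
  calc N * t ^ 72 = N * t ^ 12 * η := by rw [hηd]; ring
    _ ≤ _ := h8

end Scales

section Arctan

lemma sub_pow_three_div_le_arctan {x : ℝ} (hx : 0 ≤ x) : x - x ^ 3 / 3 ≤ Real.arctan x := by
  have hd : ∀ y : ℝ, HasDerivAt (fun y => Real.arctan y - (y - y ^ 3 / 3))
      (1 / (1 + y ^ 2) - (1 - y ^ 2)) y := fun y => by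
    have h3 : HasDerivAt (fun y : ℝ => y ^ 3 / 3) (y ^ 2) y := by
      have h := (hasDerivAt_pow 3 y).div_const 3
      rwa [show ((3 : ℕ) : ℝ) * y ^ (3 - 1) / 3 = y ^ 2 by norm_num] at h
    exact (Real.hasDerivAt_arctan y).sub ((hasDerivAt_id y).sub h3)
  have hm : Monotone fun y => Real.arctan y - (y - y ^ 3 / 3) := by
    refine monotone_of_deriv_nonneg (fun y => (hd y).differentiableAt) fun y => ?_
    rw [(hd y).deriv, sub_nonneg, le_div_iff₀ (by positivity)]
    nlinarith [sq_nonneg (y ^ 2)]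
  have := hm hx
  simp at this
  linarith

lemma arctan_le_self {x : ℝ} (hx : 0 ≤ x) : Real.arctan x ≤ x := by
  have hd : ∀ y : ℝ, HasDerivAt (fun y => y - Real.arctan y) (1 - 1 / (1 + y ^ 2)) y :=
    fun y => (hasDerivAt_id y).sub (Real.hasDerivAt_arctan y)
  have hm : Monotone fun y => y - Real.arctan y := by
    refine monotone_of_deriv_nonneg (fun y => (hd y).differentiableAt) fun y => ?_
    rw [(hd y).deriv, sub_nonneg, div_le_iff₀ (by positivity)]
    nlinarith [sq_nonneg y]
  have := hm hx
  simp at this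
  linarith

lemma abs_arctan_sub_le (x : ℝ) : |Real.arctan x - x| ≤ |x| ^ 3 / 3 := by
  rcases le_total 0 x with hx | hx
  · rw [abs_of_nonneg hx, abs_le]
    constructor
    · linarith [sub_pow_three_div_le_arctan hx]
    · have : 0 ≤ x ^ 3 := by positivity
      linarith [arctan_le_self hx]
  · have hx' : 0 ≤ -x := by linarith
    have h1 := sub_pow_three_div_le_arctan hx'
    have h2 := arctan_le_self hx'
    have : 0 ≤ (-x) ^ 3 := by positivity
    rw [Real.arctan_neg] at h1 h2
    rw [abs_of_nonpos hx, abs_le]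
    constructor <;> linarith

lemma arg_eq_arctan {w : ℂ} (hw : 0 < w.re) : Complex.arg w = Real.arctan (w.im / w.re) := by
  have h := abs_lt.mp (Complex.abs_arg_lt_pi_div_two_iff.mpr (Or.inl hw))
  rw [← Complex.tan_arg, Real.arctan_tan h.1 h.2]

lemma abs_arg_one_add_sub_im_le {w : ℂ} (hw : ‖w‖ ≤ 1 / 2) :
    |Complex.arg (1 + w) - w.im| ≤ 4 * ‖w‖ * |w.im| := by
  have hu := abs_le.mp ((Complex.abs_re_le_norm w).trans hw)
  have hv := Complex.abs_im_le_norm w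
  have hre : 1 / 2 ≤ 1 + w.re := by linarith
  have hre0 : 0 < 1 + w.re := by linarith
  rw [arg_eq_arctan (by simpa using hre0)]
  simp only [Complex.add_re, Complex.one_re, Complex.add_im, Complex.one_im, zero_add]
  set a := w.im / (1 + w.re)
  have ha : |a| ≤ 2 * |w.im| := by
    simp only [a, abs_div, abs_of_pos hre0]
    rw [div_le_iff₀ hre0]
    nlinarith [abs_nonneg w.im]
  have h1 := abs_arctan_sub_le a
  have h2 : |a - w.im| ≤ 2 * |w.im| * ‖w‖ := by
    have : a - w.im = - (a * w.re) := by simp only [a]; field_simp; ring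
    rw [this, abs_neg, abs_mul]
    gcongr
    exact Complex.abs_re_le_norm w
  have h3 : |a| ^ 3 / 3 ≤ 2 * ‖w‖ * |w.im| := by
    calc |a| ^ 3 / 3 ≤ (2 * |w.im|) ^ 3 / 3 := by gcongr
      _ = 8 / 3 * |w.im| * |w.im| * |w.im| := by ring
      _ ≤ 8 / 3 * (1 / 2) * ‖w‖ * |w.im| := by gcongr; exact hv.trans hw
      _ ≤ _ := by nlinarith [mul_nonneg (norm_nonneg w) (abs_nonneg w.im)]
  calc |Real.arctan a - w.im| ≤ |Real.arctan a - a| + |a - w.im| := abs_sub_le _ _ _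
    _ ≤ _ := by linarith

/-- A smooth monotone step function with fast decay of its tails. -/
def stepFn (u : ℝ) : ℝ := 1 / 2 + (2 * Real.arctan u - Real.arctan (u / 2)) / Real.pi

lemma stepFn_neg (u : ℝ) : stepFn (-u) = 1 - stepFn u := by
  simp only [stepFn, neg_div, Real.arctan_neg]; ring

lemma stepFn_le_one (u : ℝ) : stepFn u ≤ 1 := by
  rcases le_total u 0 with hu | hu
  · have hd : ∀ y : ℝ, HasDerivAt (fun y => 2 * Real.arctan y - Real.arctan (y / 2))
        (2 * (1 / (1 + y ^ 2)) - 1 / (1 + (y / 2) ^ 2) * (1 / 2)) y := fun y =>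
      ((Real.hasDerivAt_arctan y).const_mul 2).sub (((hasDerivAt_id y).div_const 2).arctan)
    have hm : Monotone fun y => 2 * Real.arctan y - Real.arctan (y / 2) := by
      refine monotone_of_deriv_nonneg (fun y => (hd y).differentiableAt) fun y => ?_
      rw [(hd y).deriv, sub_nonneg, mul_one_div, mul_one_div, div_div,
        div_le_div_iff₀ (by positivity) (by positivity)]
      nlinarith [sq_nonneg y]
    have := hm hu
    simp at this
    have : (2 * Real.arctan u - Real.arctan (u / 2)) / Real.pi ≤ 0 :=
      div_nonpos_of_nonpos_of_nonneg (by linarith) Real.pi_pos.le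
    rw [stepFn]; linarith
  rcases hu.eq_or_lt with rfl | hu
  · simp [stepFn]; norm_num
  · have hd : ∀ y : ℝ, HasDerivAt (fun y => 2 * Real.arctan y - Real.arctan (y * 2))
        (2 * (1 / (1 + y ^ 2)) - 1 / (1 + (y * 2) ^ 2) * (1 * 2)) y := fun y =>
      ((Real.hasDerivAt_arctan y).const_mul 2).sub (((hasDerivAt_id y).mul_const 2).arctan)
    have hm : Monotone fun y => 2 * Real.arctan y - Real.arctan (y * 2) := by
      refine monotone_of_deriv_nonneg (fun y => (hd y).differentiableAt) fun y => ?_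
      rw [(hd y).deriv, sub_nonneg, mul_one_div, div_mul_eq_mul_div,
        div_le_div_iff₀ (by positivity) (by positivity)]
      nlinarith [sq_nonneg y]
    have h0 := hm (inv_pos.mpr hu).le
    simp only [Real.arctan_zero, zero_mul, mul_zero, sub_zero] at h0
    rw [show u⁻¹ * 2 = (u / 2)⁻¹ by field_simp, Real.arctan_inv_of_pos hu,
      Real.arctan_inv_of_pos (by positivity)] at h0
    rw [stepFn]
    have : (2 * Real.arctan u - Real.arctan (u / 2)) / Real.pi ≤ 1 / 2 := by
      rw [div_le_iff₀ Real.pi_pos]; linarith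
    linarith

lemma stepFn_nonneg (u : ℝ) : 0 ≤ stepFn u := by
  have := stepFn_le_one (-u)
  rw [stepFn_neg] at this
  linarith

lemma one_sub_le_stepFn {u : ℝ} (hu : 0 < u) : 1 - 1 / u ^ 3 ≤ stepFn u := by
  have h1 := arctan_le_self (inv_pos.mpr hu).le
  have h2 := sub_pow_three_div_le_arctan (inv_pos.mpr (by positivity : 0 < u / 2)).le
  rw [Real.arctan_inv_of_pos hu] at h1
  rw [Real.arctan_inv_of_pos (by positivity)] at h2
  have h3 : (u / 2)⁻¹ = 2 * u⁻¹ := by field_simp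
  rw [h3] at h2
  have h4 : Real.pi / 2 - 8 / 3 * u⁻¹ ^ 3 ≤ 2 * Real.arctan u - Real.arctan (u / 2) := by
    have : (2 * u⁻¹) ^ 3 = 8 * u⁻¹ ^ 3 := by ring
    rw [this] at h2
    linarith
  have h5 : 1 / 2 - u⁻¹ ^ 3 ≤ (2 * Real.arctan u - Real.arctan (u / 2)) / Real.pi := by
    rw [le_div_iff₀ Real.pi_pos]
    have : 0 < u⁻¹ ^ 3 := by positivity
    nlinarith [Real.pi_gt_three]
  rw [stepFn, one_div, ← inv_pow]
  linarith

lemma stepFn_le_of_neg {u : ℝ} (hu : 0 < u) : stepFn (-u) ≤ 1 / u ^ 3 := by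
  rw [stepFn_neg]; linarith [one_sub_le_stepFn hu]

lemma one_div_pow_three_le {u L : ℝ} (hL : 1 ≤ L) (hu : L ≤ u) :
    1 / u ^ 3 ≤ 2 / L * (1 / (1 + u ^ 2)) := by
  have hL0 : 0 < L := by linarith
  have hu0 : 0 < u := by linarith
  rw [div_mul_div_comm, mul_one, div_le_div_iff₀ (by positivity) (by positivity)]
  have h1 : L * (1 + u ^ 2) ≤ u * (1 + u ^ 2) := by gcongr
  have h2 : 1 ≤ u ^ 2 := by nlinarith
  nlinarith

/-- Two decreasing sequences whose smoothed counting functions agree on a grid are close. -/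
lemma le_add_of_smoothed_counting {N : ℕ} {lam mu : Fin N → ℝ} (hlam : Antitone lam)
    (hmu : Antitone mu) {η L K : ℝ} (hη : 0 < η) (hL : 1 ≤ L) (hK : 8 * K ≤ L) (i : Fin N)
    (hi : 0 ≤ mu i)
    (h : ∀ m : ℕ, mu i ≤ m * η → m * η ≤ lam i →
      ∑ j, stepFn ((lam j - m * η) / η) ≤ ∑ j, stepFn ((mu j - m * η) / η) + 1 / 4 ∧
      ∑ j, 1 / (1 + ((lam j - m * η) / η) ^ 2) ≤ K ∧
      ∑ j, 1 / (1 + ((mu j - m * η) / η) ^ 2) ≤ K) :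
    lam i ≤ mu i + (2 * L + 1) * η := by
  by_contra! hlt
  have hL0 : 0 < L := by linarith
  have hLη : 0 < L * η := by positivity
  set m := ⌈(mu i + L * η) / η⌉₊ with hm
  have h1 : mu i + L * η ≤ m * η := by
    rw [← div_le_iff₀ hη]; exact Nat.le_ceil _
  have h2 : m * η ≤ lam i - L * η := by
    have : (m : ℝ) < (mu i + L * η) / η + 1 := Nat.ceil_lt_add_one (by positivity)
    have : m * η < ((mu i + L * η) / η + 1) * η := by gcongr
    rw [add_mul, div_mul_cancel₀ _ hη.ne'] at this
    linarith
  obtain ⟨h3, h4, h5⟩ := h m (by linarith) (by linarith)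
  have ind : ∑ j : Fin N, (if j ≤ i then (1 : ℝ) else 0) = i + 1 := by
    rw [← Finset.sum_filter, Finset.sum_const, nsmul_eq_mul, mul_one]
    have : (Finset.univ.filter fun j : Fin N => j ≤ i) = Finset.Iic i := by ext; simp
    rw [this, Fin.card_Iic]; push_cast; rfl
  have ind' : ∑ j : Fin N, (if j < i then (1 : ℝ) else 0) = i := by
    rw [← Finset.sum_filter, Finset.sum_const, nsmul_eq_mul, mul_one]
    have : (Finset.univ.filter fun j : Fin N => j < i) = Finset.Iio i := by ext; simp
    rw [this, Fin.card_Iio]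
  have low : (i + 1 : ℝ) - 2 / L * K ≤ ∑ j, stepFn ((lam j - m * η) / η) := by
    calc (i + 1 : ℝ) - 2 / L * K
        ≤ (i + 1 : ℝ) - 2 / L * ∑ j, 1 / (1 + ((lam j - m * η) / η) ^ 2) := by gcongr
      _ = ∑ j, ((if j ≤ i then (1 : ℝ) else 0)
            - 2 / L * (1 / (1 + ((lam j - m * η) / η) ^ 2))) := by
          rw [Finset.sum_sub_distrib, ind, Finset.mul_sum]
      _ ≤ _ := by
          refine Finset.sum_le_sum fun j _ => ?_
          split_ifs with hji
          · have hu : L ≤ (lam j - m * η) / η := by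
              rw [le_div_iff₀ hη]; linarith [hlam hji]
            linarith [one_sub_le_stepFn (hL0.trans_le hu), one_div_pow_three_le hL hu]
          · have := stepFn_nonneg ((lam j - m * η) / η)
            have : 0 ≤ 2 / L * (1 / (1 + ((lam j - m * η) / η) ^ 2)) := by positivity
            linarith
  have upp : ∑ j, stepFn ((mu j - m * η) / η) ≤ i + 2 / L * K := by
    calc ∑ j, stepFn ((mu j - m * η) / η)
        ≤ ∑ j, ((if j < i then (1 : ℝ) else 0)
            + 2 / L * (1 / (1 + ((mu j - m * η) / η) ^ 2))) := by
          refine Finset.sum_le_sum fun j _ => ?_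
          split_ifs with hji
          · have := stepFn_le_one ((mu j - m * η) / η)
            have : 0 ≤ 2 / L * (1 / (1 + ((mu j - m * η) / η) ^ 2)) := by positivity
            linarith
          · have hu : L ≤ -((mu j - m * η) / η) := by
              rw [← neg_div, le_div_iff₀ hη]; linarith [hmu (not_lt.mp hji)]
            have e1 := stepFn_le_of_neg (hL0.trans_le hu)
            have e2 := one_div_pow_three_le hL hu
            rw [neg_neg] at e1
            rw [neg_sq] at e2
            linarith
      _ = i + 2 / L * ∑ j, 1 / (1 + ((mu j - m * η) / η) ^ 2) := by
          rw [Finset.sum_add_distrib, ind', Finset.mul_sum]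
      _ ≤ _ := by gcongr
  have hKL : 2 / L * K ≤ 1 / 4 := by
    rw [div_mul_eq_mul_div, div_le_iff₀ hL0]; linarith
  linarith

end Arctan

section RankOne

variable {N : ℕ} {A A' : Matrix (Fin N) (Fin N) ℝ}

/-- The smoothed eigenvalue counting phase of a Hermitian matrix. -/
def phaseSum (hA : A.IsHermitian) (x η : ℝ) : ℝ :=
  ∑ j, Real.arctan ((hA.eigenvalues j - x) / η)

lemma sum_stepFn_eq (hA : A.IsHermitian) (x η : ℝ) :
    ∑ j, stepFn ((hA.eigenvalues j - x) / η)
      = N / 2 + (2 * phaseSum hA x η - phaseSum hA x (2 * η)) / Real.pi := by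
  simp only [stepFn, phaseSum, Finset.sum_add_distrib, ← Finset.sum_div, Finset.sum_sub_distrib,
    ← Finset.mul_sum]
  congr 1
  · simp
  · simp only [div_div, mul_comm η 2]

lemma shifted_factor (l x η : ℝ) : (l : ℂ) - ⟨x, η⟩ = -I * ⟨η, l - x⟩ := by
  apply Complex.ext <;> simp

lemma prod_eq_norm_mul_exp {ι : Type*} (s : Finset ι) (f : ι → ℂ) :
    ∏ j ∈ s, f j = ((∏ j ∈ s, ‖f j‖ : ℝ) : ℂ) * Complex.exp ((∑ j ∈ s, (f j).arg : ℝ) * I) := by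
  push_cast
  rw [Finset.sum_mul, Complex.exp_sum, ← Finset.prod_mul_distrib]
  refine Finset.prod_congr rfl fun j _ => ?_
  rw [Complex.norm_mul_exp_arg_mul_I]

lemma exists_int_of_prod_eq {ι : Type*} (s : Finset ι) (f g : ι → ℂ) (w : ℂ)
    (hg : ∀ j ∈ s, g j ≠ 0) (h : ∏ j ∈ s, g j = (∏ j ∈ s, f j) * w) :
    ∃ n : ℤ, ∑ j ∈ s, (g j).arg - ∑ j ∈ s, (f j).arg - w.arg = n * (2 * Real.pi) := by
  have hn : ∏ j ∈ s, ‖g j‖ = (∏ j ∈ s, ‖f j‖) * ‖w‖ := by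
    rw [← norm_prod, ← norm_prod, h, norm_mul]
  have hg0 : ((∏ j ∈ s, ‖g j‖ : ℝ) : ℂ) ≠ 0 := by
    rw [Complex.ofReal_ne_zero, Finset.prod_ne_zero_iff]
    exact fun j hj => norm_ne_zero_iff.mpr (hg j hj)
  rw [prod_eq_norm_mul_exp, prod_eq_norm_mul_exp] at h
  have h2 : ((∏ j ∈ s, ‖g j‖ : ℝ) : ℂ) * Complex.exp ((∑ j ∈ s, (g j).arg : ℝ) * I)
      = ((∏ j ∈ s, ‖g j‖ : ℝ) : ℂ) *
        (Complex.exp ((∑ j ∈ s, (f j).arg : ℝ) * I) * Complex.exp (w.arg * I)) := by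
    rw [h, hn]
    conv_lhs => rw [← Complex.norm_mul_exp_arg_mul_I w]
    push_cast; ring
  have h3 := mul_left_cancel₀ hg0 h2
  rw [← Complex.exp_add, Complex.exp_eq_exp_iff_exists_int] at h3
  obtain ⟨n, hn⟩ := h3
  refine ⟨n, ?_⟩
  have h4 := congrArg Complex.im hn
  simp at h4
  linarith

/-- A diagonal rank-one perturbation changes the phase by an argument of a resolvent entry. -/
lemma phaseSum_add_single (hA : A.IsHermitian) (hA'h : A'.IsHermitian) {k : Fin N} (d x : ℝ)
    (hA' : ∀ i j, A' i j = A i j + if i = k ∧ j = k then d else 0) {η : ℝ} (hη : 0 < η) :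
    phaseSum hA'h x η - phaseSum hA x η
      = (1 + d * resolventM N A ⟨x, η⟩ k k).arg := by
  set u : ℝ → Fin N → ℂ := fun t j => ⟨t, hA.eigenvalues j - x⟩ with hu
  set u' : ℝ → Fin N → ℂ := fun t j => ⟨t, hA'h.eigenvalues j - x⟩ with hu'
  set W : ℝ → ℂ := fun t => (∏ j, u' t j) / ∏ j, u t j with hW
  have hu0 : ∀ t, 0 < t → ∀ j, u t j ≠ 0 := fun t ht j h => by
    have := congrArg Complex.re h; simp [hu] at this; linarith
  have hu0' : ∀ t, 0 < t → ∀ j, u' t j ≠ 0 := fun t ht j h => by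
    have := congrArg Complex.re h; simp [hu'] at this; linarith
  have hWG : ∀ t, 0 < t → W t = 1 + d * resolventM N A ⟨x, t⟩ k k := by
    intro t ht
    have h := det_shiftM_add_single hA (z := ⟨x, t⟩) ht d hA'
    rw [det_shiftM hA, det_shiftM hA'h] at h
    simp only [shifted_factor, Finset.prod_mul_distrib] at h
    have hI : ∏ _j : Fin N, (-I) ≠ 0 := by simp
    rw [mul_assoc] at h
    have h := mul_left_cancel₀ hI h
    rw [hW]
    simp only
    rw [div_eq_iff (Finset.prod_ne_zero_iff.mpr fun j _ => hu0 t ht j), mul_comm]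
    exact h
  set F : ℝ → ℝ := fun t => phaseSum hA'h x t - phaseSum hA x t - (W t).arg with hF
  have hFint : ∀ t, 0 < t → ∃ n : ℤ, F t = n * (2 * Real.pi) := by
    intro t ht
    obtain ⟨n, hn⟩ := exists_int_of_prod_eq Finset.univ (u t) (u' t) (W t)
      (fun j _ => hu0' t ht j) (by
        rw [hW]; exact (mul_div_cancel₀ _ (Finset.prod_ne_zero_iff.mpr fun j _ => hu0 t ht j)).symm)
    refine ⟨n, ?_⟩
    rw [← hn]
    simp only [hF, phaseSum]
    have e1 : ∀ j, (u t j).arg = Real.arctan ((hA.eigenvalues j - x) / t) := fun j =>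
      arg_eq_arctan (w := u t j) ht
    have e2 : ∀ j, (u' t j).arg = Real.arctan ((hA'h.eigenvalues j - x) / t) := fun j =>
      arg_eq_arctan (w := u' t j) ht
    simp only [e1, e2]
  have hWs : ∀ t, 0 < t → W t ∈ Complex.slitPlane := by
    intro t ht
    rw [hWG t ht]
    by_cases hd : d = 0
    · simp [hd]
    · right
      have h1 := im_resolventM_diag hA (z := ⟨x, t⟩) ht k
      have h2 : 0 < (resolventM N A ⟨x, t⟩ k k).im := by
        rw [h1]
        have h3 : 0 < ‖resolventM N A ⟨x, t⟩ k k‖ ^ 2 := by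
          have := norm_pos_iff.mpr (resolventM_diag_ne_zero hA (z := ⟨x, t⟩) ht (k := k))
          positivity
        have h4 := Finset.single_le_sum (f := fun j => ‖resolventM N A ⟨x, t⟩ k j‖ ^ 2)
          (fun j _ => by positivity) (Finset.mem_univ k)
        exact mul_pos ht (h3.trans_le h4)
      simp [hd, h2.ne']
  have hucont : ∀ c : ℝ, Continuous fun t : ℝ => (⟨t, c⟩ : ℂ) := fun c => by
    have : (fun t : ℝ => (⟨t, c⟩ : ℂ)) = fun t : ℝ => (t : ℂ) + c * I := by
      ext t; apply Complex.ext <;> simp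
    rw [this]; fun_prop
  have hWc : ContinuousOn W (Set.Ioi 0) := by
    apply ContinuousOn.div
    · exact (continuous_finsetProd _ fun j _ => hucont _).continuousOn
    · exact (continuous_finsetProd _ fun j _ => hucont _).continuousOn
    · exact fun t ht => Finset.prod_ne_zero_iff.mpr fun j _ => hu0 t ht j
  have hphase : ∀ {B : Matrix (Fin N) (Fin N) ℝ} (hB : B.IsHermitian),
      ContinuousOn (fun t => phaseSum hB x t) (Set.Ioi 0) := fun hB => by
    unfold phaseSum
    refine continuousOn_finsetSum _ fun j _ => ?_
    refine Real.continuous_arctan.comp_continuousOn ?_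
    exact continuousOn_const.div continuousOn_id fun t ht => (ne_of_gt ht)
  have hFc : ContinuousOn F (Set.Ioi 0) := by
    refine ((hphase hA'h).sub (hphase hA)).sub fun t ht => ?_
    exact (Complex.continuousAt_arg (hWs t ht)).comp_continuousWithinAt (hWc t ht)
  have hlim : Filter.Tendsto F Filter.atTop (nhds 0) := by
    have hph : ∀ {B : Matrix (Fin N) (Fin N) ℝ} (hB : B.IsHermitian),
        Filter.Tendsto (fun t => phaseSum hB x t) Filter.atTop (nhds 0) := fun hB => by
      unfold phaseSum
      rw [← Finset.sum_const_zero (s := (Finset.univ : Finset (Fin N)))]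
      refine tendsto_finsetSum _ fun j _ => ?_
      rw [← Real.arctan_zero]
      exact (Real.continuous_arctan.tendsto 0).comp
        (tendsto_const_nhds.div_atTop Filter.tendsto_id)
    have hWl : Filter.Tendsto W Filter.atTop (nhds 1) := by
      rw [tendsto_iff_norm_sub_tendsto_zero]
      have : Filter.Tendsto (fun t : ℝ => |d| / t) Filter.atTop (nhds 0) :=
        tendsto_const_nhds.div_atTop Filter.tendsto_id
      refine squeeze_zero' (Filter.Eventually.of_forall fun t => norm_nonneg _) ?_ this
      filter_upwards [Filter.eventually_gt_atTop 0] with t ht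
      rw [hWG t ht, add_sub_cancel_left, norm_mul, Complex.norm_real, Real.norm_eq_abs,
        div_eq_mul_one_div]
      gcongr
      exact norm_resolventM_diag_le hA (z := ⟨x, t⟩) ht k
    have harg := (Complex.continuousAt_arg (x := 1) Complex.one_mem_slitPlane).tendsto.comp hWl
    rw [Complex.arg_one] at harg
    simpa using ((hph hA'h).sub (hph hA)).sub harg
  have hF0 : F η = 0 := by
    by_contra hne
    obtain ⟨n, hn⟩ := hFint η hη
    have hn0 : n ≠ 0 := by rintro rfl; simp at hn; exact hne hn
    have habs : 1 ≤ |F η| := by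
      rw [hn, abs_mul, abs_of_pos Real.two_pi_pos, ← Int.cast_abs]
      have : (1 : ℝ) ≤ (|n| : ℤ) := by exact_mod_cast Int.one_le_abs hn0
      nlinarith [Real.pi_gt_three]
    obtain ⟨b, hb1, hb2⟩ := ((hlim.eventually (Metric.ball_mem_nhds 0 one_pos)).and
      (Filter.eventually_ge_atTop η)).exists
    have hb1 : |F b| < 1 := by simpa using hb1
    have hcont : ContinuousOn (fun t => |F t|) (Set.Icc η b) :=
      (hFc.mono fun t ht => hη.trans_le ht.1).abs
    obtain ⟨c, hc, hc1⟩ := intermediate_value_Icc' hb2 hcont ⟨hb1.le, habs⟩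
    obtain ⟨p, hp⟩ := hFint c (hη.trans_le hc.1)
    simp only [hp] at hc1
    rw [abs_mul, abs_of_pos Real.two_pi_pos, ← Int.cast_abs] at hc1
    rcases eq_or_ne p 0 with rfl | hp0
    · simp at hc1
    · have : (1 : ℝ) ≤ (|p| : ℤ) := by exact_mod_cast Int.one_le_abs hp0
      nlinarith [Real.pi_gt_three]
  rw [← hWG η hη]
  have : phaseSum hA'h x η - phaseSum hA x η - (W η).arg = 0 := hF0
  linarith

end RankOne

section Comparison

variable {N : ℕ}

lemma evalsDesc_eq {A : Matrix (Fin N) (Fin N) ℝ} (hA : A.IsHermitian) (i : Fin N) :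
    evalsDesc hA i = hA.eigenvalues ((Tuple.sort fun j => - hA.eigenvalues j) i) := by
  simp [evalsDesc]

lemma evalsDesc_antitone {A : Matrix (Fin N) (Fin N) ℝ} (hA : A.IsHermitian) :
    Antitone (evalsDesc hA) := by
  intro i j hij
  have := Tuple.monotone_sort (fun j => - hA.eigenvalues j) hij
  simp only [Function.comp_apply] at this
  rw [evalsDesc_eq, evalsDesc_eq]
  linarith

lemma sum_evalsDesc {A : Matrix (Fin N) (Fin N) ℝ} (hA : A.IsHermitian) (f : ℝ → ℝ) :
    ∑ j, f (evalsDesc hA j) = ∑ j, f (hA.eigenvalues j) := by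
  simp only [evalsDesc_eq]
  exact Equiv.sum_comp (Tuple.sort fun j => - hA.eigenvalues j) fun j => f (hA.eigenvalues j)

lemma le_evalsDesc_of_le_card {A : Matrix (Fin N) (Fin N) ℝ} (hA : A.IsHermitian) {c : ℝ}
    {i : Fin N}
    (h : (i + 1 : ℝ) ≤ ((Finset.univ.filter fun j => c ≤ hA.eigenvalues j).card : ℝ)) :
    c ≤ evalsDesc hA i := by
  by_contra! hlt
  have h1 : ((Finset.univ.filter fun j => c ≤ hA.eigenvalues j).card : ℝ)
      = ∑ j, (fun y => if c ≤ y then (1 : ℝ) else 0) (hA.eigenvalues j) := by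
    simp
  rw [h1, ← sum_evalsDesc hA (fun y => if c ≤ y then (1 : ℝ) else 0)] at h
  have h2 : ∑ j, (fun y => if c ≤ y then (1 : ℝ) else 0) (evalsDesc hA j)
      ≤ ∑ j : Fin N, (if j < i then (1 : ℝ) else 0) := by
    refine Finset.sum_le_sum fun j _ => ?_
    by_cases hj : j < i
    · simp only [hj, if_true]; split_ifs <;> norm_num
    · have := evalsDesc_antitone hA (not_lt.mp hj)
      simp only [hj, if_false]
      rw [if_neg (not_le.mpr (this.trans_lt hlt))]
  have h3 : ∑ j : Fin N, (if j < i then (1 : ℝ) else 0) = i := by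
    rw [← Finset.sum_filter, Finset.sum_const, nsmul_eq_mul, mul_one]
    have : (Finset.univ.filter fun j : Fin N => j < i) = Finset.Iio i := by ext; simp
    rw [this, Fin.card_Iio]
  linarith

lemma sum_lorentzian_eq {A : Matrix (Fin N) (Fin N) ℝ} (hA : A.IsHermitian) (hN : 0 < N) {x η : ℝ}
    (hη : 0 < η) :
    ∑ j, 1 / (1 + ((hA.eigenvalues j - x) / η) ^ 2) = N * η * (stTrans N A ⟨x, η⟩).im := by
  have hN' : (0 : ℝ) < N := by exact_mod_cast hN
  rw [im_stTrans hA hη, mul_comm (N : ℝ) η, mul_assoc, ← mul_assoc (N : ℝ),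
    mul_one_div_cancel hN'.ne', one_mul, Finset.mul_sum]
  refine Finset.sum_congr rfl fun j _ => ?_
  have : 0 < (hA.eigenvalues j - x) ^ 2 + η ^ 2 := by positivity
  field_simp
  ring

/-- The deterministic part of the comparison between two matrices differing on the diagonal. -/
lemma abs_evalsDesc_sub_le {t η : ℝ} {J M : ℕ} {A : ℕ → Matrix (Fin N) (Fin N) ℝ}
    (hN : 0 < N) (hA : ∀ k, (A k).IsHermitian) {d : Fin N → ℝ}
    (hstep : ∀ k : Fin N, ∀ i j, A (k + 1) i j = A k i j + if i = k ∧ j = k then d k else 0)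
    (ht : 0 < t) (ht1 : t ≤ 1 / 100) (hη : 0 < η)
    (hQ : 1 ≤ t ^ 64 * (N * η)) (hQ' : 1 ≤ t ^ 500 * N) (hJ0 : 1 ≤ J) (hJ : J * t ^ 7 ≤ 1)
    (hJ1 : 2 ^ J * η ≤ t ^ 20) (hJ2 : t ^ 20 / 2 ≤ 2 ^ J * η)
    (hLL : ∀ k ≤ N, ∀ m ≤ M, ∀ j ≤ J, LocalLaw N (A k) t⁻¹ ⟨m * η, 2 ^ j * η⟩)
    (hedge0 : LocalLaw N (A 0) t⁻¹ ⟨2 - t ^ 20 / 2, t ^ 60⟩)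
    (hedge1 : LocalLaw N (A N) t⁻¹ ⟨2 - t ^ 20 / 2, t ^ 60⟩)
    (hd : ∀ k, d k ^ 2 ≤ 2 * t⁻¹ ^ 2 / N)
    (hmart : ∀ m ≤ M, ∀ j ≤ 1,
      |∑ k : Fin N, d k * min (resolventM N (A k) ⟨m * η, 2 ^ j * η⟩ k k).im (t ^ 6)| ≤ t)
    (hM0 : ∀ j, (hA 0).eigenvalues j ≤ M * η) (hM1 : ∀ j, (hA N).eigenvalues j ≤ M * η)
    (i : Fin N) (hi : (i + 1 : ℝ) ≤ N * t ^ 72) :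
    |evalsDesc (hA N) i - evalsDesc (hA 0) i| ≤ (16 * (N * η) + 1) * η := by
  have hN' : (0 : ℝ) < N := by exact_mod_cast hN
  have e0 := le_evalsDesc_of_le_card (hA 0) (hi.trans (hedge0.le_card_edge hN (hA 0) ht ht1 hQ'))
  have e1 := le_evalsDesc_of_le_card (hA N) (hi.trans (hedge1.le_card_edge hN (hA N) ht ht1 hQ'))
  have h20 : t ^ 20 ≤ 1 := pow_le_one₀ ht.le (by linarith)
  have h8 : t ^ 8 ≤ 1 := pow_le_one₀ ht.le (by linarith)
  have hbd : ∀ k ≤ N, ∀ m ≤ M, 2 - t ^ 20 ≤ m * η → ∀ j ≤ J,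
      (stTrans N (A k) ⟨m * η, 2 ^ j * η⟩).im ≤ t ^ 8 ∧
      ∀ l, ‖resolventM N (A k) ⟨m * η, 2 ^ j * η⟩ l l‖ ≤ 8 ∧
        (resolventM N (A k) ⟨m * η, 2 ^ j * η⟩ l l).im ≤ t ^ 6 := fun k hk m hm hx =>
    LocalLaw.bounds_of_scales hN (hA k) ht ht1 hη hx hQ hQ' hJ hJ1 hJ2 (hLL k hk m hm)
  have hphase : ∀ m ≤ M, 2 - t ^ 20 ≤ m * η → ∀ j ≤ 1,
      |phaseSum (hA N) (m * η) (2 ^ j * η) - phaseSum (hA 0) (m * η) (2 ^ j * η)| ≤ 2 * t := by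
    intro m hm hx j hj
    have hηj : 0 < 2 ^ j * η := by positivity
    set g : Fin N → ℂ := fun k => resolventM N (A k) ⟨m * η, 2 ^ j * η⟩ k k with hg
    have htel : phaseSum (hA N) (m * η) (2 ^ j * η) - phaseSum (hA 0) (m * η) (2 ^ j * η)
        = ∑ k : Fin N, (1 + d k * g k).arg := by
      rw [← Finset.sum_range_sub fun k => phaseSum (hA k) (m * η) (2 ^ j * η), Finset.sum_range]
      refine Finset.sum_congr rfl fun k _ => ?_
      exact phaseSum_add_single (hA k) (hA (k + 1)) (d k) (m * η) (hstep k) hηj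
    have hterm : ∀ k : Fin N, |(1 + d k * g k).arg - d k * min (g k).im (t ^ 6)|
        ≤ 64 * t ^ 4 / N := by
      intro k
      obtain ⟨hg1, hg2⟩ := (hbd k k.2.le m hm hx j (hj.trans hJ0)).2 k
      have hg3 := im_resolventM_diag_nonneg (hA k) (z := ⟨m * η, 2 ^ j * η⟩) hηj k
      change ‖g k‖ ≤ 8 at hg1
      change (g k).im ≤ t ^ 6 at hg2
      change 0 ≤ (g k).im at hg3
      rw [min_eq_left hg2]
      have hw : ‖(d k : ℂ) * g k‖ = |d k| * ‖g k‖ := by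
        rw [norm_mul, Complex.norm_real, Real.norm_eq_abs]
      have hsmall : ‖(d k : ℂ) * g k‖ ≤ 1 / 2 := by
        rw [hw]
        have h1 : |d k| ≤ 1 / 16 := by
          apply abs_le_of_sq_le_sq _ (by norm_num)
          refine (hd k).trans ?_
          have h2 : 512 ≤ t ^ 2 * N := by
            have h3 : t ^ 500 ≤ t ^ 2 * (1 / 100) ^ 3 :=
              (pow_le_pow_of_le_one ht.le (by linarith) (by norm_num)).trans
                (pow_le_pow_mul_of_le ht ht1 2 3)
            have h4 : 1 ≤ t ^ 2 * (1 / 100) ^ 3 * N := hQ'.trans (by gcongr)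
            linarith
          rw [div_le_iff₀ hN', inv_pow, ← div_eq_mul_inv, div_le_iff₀ (by positivity)]
          nlinarith
        nlinarith [norm_nonneg (g k), abs_nonneg (d k)]
      have h1 := abs_arg_one_add_sub_im_le hsmall
      rw [Complex.im_ofReal_mul, abs_mul, hw, abs_of_nonneg hg3] at h1
      refine h1.trans ?_
      calc 4 * (|d k| * ‖g k‖) * (|d k| * (g k).im)
          = 4 * ‖g k‖ * (g k).im * d k ^ 2 := by rw [← sq_abs (d k)]; ring
        _ ≤ 4 * 8 * t ^ 6 * (2 * t⁻¹ ^ 2 / N) := by gcongr; exact hd k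
        _ = 64 * t ^ 4 / N := by field_simp; ring
    have hsum : |∑ k : Fin N, (1 + d k * g k).arg - ∑ k : Fin N, d k * min (g k).im (t ^ 6)|
        ≤ 64 * t ^ 4 := by
      rw [← Finset.sum_sub_distrib]
      calc _ ≤ ∑ _k : Fin N, 64 * t ^ 4 / N :=
            (Finset.abs_sum_le_sum_abs _ _).trans (Finset.sum_le_sum fun k _ => hterm k)
        _ = _ := by simp; field_simp
    have hm2 : |∑ k : Fin N, d k * min (g k).im (t ^ 6)| ≤ t := hmart m hm j hj
    have ht4 : 64 * t ^ 4 ≤ t := by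
      have := pow_le_pow_mul_of_le ht ht1 1 3
      norm_num at this
      linarith
    rw [htel]
    rw [abs_le] at *
    constructor <;> linarith
  have hstepsum : ∀ m ≤ M, 2 - t ^ 20 ≤ m * η →
      |∑ j, stepFn (((hA N).eigenvalues j - m * η) / η)
        - ∑ j, stepFn (((hA 0).eigenvalues j - m * η) / η)| ≤ 1 / 4 := by
    intro m hm hx
    have p1 := hphase m hm hx 0 (by norm_num)
    have p2 := hphase m hm hx 1 le_rfl
    simp only [pow_zero, one_mul, pow_one] at p1 p2
    rw [sum_stepFn_eq, sum_stepFn_eq, add_sub_add_left_eq_sub, ← sub_div, abs_div,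
      abs_of_pos Real.pi_pos, div_le_iff₀ Real.pi_pos]
    rw [abs_le] at *
    constructor <;> linarith [Real.pi_gt_three]
  have hlor : ∀ k ≤ N, ∀ m ≤ M, 2 - t ^ 20 ≤ m * η →
      ∑ j, 1 / (1 + (((hA k).eigenvalues j - m * η) / η) ^ 2) ≤ N * η := by
    intro k hk m hm hx
    rw [sum_lorentzian_eq (hA k) hN hη]
    have := (hbd k hk m hm hx 0 (Nat.zero_le _)).1
    simp only [pow_zero, one_mul] at this
    exact mul_le_of_le_one_right (by positivity) (this.trans h8)
  have hL : 1 ≤ 8 * (N * η) := by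
    have : t ^ 64 * (N * η) ≤ 1 * (N * η) := by
      gcongr; exact pow_le_one₀ ht.le (by linarith)
    linarith
  have hmle : ∀ {B : Matrix (Fin N) (Fin N) ℝ} (hB : B.IsHermitian), (∀ j, hB.eigenvalues j ≤ M * η) →
      ∀ m : ℕ, m * η ≤ evalsDesc hB i → m ≤ M := by
    intro B hB h m hm
    rw [evalsDesc_eq] at hm
    have := hm.trans (h _)
    exact_mod_cast le_of_mul_le_mul_right this hη
  have hup := le_add_of_smoothed_counting (evalsDesc_antitone (hA N)) (evalsDesc_antitone (hA 0))
    hη hL le_rfl i (by linarith) fun m hm1 hm2 => by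
      have hm := hmle (hA N) hM1 m hm2
      have hx := e0.trans hm1
      rw [sum_evalsDesc (hA N) fun y => stepFn ((y - m * η) / η),
        sum_evalsDesc (hA 0) fun y => stepFn ((y - m * η) / η),
        sum_evalsDesc (hA N) fun y => 1 / (1 + ((y - m * η) / η) ^ 2),
        sum_evalsDesc (hA 0) fun y => 1 / (1 + ((y - m * η) / η) ^ 2)]
      refine ⟨?_, hlor N le_rfl m hm hx, hlor 0 (Nat.zero_le _) m hm hx⟩
      linarith [(abs_le.mp (hstepsum m hm hx)).2]
  have hlo := le_add_of_smoothed_counting (evalsDesc_antitone (hA 0)) (evalsDesc_antitone (hA N))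
    hη hL le_rfl i (by linarith) fun m hm1 hm2 => by
      have hm := hmle (hA 0) hM0 m hm2
      have hx := e1.trans hm1
      rw [sum_evalsDesc (hA N) fun y => stepFn ((y - m * η) / η),
        sum_evalsDesc (hA 0) fun y => stepFn ((y - m * η) / η),
        sum_evalsDesc (hA N) fun y => 1 / (1 + ((y - m * η) / η) ^ 2),
        sum_evalsDesc (hA 0) fun y => 1 / (1 + ((y - m * η) / η) ^ 2)]
      refine ⟨?_, hlor 0 (Nat.zero_le _) m hm hx, hlor N le_rfl m hm hx⟩
      linarith [(abs_le.mp (hstepsum m hm hx)).1]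
  rw [abs_le]
  constructor <;> linarith

end Comparison

section HansonWright

lemma lintegral_exp_sq_sub_one_le {a : ℝ} (ha : |a| ≤ 1 / 8) :
    ∫⁻ x, ENNReal.ofReal (Real.exp (a * (x ^ 2 - 1))) ∂(gaussianReal 0 1)
      ≤ ENNReal.ofReal (Real.exp (2 * a ^ 2)) := by
  obtain ⟨ha1, ha2⟩ := abs_le.mp ha
  rw [gaussianReal_of_var_ne_zero _ one_ne_zero,
    lintegral_withDensity_eq_lintegral_mul _ (measurable_gaussianPDF 0 1) (by fun_prop)]
  have h1 : ∀ x : ℝ, (gaussianPDF 0 1 * fun x => ENNReal.ofReal (Real.exp (a * (x ^ 2 - 1)))) x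
      = ENNReal.ofReal ((√(2 * Real.pi))⁻¹ * Real.exp (-a) * Real.exp (-(1 / 2 - a) * x ^ 2)) := by
    intro x
    rw [Pi.mul_apply, gaussianPDF, gaussianPDFReal, ← ENNReal.ofReal_mul (by positivity)]
    simp only [NNReal.coe_one, mul_one, sub_zero]
    rw [mul_assoc, mul_assoc, ← Real.exp_add, ← Real.exp_add]
    congr 3
    ring
  simp_rw [h1]
  rw [← ofReal_integral_eq_lintegral_ofReal
    ((integrable_exp_neg_mul_sq (by linarith)).const_mul _) (ae_of_all _ fun x => by positivity),
    integral_const_mul, integral_gaussian]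
  apply ENNReal.ofReal_le_ofReal
  have h2 : 0 < 1 - 2 * a := by linarith
  have h3 : √(Real.pi / (1 / 2 - a)) = √(2 * Real.pi) * (√(1 - 2 * a))⁻¹ := by
    rw [← Real.sqrt_inv, ← Real.sqrt_mul (by positivity)]
    congr 1; field_simp
  have h4 : (√(1 - 2 * a))⁻¹ ≤ Real.exp (a + 2 * a ^ 2) := by
    rw [inv_le_comm₀ (by positivity) (by positivity), ← Real.exp_neg]
    apply Real.le_sqrt_of_sq_le
    rw [← Real.exp_nat_mul]
    have h5 : -(2 * a) - (2 * a) ^ 2 ≤ Real.log (1 - 2 * a) := by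
      have hu : |2 * a| ≤ 1 / 4 := by rw [abs_mul, abs_two]; linarith
      have h6 := Real.abs_log_sub_add_sum_range_le (hu.trans_lt (by norm_num)) 2
      have h7 : |2 * a| ^ (2 + 1) / (1 - |2 * a|) ≤ (2 * a) ^ 2 / 2 := by
        rw [div_le_iff₀ (by linarith), ← sq_abs (2 * a)]
        nlinarith [sq_nonneg |2 * a|, abs_nonneg (2 * a),
          mul_nonneg (sq_nonneg |2 * a|) (sub_nonneg.mpr hu)]
      rw [Finset.sum_range_succ, Finset.sum_range_one] at h6
      have h8 := (abs_le.mp (h6.trans h7)).1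
      norm_num at h8
      linarith
    rw [← Real.exp_log h2]
    apply Real.exp_le_exp.mpr
    push_cast
    linarith
  rw [h3]
  calc _ = Real.exp (-a) * (√(1 - 2 * a))⁻¹ := by field_simp
    _ ≤ Real.exp (-a) * Real.exp (a + 2 * a ^ 2) := by gcongr
    _ = _ := by rw [← Real.exp_add]; ring_nf

variable {N : ℕ} {B : Matrix (Fin N) (Fin N) ℝ}

lemma sum_sq_entries_eq (hB : B.IsHermitian) :
    ∑ i, ∑ j, B i j ^ 2 = ∑ l, hB.eigenvalues l ^ 2 := by
  have h1 : ∑ i, ∑ j, B i j ^ 2 = (B * B).trace := by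
    simp only [Matrix.trace, Matrix.diag, Matrix.mul_apply]
    refine Finset.sum_congr rfl fun i _ => Finset.sum_congr rfl fun j _ => ?_
    rw [← hB.apply i j, star_trivial, sq]
  rw [h1]
  conv_lhs => rw [hB.spectral_theorem, Unitary.conjStarAlgAut_apply]
  set U := (hB.eigenvectorUnitary : Matrix (Fin N) (Fin N) ℝ) with hU
  set D := Matrix.diagonal (RCLike.ofReal ∘ hB.eigenvalues : Fin N → ℝ) with hD
  have h2 : star U * U = 1 := Unitary.coe_star_mul_self _
  have h3 : U * D * star U * (U * D * star U) = U * (D * D * star U) := by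
    calc _ = U * D * (star U * U) * D * star U := by simp only [Matrix.mul_assoc]
      _ = _ := by rw [h2, Matrix.mul_one]; simp only [Matrix.mul_assoc]
  rw [h3, Matrix.trace_mul_comm, Matrix.mul_assoc, h2, Matrix.mul_one, hD,
    Matrix.diagonal_mul_diagonal, Matrix.trace_diagonal]
  simp [sq]

lemma quadForm_eigenvectorBasis (hB : B.IsHermitian) (x : Fin N → ℝ) :
    ∑ i, ∑ j, B i j * ((∑ l, x l • hB.eigenvectorBasis l) i * (∑ l, x l • hB.eigenvectorBasis l) j)
      = ∑ l, hB.eigenvalues l * x l ^ 2 := by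
  set U := (hB.eigenvectorUnitary : Matrix (Fin N) (Fin N) ℝ) with hU
  set D := Matrix.diagonal (RCLike.ofReal ∘ hB.eigenvalues : Fin N → ℝ) with hD
  have h2 : U.transpose * U = 1 := Unitary.coe_star_mul_self hB.eigenvectorUnitary
  have hv : ∀ i, (∑ l, x l • hB.eigenvectorBasis l) i = U.mulVec x i := by
    intro i
    simp [Matrix.mulVec, dotProduct, hU, mul_comm]
  simp_rw [hv]
  have hBU : B = U * D * U.transpose := by
    conv_lhs => rw [hB.spectral_theorem, Unitary.conjStarAlgAut_apply]
    rfl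
  calc _ = dotProduct (U.mulVec x) (B.mulVec (U.mulVec x)) := by
        generalize U.mulVec x = v
        simp only [dotProduct, Matrix.mulVec, Finset.mul_sum]
        refine Finset.sum_congr rfl fun i _ => Finset.sum_congr rfl fun j _ => by ring
    _ = dotProduct x (D.mulVec x) := by
        rw [hBU, ← Matrix.mulVec_mulVec, ← Matrix.mulVec_mulVec, Matrix.mulVec_mulVec x U.transpose,
          h2, Matrix.one_mulVec, Matrix.dotProduct_mulVec, Matrix.vecMul_mulVec, h2, Matrix.vecMul_one]
    _ = _ := by
        simp only [hD, dotProduct, Matrix.mulVec_diagonal]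
        refine Finset.sum_congr rfl fun l _ => ?_
        simp; ring

lemma lintegral_exp_quadForm_le (hB : B.IsHermitian) {a : ℝ}
    (ha : a ^ 2 * ∑ i, ∑ j, B i j ^ 2 ≤ 1 / 64) :
    ∫⁻ ξ, ENNReal.ofReal (Real.exp (a * (∑ i, ∑ j, B i j * (ξ i * ξ j) - B.trace)))
        ∂(Measure.pi fun _ : Fin N => gaussianReal 0 1)
      ≤ ENNReal.ofReal (Real.exp (2 * a ^ 2 * ∑ i, ∑ j, B i j ^ 2)) := by
  rw [sum_sq_entries_eq hB] at *
  have h1 : ∀ l, |a * hB.eigenvalues l| ≤ 1 / 8 := by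
    intro l
    apply abs_le_of_sq_le_sq _ (by norm_num)
    have := Finset.single_le_sum (f := fun l => hB.eigenvalues l ^ 2) (fun i _ => sq_nonneg _)
      (Finset.mem_univ l)
    rw [mul_pow]
    refine (mul_le_mul_of_nonneg_left this (sq_nonneg a)).trans (ha.trans (by norm_num))
  set F : EuclideanSpace ℝ (Fin N) → ENNReal := fun v =>
    ENNReal.ofReal (Real.exp (a * (∑ i, ∑ j, B i j * (v i * v j) - B.trace))) with hF
  have hFm : Measurable F := by fun_prop
  have h2 : ∫⁻ ξ, ENNReal.ofReal (Real.exp (a * (∑ i, ∑ j, B i j * (ξ i * ξ j) - B.trace)))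
        ∂(Measure.pi fun _ : Fin N => gaussianReal 0 1) = ∫⁻ v, F v ∂(stdGaussian (EuclideanSpace ℝ (Fin N))) := by
    rw [← map_pi_eq_stdGaussian, lintegral_map hFm (by fun_prop)]
  rw [h2, stdGaussian_eq_map_pi_orthonormalBasis hB.eigenvectorBasis,
    lintegral_map hFm (by fun_prop)]
  have h3 : ∀ x : Fin N → ℝ, F (∑ l, x l • hB.eigenvectorBasis l)
      = ∏ l, ENNReal.ofReal (Real.exp (a * hB.eigenvalues l * (x l ^ 2 - 1))) := by
    intro x
    simp only [hF]
    rw [quadForm_eigenvectorBasis, hB.trace_eq_sum_eigenvalues,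
      ← ENNReal.ofReal_prod_of_nonneg (fun _ _ => by positivity), ← Real.exp_sum]
    congr 2
    simp only [RCLike.ofReal_real_eq_id, id_eq]
    rw [← Finset.sum_sub_distrib, Finset.mul_sum]
    exact Finset.sum_congr rfl fun l _ => by ring
  simp_rw [h3]
  have hind : iIndepFun (fun (l : Fin N) (x : Fin N → ℝ) =>
      ENNReal.ofReal (Real.exp (a * hB.eigenvalues l * (x l ^ 2 - 1))))
      (Measure.pi fun _ : Fin N => gaussianReal 0 1) :=
    iIndepFun_pi (X := fun (l : Fin N) (y : ℝ) =>
      ENNReal.ofReal (Real.exp (a * hB.eigenvalues l * (y ^ 2 - 1)))) fun l => by fun_prop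
  rw [lintegral_prod_eq_prod_lintegral_of_indepFun Finset.univ _ hind (fun l => by fun_prop)]
  rw [Finset.mul_sum, Real.exp_sum, ENNReal.ofReal_prod_of_nonneg (fun _ _ => by positivity)]
  refine Finset.prod_le_prod' fun l _ => ?_
  rw [(measurePreserving_eval (fun _ : Fin N => gaussianReal 0 1) l).lintegral_comp
    (f := fun y => ENNReal.ofReal (Real.exp (a * hB.eigenvalues l * (y ^ 2 - 1)))) (by fun_prop)]
  refine (lintegral_exp_sq_sub_one_le (h1 l)).trans_eq ?_
  rw [mul_pow]; ring_nf

/-- Markov's inequality for exponential moments. -/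
lemma measure_lt_le_of_lintegral_exp {Ω : Type*} [MeasurableSpace Ω] {μ : Measure Ω} {f : Ω → ℝ}
    (hf : Measurable f) {a s K : ℝ}
    (h : ∫⁻ ω, ENNReal.ofReal (Real.exp (a * f ω)) ∂μ ≤ ENNReal.ofReal (Real.exp K)) (ha : 0 ≤ a) :
    μ {ω | s ≤ f ω} ≤ ENNReal.ofReal (Real.exp (K - a * s)) := by
  have h1 := meas_ge_le_lintegral_div (μ := μ) (f := fun ω => ENNReal.ofReal (Real.exp (a * f ω)))
    (by fun_prop) (ε := ENNReal.ofReal (Real.exp (a * s))) (by simp [Real.exp_pos]) (by simp)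
  calc μ {ω | s ≤ f ω} ≤ μ {ω | ENNReal.ofReal (Real.exp (a * s)) ≤ ENNReal.ofReal (Real.exp (a * f ω))} := by
        refine measure_mono fun ω hω => ENNReal.ofReal_le_ofReal (Real.exp_le_exp.mpr ?_)
        exact mul_le_mul_of_nonneg_left hω ha
    _ ≤ _ := h1
    _ ≤ ENNReal.ofReal (Real.exp K) / ENNReal.ofReal (Real.exp (a * s)) := by gcongr
    _ = _ := by rw [← ENNReal.ofReal_div_of_pos (Real.exp_pos _), ← Real.exp_sub]

/-- The **Hanson–Wright inequality** for standard Gaussian vectors. -/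
lemma measure_quadForm_deviation_le (hB : B.IsHermitian) (T : ℝ) :
    (Measure.pi fun _ : Fin N => gaussianReal 0 1)
      {ξ | T * √(∑ i, ∑ j, B i j ^ 2) < |∑ i, ∑ j, B i j * (ξ i * ξ j) - B.trace|}
      ≤ ENNReal.ofReal (4 * Real.exp (- T / 8)) := by
  obtain ⟨s, hs, hs0, hs2⟩ : ∃ s, s = √(∑ i, ∑ j, B i j ^ 2) ∧ 0 ≤ s ∧ s ^ 2 = ∑ i, ∑ j, B i j ^ 2 :=
    ⟨_, rfl, Real.sqrt_nonneg _, Real.sq_sqrt (by positivity)⟩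
  rw [← hs]
  rcases hs0.eq_or_lt with h0 | h0
  · have hz : ∀ i j, B i j = 0 := by
      rw [← h0, zero_pow two_ne_zero, eq_comm, Finset.sum_eq_zero_iff_of_nonneg (fun _ _ => by positivity)] at hs2
      intro i j
      have := hs2 i (Finset.mem_univ i)
      rw [Finset.sum_eq_zero_iff_of_nonneg (fun _ _ => by positivity)] at this
      exact pow_eq_zero_iff two_ne_zero |>.mp (this j (Finset.mem_univ j))
    simp [← h0, hz, Matrix.trace]
  · set f : (Fin N → ℝ) → ℝ := fun ξ => ∑ i, ∑ j, B i j * (ξ i * ξ j) - B.trace with hf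
    have hfm : Measurable f := by fun_prop
    have key : ∀ a : ℝ, a ^ 2 = (1 / (8 * s)) ^ 2 →
        ∫⁻ ξ, ENNReal.ofReal (Real.exp (a * f ξ)) ∂(Measure.pi fun _ : Fin N => gaussianReal 0 1)
          ≤ ENNReal.ofReal (Real.exp (1 / 32)) := by
      intro a ha
      have e1 : a ^ 2 * ∑ i, ∑ j, B i j ^ 2 = 1 / 64 := by rw [ha, ← hs2]; field_simp; norm_num
      refine (lintegral_exp_quadForm_le hB e1.le).trans_eq ?_
      rw [mul_assoc, e1]; norm_num
    have p1 := measure_lt_le_of_lintegral_exp hfm (s := T * s) (key (1 / (8 * s)) rfl) (by positivity)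
    have p2 := measure_lt_le_of_lintegral_exp (f := fun ξ => - f ξ) hfm.neg (s := T * s) (a := 1 / (8 * s)) (K := 1 / 32) (by
      have := key (- (1 / (8 * s))) (by ring)
      simpa only [mul_neg, neg_mul] using this) (by positivity)
    have e2 : (1 / 32 : ℝ) - 1 / (8 * s) * (T * s) = 1 / 32 + (- T / 8) := by field_simp; ring
    rw [e2] at p1 p2
    have e3 : Real.exp (1 / 32 + - T / 8) ≤ 2 * Real.exp (- T / 8) := by
      rw [Real.exp_add]
      have : Real.exp (1 / 32) ≤ 2 := by
        have := Real.exp_bound_div_one_sub_of_interval (x := 1 / 32) (by norm_num) (by norm_num)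
        norm_num at this ⊢; linarith
      gcongr
    calc _ ≤ (Measure.pi fun _ : Fin N => gaussianReal 0 1) ({ξ | T * s ≤ f ξ} ∪ {ξ | T * s ≤ - f ξ}) := by
          refine measure_mono fun ξ (hξ : T * s < |f ξ|) => ?_
          rcases lt_abs.mp hξ with h | h
          · exact Or.inl h.le
          · exact Or.inr h.le
      _ ≤ _ := measure_union_le _ _
      _ ≤ ENNReal.ofReal (2 * Real.exp (- T / 8)) + ENNReal.ofReal (2 * Real.exp (- T / 8)) := by
          gcongr
          · exact p1.trans (ENNReal.ofReal_le_ofReal e3)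
          · exact p2.trans (ENNReal.ofReal_le_ofReal e3)
      _ = _ := by rw [← ENNReal.ofReal_add (by positivity) (by positivity)]; ring_nf

/-- Gaussian tail bound. -/
lemma measure_gaussian_abs_gt_le (T : ℝ) :
    gaussianReal 0 1 {x | T < |x|} ≤ ENNReal.ofReal (4 * Real.exp (- T / 8)) := by
  have h1 := measure_lt_le_of_lintegral_exp (f := fun x : ℝ => x ^ 2 - 1) (by fun_prop)
    (s := T - 5 / 4) (lintegral_exp_sq_sub_one_le (a := 1 / 8) (by norm_num)) (by norm_num)
  calc _ ≤ gaussianReal 0 1 {x : ℝ | T - 5 / 4 ≤ x ^ 2 - 1} := by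
        refine measure_mono fun x (hx : T < |x|) => ?_
        change T - 5 / 4 ≤ x ^ 2 - 1
        rw [← sq_abs]
        nlinarith [sq_nonneg (|x| - 1 / 2)]
    _ ≤ _ := h1
    _ ≤ _ := by
        apply ENNReal.ofReal_le_ofReal
        have h2 := Real.exp_bound_div_one_sub_of_interval (x := 3 / 16) (by norm_num) (by norm_num)
        have h3 : 2 * (1 / 8 : ℝ) ^ 2 - 1 / 8 * (T - 5 / 4) = 3 / 16 + - T / 8 := by ring
        rw [h3, Real.exp_add]
        have h4 : Real.exp (3 / 16) ≤ 4 := h2.trans (by norm_num)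
        gcongr

end HansonWright

section Model

lemma iIndepFun_blocks {ι Ω 𝓧 : Type*} {κ : ι → Type*} [MeasurableSpace Ω] [MeasurableSpace 𝓧]
    {P : Measure Ω} {X : (i : ι) → κ i → Ω → 𝓧} (hX : ∀ i j, Measurable (X i j))
    (h : iIndepFun (fun (p : (i : ι) × κ i) => X p.1 p.2) P) :
    iIndepFun (fun (i : ι) ω (j : κ i) => X i j ω) P := by
  have : IsProbabilityMeasure P := h.isProbabilityMeasure
  have hP : ∀ i j, IsProbabilityMeasure (P.map (X i j)) := fun i j =>
    Measure.isProbabilityMeasure_map (hX i j).aemeasurable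
  have h1 : ∀ i, P.map (fun ω (j : κ i) => X i j ω) = Measure.infinitePi fun j => P.map (X i j) :=
    fun i => (h.precomp (g := fun j : κ i => (⟨i, j⟩ : (i : ι) × κ i)) sigma_mk_injective).map_fun_eq_infinitePi_map
      (fun j => hX i j)
  rw [iIndepFun_iff_map_fun_eq_infinitePi_map (fun i => measurable_pi_lambda _ (hX i))]
  simp_rw [h1]
  rw [← Measure.infinitePi_map_piCurry, ← iIndepFun.map_fun_eq_infinitePi_map (fun p : (i : ι) × κ i => hX p.1 p.2) h,
    Measure.map_map (by fun_prop)
      (measurable_pi_lambda (fun ω (p : (i : ι) × κ i) => X p.1 p.2 ω) fun p => hX p.1 p.2)]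
  rfl

variable {N : ℕ}

instance instIsProbabilityMeasureGMeasure : IsProbabilityMeasure (gMeasure N) := by
  unfold gMeasure; infer_instance

lemma iIndepFun_gMeasure :
    iIndepFun (fun (p : Fin N × Fin N) (g : Fin N → Fin N → ℝ) => g p.1 p.2) (gMeasure N) := by
  have := iIndepFun_uncurry_infinitePi' (ι := Fin N) (κ := Fin N) (Ω := fun _ _ => ℝ)
    (𝓧 := fun _ _ => ℝ) (X := fun _ _ => id) (fun _ _ => gaussianReal 0 1) (fun _ _ => measurable_id)
  simp only [Measure.infinitePi_eq_pi] at this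
  exact this

lemma hasLaw_gMeasure (i j : Fin N) :
    HasLaw (fun g : Fin N → Fin N → ℝ => g i j) (gaussianReal 0 1) (gMeasure N) where
  aemeasurable := by
    have : Measurable fun g : Fin N → Fin N → ℝ => g i j := by fun_prop
    exact this.aemeasurable
  map_eq := by
    have h1 := (measurePreserving_eval (fun _ : Fin N => gaussianReal 0 1) j).comp
      (measurePreserving_eval (fun _ : Fin N => Measure.pi fun _ : Fin N => gaussianReal 0 1) i)
    exact h1.map_eq

/-- The normalized symmetrized Gaussian attached to an unordered pair of indices. -/
def symGauss (e : Sym2 (Fin N)) (g : Fin N → Fin N → ℝ) : ℝ :=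
  (if e.IsDiag then 1 else (√2)⁻¹) * ∑ p : {p : Fin N × Fin N // s(p.1, p.2) = e}, g p.1.1 p.1.2

@[fun_prop]
lemma measurable_symGauss (e : Sym2 (Fin N)) : Measurable (symGauss e) := by
  unfold symGauss; fun_prop

lemma symGauss_diag (i : Fin N) (g : Fin N → Fin N → ℝ) : symGauss s(i, i) g = g i i := by
  have : ∑ p : {p : Fin N × Fin N // s(p.1, p.2) = s(i, i)}, g p.1.1 p.1.2 = g i i := by
    rw [← Finset.sum_subtype {(i, i)} (fun p => by aesop) (fun p : Fin N × Fin N => g p.1 p.2)]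
    simp
  simp [symGauss, this]

lemma symGauss_of_ne {i j : Fin N} (hij : i ≠ j) (g : Fin N → Fin N → ℝ) :
    symGauss s(i, j) g = (√2)⁻¹ * (g i j + g j i) := by
  have : ∑ p : {p : Fin N × Fin N // s(p.1, p.2) = s(i, j)}, g p.1.1 p.1.2 = g i j + g j i := by
    rw [← Finset.sum_subtype {(i, j), (j, i)} (fun p => by aesop) (fun p : Fin N × Fin N => g p.1 p.2)]
    rw [Finset.sum_pair (by aesop)]
  simp [symGauss, this, hij]

lemma iIndepFun_symGauss : iIndepFun (fun e : Sym2 (Fin N) => symGauss e) (gMeasure N) := by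
  have h1 := (iIndepFun_gMeasure (N := N)).precomp
    (g := fun q : (e : Sym2 (Fin N)) × {p : Fin N × Fin N // s(p.1, p.2) = e} => q.2.1)
    (Equiv.sigmaFiberEquiv fun p : Fin N × Fin N => s(p.1, p.2)).injective
  have h2 := iIndepFun_blocks (X := fun (e : Sym2 (Fin N))
    (p : {p : Fin N × Fin N // s(p.1, p.2) = e}) (g : Fin N → Fin N → ℝ) => g p.1.1 p.1.2)
    (fun e p => by fun_prop) h1
  exact h2.comp (fun e x => (if e.IsDiag then 1 else (√2)⁻¹) * ∑ p, x p) (fun e => by fun_prop)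

lemma hasLaw_symGauss (e : Sym2 (Fin N)) : HasLaw (symGauss e) (gaussianReal 0 1) (gMeasure N) := by
  induction e using Sym2.ind with
  | _ i j =>
  by_cases hij : i = j
  · subst hij
    rw [show symGauss s(i, i) = fun g => g i i from funext fun g => symGauss_diag i g]
    exact hasLaw_gMeasure i i
  · have h1 : IndepFun (fun g : Fin N → Fin N → ℝ => g i j) (fun g => g j i) (gMeasure N) :=
      iIndepFun_gMeasure.indepFun (i := (i, j)) (j := (j, i)) (by aesop)
    have h2 := gaussianReal_add_gaussianReal_of_indepFun h1 (hasLaw_gMeasure i j).map_eq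
      (hasLaw_gMeasure j i).map_eq
    have h3 := gaussianReal_const_mul ⟨by fun_prop, h2⟩ (√2)⁻¹
    rw [show symGauss s(i, j) = fun g => (√2)⁻¹ * ((fun g : Fin N → Fin N → ℝ => g i j) +
        (fun g : Fin N → Fin N → ℝ => g j i)) g from
      funext fun g => symGauss_of_ne hij g]
    convert! h3 using 2
    · simp
    · ext; norm_num

lemma map_row_symGauss (k : Fin N) :
    (gMeasure N).map (fun g j => symGauss s(k, j) g) = Measure.pi fun _ : Fin N => gaussianReal 0 1 := by
  have h1 := (iIndepFun_symGauss (N := N)).precomp (g := fun j : Fin N => s(k, j)) (fun a b h => by aesop)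
  rw [(iIndepFun_iff_map_fun_eq_pi_map fun j => by fun_prop).mp h1]
  simp_rw [(hasLaw_symGauss _).map_eq]

end Model

section Measurability

variable {Ω : Type*} [MeasurableSpace Ω] {N : ℕ}

lemma measurable_matrix_det {M : Ω → Matrix (Fin N) (Fin N) ℂ}
    (hM : ∀ i j, Measurable fun ω => M ω i j) : Measurable fun ω => (M ω).det := by
  simp only [Matrix.det_apply']
  exact Finset.measurable_sum _ fun σ _ => measurable_const.mul
    (Finset.measurable_prod _ fun i _ => hM _ _)

lemma measurable_matrix_inv_apply {M : Ω → Matrix (Fin N) (Fin N) ℂ}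
    (hM : ∀ i j, Measurable fun ω => M ω i j) (i j : Fin N) :
    Measurable fun ω => (M ω)⁻¹ i j := by
  simp only [Matrix.inv_def, Ring.inverse_eq_inv', Matrix.smul_apply, Matrix.adjugate_apply,
    smul_eq_mul]
  refine (measurable_matrix_det hM).inv.mul (measurable_matrix_det fun a b => ?_)
  simp only [Matrix.updateRow_apply]
  split_ifs
  · exact measurable_const
  · exact hM a b

lemma measurable_resolventM_apply {A : Ω → Matrix (Fin N) (Fin N) ℝ}
    (hA : ∀ i j, Measurable fun ω => A ω i j) (z : ℂ) (i j : Fin N) :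
    Measurable fun ω => resolventM N (A ω) z i j := by
  refine measurable_matrix_inv_apply (fun a b => ?_) i j
  simp only [Matrix.sub_apply, Matrix.map_apply]
  exact (Complex.measurable_ofReal.comp (hA a b)).sub measurable_const

lemma measurable_minorRes_apply {A : Ω → Matrix (Fin N) (Fin N) ℝ}
    (hA : ∀ i j, Measurable fun ω => A ω i j) (z : ℂ) (k i j : Fin N) :
    Measurable fun ω => minorRes N (A ω) z k i j := by
  simp only [minorRes]
  split_ifs
  · exact measurable_const
  · refine measurable_resolventM_apply (fun a b => ?_) z i j
    simp only [minorM]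
    split_ifs
    · exact measurable_const
    · exact hA a b

end Measurability

section Deterministic

variable {N : ℕ} {A : Matrix (Fin N) (Fin N) ℝ} {z : ℂ} {T : ℝ}

lemma localLaw_of_concentration (hN : 0 < N) (hA : A.IsHermitian) (hz : 0 < z.im) (hz1 : z.im ≤ 1)
    (hQ : 1 ≤ N * z.im) (hT : 1 ≤ T) {ξ : Fin N → Fin N → ℝ}
    (hξ : ∀ k j, j ≠ k → A k j = ξ k j / √N) (hd : ∀ k, |A k k| ≤ √(2 / N) * T)
    (hre : ∀ k, |∑ i, ∑ j, (minorRes N A z k i j).re * (ξ k i * ξ k j)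
      - Matrix.trace (fun i j => (minorRes N A z k i j).re)|
        ≤ T * √(∑ i, ∑ j, (minorRes N A z k i j).re ^ 2))
    (him : ∀ k, |∑ i, ∑ j, (minorRes N A z k i j).im * (ξ k i * ξ k j)
      - Matrix.trace (fun i j => (minorRes N A z k i j).im)|
        ≤ T * √(∑ i, ∑ j, (minorRes N A z k i j).im ^ 2)) :
    LocalLaw N A T z := by
  intro k
  have hN' : (0 : ℝ) < N := by exact_mod_cast hN
  set R := minorRes N A z k with hR
  set η := z.im with hη
  set y := (stTrans N A z).im with hy
  have hy0 : 0 ≤ y := im_stTrans_nonneg hA hz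
  set Q : ℝ := N * η with hQdef
  have hQ0 : 0 < Q := by positivity
  set F := √(∑ i, ∑ j, ‖R i j‖ ^ 2) with hF
  -- quadratic form
  have hquad : ∑ i, ∑ j, R i j * ((A k i : ℂ) * (A k j : ℂ))
      = (1 / N : ℂ) * ∑ i, ∑ j, R i j * ((ξ k i * ξ k j : ℝ) : ℂ) := by
    simp only [Finset.mul_sum]
    refine Finset.sum_congr rfl fun i _ => Finset.sum_congr rfl fun j _ => ?_
    by_cases hij : i = k ∨ j = k
    · have : R i j = 0 := by simp [hR, minorRes, hij]
      simp [this]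
    · rw [not_or] at hij
      rw [← Complex.ofReal_mul, hξ k i hij.1, hξ k j hij.2, div_mul_div_comm,
        Real.mul_self_sqrt hN'.le]
      push_cast; ring
  have hdev : ‖∑ i, ∑ j, R i j * ((ξ k i * ξ k j : ℝ) : ℂ) - R.trace‖ ≤ 2 * T * F := by
    refine (Complex.norm_le_abs_re_add_abs_im _).trans ?_
    have e1 : (∑ i, ∑ j, R i j * ((ξ k i * ξ k j : ℝ) : ℂ) - R.trace).re
        = ∑ i, ∑ j, (R i j).re * (ξ k i * ξ k j) - Matrix.trace (fun i j => (R i j).re) := by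
      simp only [Matrix.trace, Matrix.diag_apply, Complex.sub_re, Complex.re_sum, Complex.re_mul_ofReal]
      rfl
    have e2 : (∑ i, ∑ j, R i j * ((ξ k i * ξ k j : ℝ) : ℂ) - R.trace).im
        = ∑ i, ∑ j, (R i j).im * (ξ k i * ξ k j) - Matrix.trace (fun i j => (R i j).im) := by
      simp only [Matrix.trace, Matrix.diag_apply, Complex.sub_im, Complex.im_sum, Complex.im_mul_ofReal]
      rfl
    rw [e1, e2]
    have f1 : √(∑ i, ∑ j, (R i j).re ^ 2) ≤ F := by
      apply Real.sqrt_le_sqrt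
      refine Finset.sum_le_sum fun i _ => Finset.sum_le_sum fun j _ => ?_
      rw [← sq_abs]
      exact pow_le_pow_left₀ (abs_nonneg _) (Complex.abs_re_le_norm _) 2
    have f2 : √(∑ i, ∑ j, (R i j).im ^ 2) ≤ F := by
      apply Real.sqrt_le_sqrt
      refine Finset.sum_le_sum fun i _ => Finset.sum_le_sum fun j _ => ?_
      rw [← sq_abs]
      exact pow_le_pow_left₀ (abs_nonneg _) (Complex.abs_im_le_norm _) 2
    calc _ ≤ T * √(∑ i, ∑ j, (R i j).re ^ 2) + T * √(∑ i, ∑ j, (R i j).im ^ 2) :=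
          add_le_add (hre k) (him k)
      _ ≤ T * F + T * F := by gcongr
      _ = _ := by ring
  have htr := norm_trace_sub_minorRes_le (k := k) hA hz
  have hst : stTrans N A z = (1 / N : ℂ) * (resolventM N A z).trace := rfl
  have hNy : (resolventM N A z).trace.im = N * y := by
    rw [hy, hst, one_div, ← Complex.ofReal_natCast, ← Complex.ofReal_inv, Complex.im_ofReal_mul]
    field_simp
  have hFb : F ≤ √(N * y / η) + 1 / η := by
    rw [hF]
    apply Real.sqrt_le_iff.mpr ⟨by positivity, ?_⟩
    have g1 : ∑ i, ∑ j, ‖R i j‖ ^ 2 = R.trace.im / η := by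
      rw [eq_div_iff hz.ne', mul_comm]; exact frob_minorRes hA hz
    have g2 : R.trace.im ≤ N * y + 1 / η := by
      have := (Complex.abs_im_le_norm _).trans htr
      rw [Complex.sub_im, hNy] at this
      linarith [(abs_le.mp this).1]
    have g3 : √(N * y / η) ^ 2 = N * y / η := Real.sq_sqrt (by positivity)
    rw [g1, div_le_iff₀ hz]
    refine g2.trans ?_
    have : (√(N * y / η) + 1 / η) ^ 2 * η = (√(N * y / η) ^ 2) * η + 1 / η + 2 * √(N * y / η) := by
      field_simp; ring
    rw [this, g3]
    have g4 : N * y / η * η = N * y := by field_simp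
    have := Real.sqrt_nonneg (N * y / η)
    linarith
  have hsQ : 1 ≤ √Q := Real.one_le_sqrt.mpr hQ
  have hFN : F / N ≤ (1 + √y) / √Q := by
    have g1 : √(N * y / η) / N = √y / √Q := by
      rw [hQdef, Real.sqrt_div (by positivity), Real.sqrt_mul hN'.le, Real.sqrt_mul hN'.le]
      have h1 := Real.mul_self_sqrt hN'.le
      have h2 : 0 < √(N : ℝ) := by positivity
      have h3 : 0 < √η := by positivity
      rw [div_div, div_eq_div_iff (by positivity) (by positivity)]
      linear_combination (√y * √η) * h1
    have g2 : 1 / η / N = 1 / Q := by rw [hQdef]; field_simp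
    have g3 : 1 / Q ≤ 1 / √Q := by
      apply one_div_le_one_div_of_le (by positivity)
      nlinarith [Real.mul_self_sqrt hQ0.le]
    calc F / N ≤ (√(N * y / η) + 1 / η) / N := by gcongr
      _ = √y / √Q + 1 / Q := by rw [add_div, g1, g2]
      _ ≤ √y / √Q + 1 / √Q := by gcongr
      _ = _ := by ring
  have hd2 : |A k k| ≤ 2 * T / √Q := by
    refine (hd k).trans ?_
    have g1 : √Q ≤ √N := Real.sqrt_le_sqrt (by nlinarith)
    have g2 : √2 ≤ 2 := by rw [Real.sqrt_le_left (by norm_num)]; norm_num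
    calc √(2 / N) * T = √2 * T / √N := by rw [Real.sqrt_div (by norm_num)]; ring
      _ ≤ 2 * T / √Q := by gcongr
  have htr2 : ‖stTrans N A z - (1 / N : ℂ) * R.trace‖ ≤ 1 / √Q := by
    rw [hst, ← mul_sub, norm_mul, norm_div, norm_one, Complex.norm_natCast]
    calc 1 / (N : ℝ) * _ ≤ 1 / N * (1 / η) := by gcongr
      _ = 1 / Q := by rw [hQdef]; field_simp
      _ ≤ _ := by
        apply one_div_le_one_div_of_le (by positivity)
        nlinarith [Real.mul_self_sqrt hQ0.le]
  rw [inv_resolventM_diag hA hz, schurC, ← hR, hquad]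
  have hsplit : (A k k : ℂ) - z - 1 / N * ∑ i, ∑ j, R i j * ((ξ k i * ξ k j : ℝ) : ℂ) + z + stTrans N A z
      = (A k k : ℂ) + (stTrans N A z - (1 / N : ℂ) * R.trace)
        - (1 / N : ℂ) * (∑ i, ∑ j, R i j * ((ξ k i * ξ k j : ℝ) : ℂ) - R.trace) := by ring
  rw [hsplit]
  calc _ ≤ ‖(A k k : ℂ)‖ + ‖stTrans N A z - (1 / N : ℂ) * R.trace‖
        + ‖(1 / N : ℂ) * (∑ i, ∑ j, R i j * ((ξ k i * ξ k j : ℝ) : ℂ) - R.trace)‖ :=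
        (norm_sub_le _ _).trans (add_le_add_left (norm_add_le _ _) _)
    _ ≤ 2 * T / √Q + 1 / √Q + 2 * T * ((1 + √y) / √Q) := by
        refine add_le_add (add_le_add ?_ htr2) ?_
        · rwa [Complex.norm_real, Real.norm_eq_abs]
        · rw [norm_mul, norm_div, norm_one, Complex.norm_natCast]
          calc 1 / (N : ℝ) * _ ≤ 1 / N * (2 * T * F) := by gcongr
            _ = 2 * T * (F / N) := by ring
            _ ≤ _ := by gcongr
    _ = (2 * T + 1 + 2 * T * (1 + √y)) / √Q := by ring
    _ ≤ (8 * T * (1 + √y)) / √Q := by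
        gcongr
        nlinarith [Real.sqrt_nonneg y, mul_nonneg (by linarith : 0 ≤ T) (Real.sqrt_nonneg y)]
    _ = _ := by ring

end Deterministic

section Independence

variable {Ω α β : Type*} [MeasurableSpace Ω] [MeasurableSpace α] [MeasurableSpace β]
  {μ : Measure Ω}

lemma measure_setOf_not_forall_le {ι : Type*} (s : Finset ι) {P : ι → Ω → Prop} {c : ENNReal}
    (h : ∀ i ∈ s, μ {ω | ¬ P i ω} ≤ c) : μ {ω | ¬ ∀ i ∈ s, P i ω} ≤ s.card * c := by
  have h1 : {ω | ¬ ∀ i ∈ s, P i ω} = ⋃ i ∈ s, {ω | ¬ P i ω} := by ext; simp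
  rw [h1, ← nsmul_eq_mul]
  exact (measure_biUnion_finset_le _ _).trans (Finset.sum_le_card_nsmul _ _ _ h)

lemma measure_fiber_le [IsProbabilityMeasure μ] {X : Ω → α} {Y : Ω → β} (hX : Measurable X)
    (hY : Measurable Y) (hXY : IndepFun X Y μ) {S : Set (α × β)} (hS : MeasurableSet S)
    {c : ENNReal} (h : ∀ ω, μ.map Y {y | (X ω, y) ∈ S} ≤ c) : μ {ω | (X ω, Y ω) ∈ S} ≤ c := by
  have : IsProbabilityMeasure (μ.map Y) := Measure.isProbabilityMeasure_map hY.aemeasurable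
  have h1 := (indepFun_iff_map_prod_eq_prod_map_map hX.aemeasurable hY.aemeasurable).mp hXY
  have h2 : μ {ω | (X ω, Y ω) ∈ S} = (μ.map fun ω => (X ω, Y ω)) S :=
    (Measure.map_apply (hX.prodMk hY) hS).symm
  rw [h2, h1, Measure.prod_apply hS, lintegral_map (measurable_measure_prodMk_left hS) hX]
  calc _ ≤ ∫⁻ _, c ∂μ := lintegral_mono fun ω => h ω
    _ = c := by simp

lemma lintegral_indepFun_eq [IsProbabilityMeasure μ] {X : Ω → α} {Y : Ω → β} (hX : Measurable X)
    (hY : Measurable Y) (hXY : IndepFun X Y μ) {f : α × β → ENNReal} (hf : Measurable f) :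
    ∫⁻ ω, f (X ω, Y ω) ∂μ = ∫⁻ ω, ∫⁻ y, f (X ω, y) ∂(μ.map Y) ∂μ := by
  have : IsProbabilityMeasure (μ.map Y) := Measure.isProbabilityMeasure_map hY.aemeasurable
  have h1 := (indepFun_iff_map_prod_eq_prod_map_map hX.aemeasurable hY.aemeasurable).mp hXY
  rw [← lintegral_map (f := f) hf (hX.prodMk hY), h1, lintegral_prod _ hf.aemeasurable,
    lintegral_map hf.lintegral_prod_right' hX]

lemma iIndepFun.indepFun_of_dependsOn {ι : Type*} [Fintype ι] {W : ι → Ω → ℝ}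
    (hW : iIndepFun W μ) (hWm : ∀ i, Measurable (W i)) {S : Finset ι} {φ : (ι → ℝ) → α}
    {ψ : (ι → ℝ) → β} (hφ : Measurable φ) (hψ : Measurable ψ) (hφS : DependsOn φ S)
    (hψS : DependsOn ψ (S : Set ι)ᶜ) :
    IndepFun (fun ω => φ fun i => W i ω) (fun ω => ψ fun i => W i ω) μ := by
  classical
  have h1 := hW.indepFun_finset S Sᶜ disjoint_compl_right hWm
  have ext_meas : ∀ T : Finset ι,
      Measurable fun (x : T → ℝ) (i : ι) => if h : i ∈ T then x ⟨i, h⟩ else 0 := by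
    intro T
    refine measurable_pi_lambda _ fun i => ?_
    split_ifs
    · fun_prop
    · fun_prop
  have h2 := h1.comp (hφ.comp (ext_meas S)) (hψ.comp (ext_meas Sᶜ))
  convert! h2 using 1
  · funext ω
    exact hφS fun i hi => by simp [Finset.mem_coe.mp hi]
  · funext ω
    refine hψS fun i hi => ?_
    have : i ∉ S := fun h => hi h
    simp [this]

end Independence

section PartialDiagonal

variable {N : ℕ}

/-- The matrix with Gaussian off-diagonal entries in which only the first `m` diagonal entries
have been switched on. -/
def partialDiagMat (N m : ℕ) (w : Sym2 (Fin N) → ℝ) : Matrix (Fin N) (Fin N) ℝ :=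
  fun i j => if i = j then (if (i : ℕ) < m then √(2 / N) * w s(i, i) else 0) else w s(i, j) / √N

lemma partialDiagMat_isHermitian (m : ℕ) (w : Sym2 (Fin N) → ℝ) :
    (partialDiagMat N m w).IsHermitian := by
  ext i j
  simp only [partialDiagMat, Matrix.conjTranspose_apply, star_trivial]
  by_cases h : i = j
  · subst h; rfl
  · rw [if_neg h, if_neg (Ne.symm h), Sym2.eq_swap]

lemma symGauss_div_sqrt {i j : Fin N} (hij : i ≠ j) (g : Fin N → Fin N → ℝ) :
    symGauss s(i, j) g / √N = (g i j + g j i) / √(2 * N) := by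
  rw [symGauss_of_ne hij, Real.sqrt_mul (by norm_num)]
  field_simp

lemma partialDiagMat_zero (g : Fin N → Fin N → ℝ) :
    partialDiagMat N 0 (fun e => symGauss e g) = Mmat N g := by
  ext i j
  simp only [partialDiagMat, Mmat]
  split_ifs with h h'
  · exact absurd h' (Nat.not_lt_zero _)
  · rfl
  · exact symGauss_div_sqrt h g

lemma partialDiagMat_self (g : Fin N → Fin N → ℝ) :
    partialDiagMat N N (fun e => symGauss e g) = Hmat N g := by
  ext i j
  simp only [partialDiagMat, Hmat]
  split_ifs with h h'
  · rw [symGauss_diag]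
  · exact absurd i.2 h'
  · exact symGauss_div_sqrt h g

lemma partialDiagMat_succ (k : Fin N) (w : Sym2 (Fin N) → ℝ) (i j : Fin N) :
    partialDiagMat N (k + 1) w i j = partialDiagMat N k w i j
      + if i = k ∧ j = k then √(2 / N) * w s(k, k) else 0 := by
  simp only [partialDiagMat]
  by_cases h : i = j
  · subst h
    by_cases hk : i = k
    · subst hk; simp
    · have : (i : ℕ) ≠ k := fun h => hk (Fin.ext h)
      have h3 : (i : ℕ) < k + 1 ↔ (i : ℕ) < k := by omega
      simp [hk, h3]
  · have : ¬ (i = k ∧ j = k) := fun h' => h (h'.1.trans h'.2.symm)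
    simp [h, this]

@[fun_prop]
lemma measurable_partialDiagMat_apply (m : ℕ) (i j : Fin N) :
    Measurable fun w => partialDiagMat N m w i j := by
  simp only [partialDiagMat]
  split_ifs <;> fun_prop

lemma dependsOn_resolventM_partialDiagMat (m : ℕ) (z : ℂ) (i j : Fin N) :
    DependsOn (fun w => resolventM N (partialDiagMat N m w) z i j)
      {e | ∀ n : Fin N, m ≤ n → e ≠ s(n, n)} := by
  intro w w' h
  have : partialDiagMat N m w = partialDiagMat N m w' := by
    ext a b
    simp only [partialDiagMat]
    split_ifs with h1 h2
    · subst h1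
      rw [h]
      intro n hn hs
      have : a = n := by simpa using hs
      subst this; omega
    · rfl
    · rw [h]
      intro n hn hs
      apply h1
      have := Sym2.eq_iff.mp hs
      aesop
  simp only [this]

lemma dependsOn_minorRes_partialDiagMat (m : ℕ) (z : ℂ) (k : Fin N) :
    DependsOn (fun w => minorRes N (partialDiagMat N m w) z k) {e | k ∉ e} := by
  intro w w' h
  have : minorM (partialDiagMat N m w) k = minorM (partialDiagMat N m w') k := by
    ext a b
    simp only [minorM]
    split_ifs with h1
    · rfl
    · simp only [not_or] at h1
      simp only [partialDiagMat]
      rw [h (i := s(a, a)) (by simpa using Ne.symm h1.1),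
        h (i := s(a, b)) (by simpa using ⟨Ne.symm h1.1, Ne.symm h1.2⟩)]
  funext i j
  simp only [minorRes, this]

lemma measure_abs_symGauss_gt_le (e : Sym2 (Fin N)) (T : ℝ) :
    gMeasure N {g | ¬ |symGauss e g| ≤ T} ≤ ENNReal.ofReal (4 * Real.exp (-T / 8)) := by
  have h := measure_gaussian_abs_gt_le T
  have hs : MeasurableSet {x : ℝ | T < |x|} := measurableSet_lt measurable_const measurable_id.abs
  rw [← (hasLaw_symGauss e).map_eq, Measure.map_apply (by fun_prop) hs] at h
  simp only [not_le]
  exact h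

/-- Concentration of the quadratic forms in the Schur complement formula, for a real part `p` of
the resolvent entries. -/
lemma measure_minorRes_deviation_le (m : ℕ) (z : ℂ) (k : Fin N) (T : ℝ) {p : ℂ → ℝ}
    (hp : Measurable p) :
    gMeasure N {g | ¬ |∑ i, ∑ j, p (minorRes N (partialDiagMat N m fun e => symGauss e g) z k i j)
        * (symGauss s(k, i) g * symGauss s(k, j) g)
      - Matrix.trace (fun i j => p (minorRes N (partialDiagMat N m fun e => symGauss e g) z k i j))|
        ≤ T * √(∑ i, ∑ j, p (minorRes N (partialDiagMat N m fun e => symGauss e g) z k i j) ^ 2)}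
      ≤ ENNReal.ofReal (4 * Real.exp (-T / 8)) := by
  have hφ : Measurable fun (w : Sym2 (Fin N) → ℝ) i j => p (minorRes N (partialDiagMat N m w) z k i j) :=
    measurable_pi_lambda _ fun i => measurable_pi_lambda _ fun j =>
      hp.comp (measurable_minorRes_apply (fun a b => by fun_prop) z k i j)
  have hψ : Measurable fun (w : Sym2 (Fin N) → ℝ) (j : Fin N) => w s(k, j) := by fun_prop
  have hW : Measurable fun (g : Fin N → Fin N → ℝ) (e : Sym2 (Fin N)) => symGauss e g := by fun_prop
  have hind := iIndepFun.indepFun_of_dependsOn (S := Finset.univ.filter fun e : Sym2 (Fin N) => k ∉ e)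
    (iIndepFun_symGauss (N := N)) (fun e => by fun_prop) hφ hψ
    (fun w w' h => by
      have := dependsOn_minorRes_partialDiagMat m z k (x := w) (y := w') (fun e he => h e (by simpa using he))
      simp only at this
      simp only [this])
    (fun w w' h => by
      funext j
      exact h _ (by simp))
  have hS : MeasurableSet {q : (Fin N → Fin N → ℝ) × (Fin N → ℝ) |
      T * √(∑ i, ∑ j, q.1 i j ^ 2) < |∑ i, ∑ j, q.1 i j * (q.2 i * q.2 j)
        - Matrix.trace (q.1 : Matrix (Fin N) (Fin N) ℝ)|} := by
    simp only [Matrix.trace, Matrix.diag]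
    exact measurableSet_lt (by fun_prop) (Measurable.abs (by fun_prop))
  have := measure_fiber_le (hφ.comp hW) (hψ.comp hW) hind hS
    (c := ENNReal.ofReal (4 * Real.exp (-T / 8))) ?_
  · simp only [not_le]
    exact this
  · intro g
    have h1 := map_row_symGauss k
    have h2 : (fun (w : Sym2 (Fin N) → ℝ) (j : Fin N) => w s(k, j)) ∘ (fun (g : Fin N → Fin N → ℝ) (e : Sym2 (Fin N)) => symGauss e g) = fun g j => symGauss s(k, j) g := rfl
    rw [h2, h1]
    refine measure_quadForm_deviation_le (B := fun i j => p (minorRes N (partialDiagMat N m fun e => symGauss e g) z k i j)) ?_ T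
    refine Matrix.IsHermitian.ext fun i j => ?_
    rw [star_trivial, minorRes_symm (partialDiagMat_isHermitian m _)]

lemma measure_not_localLaw_le (hN : 0 < N) {m : ℕ} {z : ℂ} {T : ℝ} (hz : 0 < z.im) (hz1 : z.im ≤ 1)
    (hQ : 1 ≤ N * z.im) (hT : 1 ≤ T) :
    gMeasure N {g | ¬ LocalLaw N (partialDiagMat N m fun e => symGauss e g) T z}
      ≤ N * ENNReal.ofReal (12 * Real.exp (-T / 8)) := by
  set c := ENNReal.ofReal (4 * Real.exp (-T / 8)) with hc
  have h12 : ENNReal.ofReal (12 * Real.exp (-T / 8)) = c + c + c := by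
    rw [hc, ← ENNReal.ofReal_add (by positivity) (by positivity),
      ← ENNReal.ofReal_add (by positivity) (by positivity)]
    congr 1; ring
  rw [h12]
  have key := measure_setOf_not_forall_le (μ := gMeasure N) (Finset.univ : Finset (Fin N))
    (P := fun k g => (|symGauss s(k, k) g| ≤ T ∧
      |∑ i, ∑ j, (minorRes N (partialDiagMat N m fun e => symGauss e g) z k i j).re
        * (symGauss s(k, i) g * symGauss s(k, j) g)
      - Matrix.trace (fun i j => (minorRes N (partialDiagMat N m fun e => symGauss e g) z k i j).re)|
        ≤ T * √(∑ i, ∑ j, (minorRes N (partialDiagMat N m fun e => symGauss e g) z k i j).re ^ 2)) ∧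
      |∑ i, ∑ j, (minorRes N (partialDiagMat N m fun e => symGauss e g) z k i j).im
        * (symGauss s(k, i) g * symGauss s(k, j) g)
      - Matrix.trace (fun i j => (minorRes N (partialDiagMat N m fun e => symGauss e g) z k i j).im)|
        ≤ T * √(∑ i, ∑ j, (minorRes N (partialDiagMat N m fun e => symGauss e g) z k i j).im ^ 2))
    (c := c + c + c) ?_
  · rw [Finset.card_univ, Fintype.card_fin] at key
    refine (measure_mono ?_).trans key
    refine fun g hg hall => hg ?_
    simp only [Finset.mem_univ, forall_true_left] at hall
    refine localLaw_of_concentration hN (partialDiagMat_isHermitian m _) hz hz1 hQ hT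
      (ξ := fun k j => symGauss s(k, j) g) (fun k j hjk => ?_) (fun k => ?_)
      (fun k => (hall k).1.2) (fun k => (hall k).2)
    · simp only [partialDiagMat, if_neg (Ne.symm hjk)]
    · simp only [partialDiagMat, if_true]
      split_ifs
      · rw [abs_mul, abs_of_nonneg (Real.sqrt_nonneg _)]
        exact mul_le_mul_of_nonneg_left (hall k).1.1 (Real.sqrt_nonneg _)
      · rw [abs_zero]; positivity
  · intro k _
    simp only [not_and_or, Set.ofPred_or]
    refine (measure_union_le _ _).trans (add_le_add ((measure_union_le _ _).trans (add_le_add ?_ ?_)) ?_)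
    · exact measure_abs_symGauss_gt_le _ T
    · exact measure_minorRes_deviation_le m z k T Complex.measurable_re
    · exact measure_minorRes_deviation_le m z k T Complex.measurable_im

end PartialDiagonal

section Martingale

lemma lintegral_exp_mul_gaussian (a : ℝ) :
    ∫⁻ x, ENNReal.ofReal (Real.exp (a * x)) ∂(gaussianReal 0 1)
      = ENNReal.ofReal (Real.exp (a ^ 2 / 2)) := by
  rw [← ofReal_integral_eq_lintegral_ofReal (integrable_exp_mul_gaussianReal a)
    (ae_of_all _ fun x => (Real.exp_pos _).le)]
  have := congrFun (mgf_id_gaussianReal (μ := 0) (v := 1)) a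
  simp only [mgf, id] at this
  rw [this]; simp

variable {N : ℕ}

/-- Exponential moment bound for a discrete stochastic integral: the increments are the diagonal
Gaussians, and the `k`-th integrand is bounded and does not involve the diagonal entries of index
at least `k`. -/
lemma lintegral_exp_diag_martingale_le {C : ℕ → Fin N → (Sym2 (Fin N) → ℝ) → ℝ} {b : ℝ}
    (hC : ∀ m k, Measurable (C m k)) (hCb : ∀ m k w, |C m k w| ≤ b)
    (hdep : ∀ m k, DependsOn (C m k) {e | ∀ n : Fin N, m ≤ n → e ≠ s(n, n)}) (n : ℕ) (hn : n ≤ N) :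
    ∫⁻ g, ENNReal.ofReal (Real.exp (∑ k ∈ Finset.univ.filter fun k : Fin N => (k : ℕ) < n,
        symGauss s(k, k) g * C k k fun e => symGauss e g)) ∂(gMeasure N)
      ≤ ENNReal.ofReal (Real.exp (n * (b ^ 2 / 2))) := by
  induction n with
  | zero => simp
  | succ n ih =>
    set k : Fin N := ⟨n, hn⟩ with hk
    have hfilter : (Finset.univ.filter fun j : Fin N => (j : ℕ) < n + 1)
        = insert k (Finset.univ.filter fun j : Fin N => (j : ℕ) < n) := by
      ext j
      simp only [Finset.mem_filter, Finset.mem_univ, true_and, Finset.mem_insert, hk, Fin.ext_iff]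
      omega
    have hnot : k ∉ Finset.univ.filter fun j : Fin N => (j : ℕ) < n := by simp [hk]
    simp only [hfilter, Finset.sum_insert hnot]
    set φ : (Sym2 (Fin N) → ℝ) → ℝ × ℝ := fun w =>
      (∑ j ∈ Finset.univ.filter fun j : Fin N => (j : ℕ) < n, w s(j, j) * C j j w, C n k w) with hφdef
    have hφ : Measurable φ := by
      refine Measurable.prodMk ?_ (hC n k)
      exact Finset.measurable_sum _ fun j _ => Measurable.mul (by fun_prop) (hC j j)
    have hψ : Measurable fun w : Sym2 (Fin N) → ℝ => w s(k, k) := by fun_prop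
    have hW : Measurable fun (g : Fin N → Fin N → ℝ) (e : Sym2 (Fin N)) => symGauss e g := by
      fun_prop
    have hind := iIndepFun.indepFun_of_dependsOn
      (S := Finset.univ.filter fun e : Sym2 (Fin N) => ∀ j : Fin N, n ≤ j → e ≠ s(j, j))
      (iIndepFun_symGauss (N := N)) (fun e => by fun_prop) hφ hψ
      (fun w w' h => by
        simp only [Finset.coe_filter, Finset.mem_univ, true_and] at h
        refine Prod.ext ?_ (hdep n k h)
        change ∑ j ∈ Finset.univ.filter fun j : Fin N => (j : ℕ) < n, w s(j, j) * C j j w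
          = ∑ j ∈ Finset.univ.filter fun j : Fin N => (j : ℕ) < n, w' s(j, j) * C j j w'
        refine Finset.sum_congr rfl fun j hj => ?_
        have hj' : (j : ℕ) < n := by simpa using hj
        rw [h s(j, j) fun l hl hs => ?_, hdep j j fun e he => h e fun l hl => he l (hj'.le.trans hl)]
        have : j = l := by simpa using hs
        subst this; omega)
      (fun w w' h => by
        refine h _ ?_
        simp only [Finset.coe_filter, Finset.mem_univ, true_and, Set.mem_compl_iff, Set.mem_ofPred_eq,
          not_forall]
        exact ⟨k, le_rfl, by simp⟩)
    have key := lintegral_indepFun_eq (hφ.comp hW) (hψ.comp hW) hind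
      (f := fun q : (ℝ × ℝ) × ℝ => ENNReal.ofReal (Real.exp (q.2 * q.1.2 + q.1.1))) (by fun_prop)
    have hlaw : (gMeasure N).map ((fun w : Sym2 (Fin N) → ℝ => w s(k, k)) ∘
        fun (g : Fin N → Fin N → ℝ) (e : Sym2 (Fin N)) => symGauss e g) = gaussianReal 0 1 :=
      (hasLaw_symGauss s(k, k)).map_eq
    rw [hlaw] at key
    refine key.le.trans ?_
    have hinner : ∀ g : Fin N → Fin N → ℝ,
        ∫⁻ y, ENNReal.ofReal (Real.exp (y * (φ fun e => symGauss e g).2 + (φ fun e => symGauss e g).1))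
          ∂(gaussianReal 0 1) ≤ ENNReal.ofReal (Real.exp (b ^ 2 / 2)) *
            ENNReal.ofReal (Real.exp (φ fun e => symGauss e g).1) := by
      intro g
      simp_rw [Real.exp_add, ENNReal.ofReal_mul (Real.exp_pos _).le]
      rw [lintegral_mul_const _ (by fun_prop)]
      gcongr
      simp_rw [mul_comm _ (φ fun e => symGauss e g).2]
      rw [lintegral_exp_mul_gaussian]
      have hsq : (φ fun e => symGauss e g).2 ^ 2 ≤ b ^ 2 :=
        sq_le_sq.mpr ((hCb n k _).trans (le_abs_self b))
      exact ENNReal.ofReal_le_ofReal (Real.exp_le_exp.mpr (by linarith))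
    calc _ ≤ ∫⁻ g, ENNReal.ofReal (Real.exp (b ^ 2 / 2)) *
            ENNReal.ofReal (Real.exp (φ fun e => symGauss e g).1) ∂(gMeasure N) := lintegral_mono hinner
      _ = ENNReal.ofReal (Real.exp (b ^ 2 / 2)) *
            ∫⁻ g, ENNReal.ofReal (Real.exp (φ fun e => symGauss e g).1) ∂(gMeasure N) :=
          lintegral_const_mul _ (((hφ.comp hW).fst.exp).ennreal_ofReal)
      _ ≤ ENNReal.ofReal (Real.exp (b ^ 2 / 2)) * ENNReal.ofReal (Real.exp (n * (b ^ 2 / 2))) := by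
          gcongr
          exact ih (by omega)
      _ = _ := by
          rw [← ENNReal.ofReal_mul (Real.exp_pos _).le, ← Real.exp_add]
          congr 2; push_cast; ring

lemma measure_diag_martingale_le (hN : 0 < N) {t : ℝ} (ht : 0 < t) (ht1 : t ≤ 1) {z : ℂ}
    (hz : 0 < z.im) :
    gMeasure N {g | ¬ |∑ k : Fin N, √(2 / N) * symGauss s(k, k) g *
        min (resolventM N (partialDiagMat N k fun e => symGauss e g) z k k).im (t ^ 6)| ≤ t}
      ≤ ENNReal.ofReal (6 * Real.exp (-t⁻¹)) := by
  have hN' : (0 : ℝ) < N := by exact_mod_cast hN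
  set f : (Fin N → Fin N → ℝ) → ℝ := fun g => ∑ k : Fin N, √(2 / N) * symGauss s(k, k) g *
        min (resolventM N (partialDiagMat N k fun e => symGauss e g) z k k).im (t ^ 6) with hf
  have hfm : Measurable f := by
    refine Finset.measurable_sum _ fun k _ => ((measurable_symGauss _).const_mul _).mul (Measurable.min ?_ measurable_const)
    refine Complex.measurable_im.comp (measurable_resolventM_apply (fun i j => ?_) z k k)
    exact (measurable_partialDiagMat_apply k i j).comp (measurable_pi_lambda _ fun e => measurable_symGauss e)
  have key : ∀ σ : ℝ, |σ| = 1 → gMeasure N {g | t ≤ σ * f g} ≤ ENNReal.ofReal (3 * Real.exp (-t⁻¹)) := by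
    intro σ hσ
    set θ : ℝ := (t ^ 6)⁻¹ with hθ
    have hθ0 : 0 ≤ θ := by positivity
    have hbd := lintegral_exp_diag_martingale_le (N := N) (b := √(2 / N))
      (C := fun m k w => θ * σ * √(2 / N) * min (resolventM N (partialDiagMat N m w) z k k).im (t ^ 6))
      (fun m k => Measurable.mul measurable_const (Measurable.min (Complex.measurable_im.comp
        (measurable_resolventM_apply (fun i j => measurable_partialDiagMat_apply m i j) z k k))
          measurable_const))
      (fun m k w => by
        have h0 := im_resolventM_diag_nonneg (partialDiagMat_isHermitian m w) hz k
        have h1 : |min (resolventM N (partialDiagMat N m w) z k k).im (t ^ 6)| ≤ t ^ 6 := by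
          rw [abs_of_nonneg (le_min h0 (by positivity))]; exact min_le_right _ _
        rw [abs_mul, abs_mul, abs_mul, hσ, abs_of_nonneg hθ0, abs_of_nonneg (Real.sqrt_nonneg _)]
        calc _ ≤ θ * 1 * √(2 / N) * t ^ 6 := by gcongr
          _ = √(2 / N) := by rw [hθ]; field_simp)
      (fun m k w w' h => by
        have := dependsOn_resolventM_partialDiagMat m z k k h
        simp only at this
        simp only [this]) N le_rfl
    have hexp : (N : ℝ) * (√(2 / N) ^ 2 / 2) = 1 := by
      rw [Real.sq_sqrt (by positivity)]; field_simp
    rw [hexp] at hbd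
    have h2 := measure_lt_le_of_lintegral_exp (μ := gMeasure N) (f := fun g => σ * f g) (a := θ) (s := t)
      (K := 1) (hfm.const_mul σ) (le_of_eq_of_le ?_ hbd) hθ0
    · refine h2.trans (ENNReal.ofReal_le_ofReal ?_)
      have h3 : t⁻¹ ≤ θ * t := by
        rw [hθ, inv_mul_eq_div, inv_eq_one_div, div_le_div_iff₀ ht (by positivity)]
        have : t ^ 6 ≤ t ^ 2 := pow_le_pow_of_le_one ht.le ht1 (by norm_num)
        nlinarith
      calc Real.exp (1 - θ * t) ≤ Real.exp (1 + -t⁻¹) := Real.exp_le_exp.mpr (by linarith)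
        _ = Real.exp 1 * Real.exp (-t⁻¹) := Real.exp_add _ _
        _ ≤ 3 * Real.exp (-t⁻¹) := by
          gcongr; linarith [Real.exp_one_lt_d9]
    · refine lintegral_congr fun g => ?_
      congr 2
      simp only [hf, Finset.mul_sum, Fin.is_lt, Finset.filter_true]
      refine Finset.sum_congr rfl fun k _ => ?_
      ring
  have h6 : ENNReal.ofReal (6 * Real.exp (-t⁻¹))
      = ENNReal.ofReal (3 * Real.exp (-t⁻¹)) + ENNReal.ofReal (3 * Real.exp (-t⁻¹)) := by
    rw [← ENNReal.ofReal_add (by positivity) (by positivity)]; congr 1; ring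
  rw [h6]
  refine (measure_mono (t := {g | t ≤ 1 * f g} ∪ {g | t ≤ -1 * f g}) fun g hg => ?_).trans
    ((measure_union_le _ _).trans (add_le_add (key 1 (by simp)) (key (-1) (by simp))))
  have hg' : t < |f g| := not_le.mp hg
  rcases lt_abs.mp hg' with h | h
  · left; change t ≤ 1 * f g; linarith
  · right; change t ≤ -1 * f g; linarith

end Martingale

section CrudeBound

variable {N : ℕ}

lemma eigenvalues_le_of_entries_le {A : Matrix (Fin N) (Fin N) ℝ} (hA : A.IsHermitian) {B : ℝ}
    (hB : 0 ≤ B) (h : ∀ i j, |A i j| ≤ B) (j : Fin N) : hA.eigenvalues j ≤ N * B := by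
  have h1 : hA.eigenvalues j ^ 2 ≤ ∑ l, hA.eigenvalues l ^ 2 :=
    Finset.single_le_sum (f := fun l => hA.eigenvalues l ^ 2) (fun l _ => sq_nonneg _) (Finset.mem_univ j)
  rw [← sum_sq_entries_eq hA] at h1
  have h2 : ∑ i, ∑ j, A i j ^ 2 ≤ ∑ _i : Fin N, ∑ _j : Fin N, B ^ 2 :=
    Finset.sum_le_sum fun i _ => Finset.sum_le_sum fun j _ => by
      rw [← sq_abs]; exact pow_le_pow_left₀ (abs_nonneg _) (h i j) 2
  simp only [Finset.sum_const, Finset.card_univ, Fintype.card_fin, nsmul_eq_mul] at h2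
  refine le_of_sq_le_sq ?_ (by positivity)
  calc _ ≤ _ := h1.trans h2
    _ = _ := by ring

lemma abs_partialDiagMat_le (hN : 0 < N) {m : ℕ} {w : Sym2 (Fin N) → ℝ} {T : ℝ} (hT : 0 ≤ T)
    (hw : ∀ i j, |w s(i, j)| ≤ T) (i j : Fin N) : |partialDiagMat N m w i j| ≤ 2 * T := by
  have hN' : (1 : ℝ) ≤ N := by exact_mod_cast hN
  simp only [partialDiagMat]
  split_ifs
  · rw [abs_mul, abs_of_nonneg (Real.sqrt_nonneg _)]
    have : √(2 / (N : ℝ)) ≤ 2 := by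
      rw [Real.sqrt_le_left (by norm_num), div_le_iff₀ (by linarith)]; linarith
    exact mul_le_mul this (hw i i) (abs_nonneg _) (by norm_num)
  · rw [abs_zero]; linarith
  · rw [abs_div, abs_of_nonneg (Real.sqrt_nonneg _), div_le_iff₀ (by positivity)]
    have : 1 ≤ √(N : ℝ) := Real.one_le_sqrt.mpr hN'
    have := hw i j
    nlinarith

end CrudeBound

section Assembly

variable {N : ℕ}

lemma evalsDesc_congr {A B : Matrix (Fin N) (Fin N) ℝ} (hA : A.IsHermitian) (hB : B.IsHermitian)
    (h : A = B) : evalsDesc hA = evalsDesc hB := by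
  subst h; rfl

lemma measure_eigenvalue_deviation_le {T : ℝ} (hT : 100 ≤ T) (hTN : T ^ 500 ≤ N)
    (hlog : (Nat.log 2 N : ℝ) ≤ T ^ 7) :
    gMeasure N {g | ¬ ∀ i : Fin N, ((i : ℕ) + 1 : ℝ) ≤ N * T⁻¹ ^ 72 →
        |evalsH N g i - evalsM N g i| ≤ (16 * T ^ 64 + 1) * (T ^ 64 / N)}
      ≤ ENNReal.ofReal (168 * N ^ 5 * Real.exp (-T / 8)) := by
  have hT0 : 0 < T := by linarith
  have hT1 : 1 ≤ T := by linarith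
  have hTpow : ∀ n : ℕ, 1 ≤ T ^ n := fun n => one_le_pow₀ hT1
  have hNT : ∀ n : ℕ, n ≤ 500 → T ^ n ≤ N := fun n hn => (pow_le_pow_right₀ hT1 hn).trans hTN
  have hN100 : (100 : ℝ) ≤ N := hT.trans (by simpa using hNT 1 (by norm_num))
  have hN' : (0 : ℝ) < N := by linarith
  have hN : 0 < N := by exact_mod_cast hN'
  set t : ℝ := T⁻¹ with ht
  have ht0 : 0 < t := by positivity
  have htT : t⁻¹ = T := inv_inv T
  have htpow : ∀ n : ℕ, t ^ n * T ^ n = 1 := fun n => by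
    rw [← mul_pow, ht, inv_mul_cancel₀ hT0.ne', one_pow]
  have ht1 : t ≤ 1 / 100 := by
    rw [ht, inv_eq_one_div]; exact one_div_le_one_div_of_le (by norm_num) hT
  set η : ℝ := T ^ 64 / N with hη
  have hη0 : 0 < η := by positivity
  have hNη : N * η = T ^ 64 := by rw [hη]; field_simp
  -- number of dyadic scales
  obtain ⟨J, hJ1, hJ2⟩ := exists_nat_pow_near (x := t ^ 20 / η) (y := (2 : ℝ))
    (by
      rw [le_div_iff₀ hη0, one_mul, hη, div_le_iff₀ hN']
      have := hNT 84 (by norm_num)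
      calc T ^ 64 = t ^ 20 * T ^ 20 * T ^ 64 := by rw [htpow]; ring
        _ = t ^ 20 * T ^ 84 := by ring
        _ ≤ _ := by gcongr) one_lt_two
  have hx : t ^ 20 / η ≤ N := by
    rw [div_le_iff₀ hη0, hNη]
    exact (pow_le_one₀ ht0.le (by linarith)).trans (hTpow 64)
  have hx2 : 2 ≤ t ^ 20 / η := by
    rw [le_div_iff₀ hη0, hη, ← mul_div_assoc, div_le_iff₀ hN']
    have := hNT 85 (by norm_num)
    calc 2 * T ^ 64 ≤ T * T ^ 64 := by gcongr; linarith
      _ = t ^ 20 * T ^ 20 * (T * T ^ 64) := by rw [htpow]; ring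
      _ = t ^ 20 * T ^ 85 := by ring
      _ ≤ _ := by gcongr
  have hJN : 2 ^ J ≤ N := by exact_mod_cast hJ1.trans hx
  have hJ0 : 1 ≤ J := by
    by_contra h
    have : J = 0 := by omega
    subst this
    norm_num at hJ2
    linarith
  have hJlog : (J : ℝ) ≤ T ^ 7 :=
    le_trans (by exact_mod_cast Nat.le_log_of_pow_le one_lt_two hJN) hlog
  have hJle : J + 1 ≤ N := Nat.lt_two_pow_self.trans_le hJN
  rw [le_div_iff₀ hη0] at hJ1
  rw [div_lt_iff₀ hη0, pow_succ (2 : ℝ)] at hJ2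
  -- number of spectral points
  set M : ℕ := ⌈N * (2 * T) / η⌉₊ with hM
  have hMη : N * (2 * T) ≤ M * η := by
    rw [← div_le_iff₀ hη0]; exact Nat.le_ceil _
  have hMle : M + 1 ≤ 2 * N ^ 2 := by
    have h1 : (M : ℝ) < N * (2 * T) / η + 1 := Nat.ceil_lt_add_one (by positivity)
    have h2 : N * (2 * T) / η ≤ (N : ℝ) ^ 2 := by
      rw [div_le_iff₀ hη0]
      calc N * (2 * T) ≤ N * (T * T) := by gcongr; linarith
        _ = N * T ^ 2 := by ring
        _ ≤ N * T ^ 64 := mul_le_mul_of_nonneg_left (pow_le_pow_right₀ hT1 (by norm_num)) hN'.le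
        _ = _ := by rw [← hNη]; ring
    have h3 : ((M + 1 : ℕ) : ℝ) ≤ ((2 * N ^ 2 : ℕ) : ℝ) := by
      push_cast; nlinarith
    exact_mod_cast h3
  -- the exceptional events
  set c : ENNReal := ENNReal.ofReal (12 * N * Real.exp (-T / 8)) with hc
  have hc1 : (N : ENNReal) * ENNReal.ofReal (12 * Real.exp (-T / 8)) ≤ c := by
    rw [hc, ← ENNReal.ofReal_natCast, ← ENNReal.ofReal_mul (by positivity)]
    apply ENNReal.ofReal_le_ofReal; linarith
  have hE : 0 < Real.exp (-T / 8) := Real.exp_pos _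
  have hc2 : ENNReal.ofReal (4 * Real.exp (-T / 8)) ≤ c :=
    ENNReal.ofReal_le_ofReal (by gcongr; linarith)
  have hc3 : ENNReal.ofReal (6 * Real.exp (-t⁻¹)) ≤ c := by
    apply ENNReal.ofReal_le_ofReal
    have : Real.exp (-t⁻¹) ≤ Real.exp (-T / 8) := Real.exp_le_exp.mpr (by rw [htT]; linarith)
    gcongr; linarith
  have hscale : ∀ j ≤ J, (2 : ℝ) ^ j * η ≤ 1 ∧ 1 ≤ N * (2 ^ j * η) := by
    intro j hj
    constructor
    · calc (2 : ℝ) ^ j * η ≤ 2 ^ J * η := by gcongr; norm_num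
        _ ≤ t ^ 20 := hJ1
        _ ≤ 1 := pow_le_one₀ ht0.le (by linarith)
    · have h2 : (1 : ℝ) ≤ 2 ^ j := one_le_pow₀ (by norm_num)
      have : 1 ≤ N * η := by rw [hNη]; exact hTpow 64
      nlinarith
  set W : (Fin N → Fin N → ℝ) → Sym2 (Fin N) → ℝ := fun g e => symGauss e g with hW
  have hE1 := measure_setOf_not_forall_le (μ := gMeasure N) (c := c)
    (Finset.range (N + 1) ×ˢ Finset.range (M + 1) ×ˢ Finset.range (J + 1))
    (P := fun p g => LocalLaw N (partialDiagMat N p.1 (W g)) T ⟨p.2.1 * η, 2 ^ p.2.2 * η⟩)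
    (fun p hp => by
      simp only [Finset.mem_product, Finset.mem_range, Nat.lt_succ_iff] at hp
      have := hscale p.2.2 hp.2.2
      exact (measure_not_localLaw_le hN (by positivity) this.1 this.2 hT1).trans hc1)
  have hedge : ∀ m : ℕ, gMeasure N {g | ¬ LocalLaw N (partialDiagMat N m (W g)) T
      ⟨2 - t ^ 20 / 2, t ^ 60⟩} ≤ c := fun m => by
    refine (measure_not_localLaw_le hN (by positivity) (pow_le_one₀ ht0.le (by linarith)) ?_ hT1).trans hc1
    calc (1 : ℝ) = T ^ 60 * t ^ 60 := by rw [mul_comm, htpow]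
      _ ≤ N * t ^ 60 := by gcongr; exact hNT 60 (by norm_num)
  have hE2 := measure_setOf_not_forall_le (μ := gMeasure N) (c := c) ({0, N} : Finset ℕ)
    (P := fun m g => LocalLaw N (partialDiagMat N m (W g)) T ⟨2 - t ^ 20 / 2, t ^ 60⟩)
    (fun m _ => hedge m)
  have hE3 := measure_setOf_not_forall_le (μ := gMeasure N) (c := c)
    (Finset.univ : Finset (Fin N × Fin N)) (P := fun p g => |symGauss s(p.1, p.2) g| ≤ T)
    (fun p _ => (measure_abs_symGauss_gt_le _ T).trans hc2)
  have hE4 := measure_setOf_not_forall_le (μ := gMeasure N) (c := c)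
    (Finset.range (M + 1) ×ˢ Finset.range 2)
    (P := fun p g => |∑ k : Fin N, √(2 / N) * symGauss s(k, k) g *
      min (resolventM N (partialDiagMat N k (W g)) ⟨p.1 * η, 2 ^ p.2 * η⟩ k k).im (t ^ 6)| ≤ t)
    (fun p _ => (measure_diag_martingale_le hN ht0 (by linarith) (by positivity)).trans hc3)
  have hcard : (((N + 1) * ((M + 1) * (J + 1)) + 2 + N * N + (M + 1) * 2 : ℕ) : ENNReal) * c
      ≤ ENNReal.ofReal (168 * N ^ 5 * Real.exp (-T / 8)) := by
    rw [hc, ← ENNReal.ofReal_natCast, ← ENNReal.ofReal_mul (by positivity)]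
    apply ENNReal.ofReal_le_ofReal
    have h1 : (((N + 1) * ((M + 1) * (J + 1)) + 2 + N * N + (M + 1) * 2 : ℕ) : ℝ) ≤ 14 * (N : ℝ) ^ 4 := by
      have a1 : ((N + 1) * ((M + 1) * (J + 1)) : ℕ) ≤ 2 * N * (2 * N ^ 2 * N) := by gcongr; omega
      have a2 : ((N + 1) * ((M + 1) * (J + 1)) + 2 + N * N + (M + 1) * 2 : ℕ)
          ≤ 2 * N * (2 * N ^ 2 * N) + 2 + N * N + 2 * N ^ 2 * 2 := by gcongr
      have a3 : (((N + 1) * ((M + 1) * (J + 1)) + 2 + N * N + (M + 1) * 2 : ℕ) : ℝ)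
          ≤ 2 * N * (2 * N ^ 2 * N) + 2 + N * N + 2 * N ^ 2 * 2 := by exact_mod_cast a2
      have a4 : (1 : ℝ) ≤ N := by linarith
      have a5 : (N : ℝ) ^ 2 ≤ N ^ 4 := pow_le_pow_right₀ a4 (by norm_num)
      have a6 : (1 : ℝ) ≤ N ^ 4 := one_le_pow₀ a4
      nlinarith
    calc _ ≤ 14 * (N : ℝ) ^ 4 * (12 * N * Real.exp (-T / 8)) := by gcongr
      _ = _ := by ring
  refine le_trans ?_ hcard
  refine (measure_mono (t := (({g | ¬ ∀ p ∈ Finset.range (N + 1) ×ˢ Finset.range (M + 1) ×ˢ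
      Finset.range (J + 1), LocalLaw N (partialDiagMat N p.1 (W g)) T ⟨p.2.1 * η, 2 ^ p.2.2 * η⟩} ∪
      {g | ¬ ∀ m ∈ ({0, N} : Finset ℕ), LocalLaw N (partialDiagMat N m (W g)) T
        ⟨2 - t ^ 20 / 2, t ^ 60⟩}) ∪
      {g | ¬ ∀ p ∈ (Finset.univ : Finset (Fin N × Fin N)), |symGauss s(p.1, p.2) g| ≤ T}) ∪
      {g | ¬ ∀ p ∈ Finset.range (M + 1) ×ˢ Finset.range 2,
        |∑ k : Fin N, √(2 / N) * symGauss s(k, k) g *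
      min (resolventM N (partialDiagMat N k (W g)) ⟨p.1 * η, 2 ^ p.2 * η⟩ k k).im (t ^ 6)| ≤ t})
      fun g hg => ?_).trans ?_
  · by_contra hcon
    simp only [Set.mem_union, Set.mem_ofPred_eq, not_or, not_not] at hcon
    obtain ⟨⟨⟨h1, h2⟩, h3⟩, h4⟩ := hcon
    apply hg
    have hw : ∀ i j, |W g s(i, j)| ≤ T := fun i j => h3 (i, j) (Finset.mem_univ _)
    have heig : ∀ m j, (partialDiagMat_isHermitian m (W g)).eigenvalues j ≤ M * η := fun m j =>
      (eigenvalues_le_of_entries_le _ (by positivity)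
        (abs_partialDiagMat_le hN hT0.le hw) j).trans hMη
    intro i hi
    have key := abs_evalsDesc_sub_le (t := t) (η := η) (J := J) (M := M)
      (A := fun m => partialDiagMat N m (W g)) hN (fun m => partialDiagMat_isHermitian m (W g))
      (d := fun k => √(2 / N) * W g s(k, k)) (fun k i j => partialDiagMat_succ k (W g) i j)
      ht0 ht1 hη0 (by rw [hNη, htpow])
      (by
        calc (1 : ℝ) = t ^ 500 * T ^ 500 := (htpow 500).symm
          _ ≤ _ := by gcongr)
      hJ0
      (by
        calc (J : ℝ) * t ^ 7 ≤ T ^ 7 * t ^ 7 := by gcongr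
          _ = 1 := by rw [mul_comm, htpow])
      hJ1 (by linarith)
      (fun k hk m hm j hj => by
        rw [htT]
        exact h1 (k, m, j) (by simp only [Finset.mem_product, Finset.mem_range]; omega))
      (by rw [htT]; exact h2 0 (by simp)) (by rw [htT]; exact h2 N (by simp))
      (fun k => by
        rw [htT, mul_pow, Real.sq_sqrt (by positivity), ← sq_abs (W g _)]
        have : |W g s(k, k)| ^ 2 ≤ T ^ 2 := pow_le_pow_left₀ (abs_nonneg _) (hw k k) 2
        calc _ ≤ 2 / (N : ℝ) * T ^ 2 := by gcongr
          _ = _ := by ring)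
      (fun m hm j hj => h4 (m, j) (by simp only [Finset.mem_product, Finset.mem_range]; omega))
      (heig 0) (heig N) i hi
    rw [hNη] at key
    rwa [evalsDesc_congr _ (Hmat_isHermitian N g) (partialDiagMat_self g),
      evalsDesc_congr _ (Mmat_isHermitian N g) (partialDiagMat_zero g)] at key
  · refine (measure_union_le _ _).trans ((add_le_add ((measure_union_le _ _).trans (add_le_add
      ((measure_union_le _ _).trans (add_le_add hE1 hE2)) hE3)) hE4).trans ?_)
    rw [← add_mul, ← add_mul, ← add_mul]
    gcongr
    simp only [Finset.card_product, Finset.card_range, Finset.card_univ, Fintype.card_prod,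
      Fintype.card_fin]
    have : (({0, N} : Finset ℕ).card : ENNReal) ≤ 2 := by exact_mod_cast Finset.card_le_two
    push_cast
    gcongr

end Assembly

section Asymptotics

open Filter Topology Asymptotics

lemma eventually_natLog_le_rpow {a : ℝ} (ha : 0 < a) :
    ∀ᶠ N : ℕ in atTop, (Nat.log 2 N : ℝ) ≤ (N : ℝ) ^ a := by
  have h := (isLittleO_log_rpow_atTop ha).bound (c := Real.log 2) (Real.log_pos one_lt_two)
  filter_upwards [tendsto_natCast_atTop_atTop.eventually h, eventually_ge_atTop 1] with N hN h1
  have h1' : (1 : ℝ) ≤ N := by exact_mod_cast h1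
  rw [Real.norm_of_nonneg (Real.log_nonneg h1'), Real.norm_of_nonneg (by positivity)] at hN
  have h2 : (Nat.log 2 N : ℝ) ≤ Real.log N / Real.log 2 := by
    rw [le_div_iff₀ (Real.log_pos one_lt_two), ← Real.log_pow]
    apply Real.log_le_log (by positivity)
    exact_mod_cast Nat.pow_log_le_self 2 (by omega)
  refine h2.trans ?_
  rw [div_le_iff₀ (Real.log_pos one_lt_two), mul_comm]
  exact hN

lemma eventually_pow_mul_exp_neg_rpow_le {b : ℝ} (hb : 0 < b) {D : ℝ} :
    ∀ᶠ N : ℕ in atTop, 168 * (N : ℝ) ^ 5 * Real.exp (-(N : ℝ) ^ b / 8) ≤ (N : ℝ) ^ (-D) := by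
  have h1 := tendsto_rpow_mul_exp_neg_mul_atTop_nhds_zero ((5 + D) / b) (1 / 8) (by norm_num)
  have h2 : Tendsto (fun N : ℕ => (N : ℝ) ^ b) atTop atTop :=
    (tendsto_rpow_atTop hb).comp tendsto_natCast_atTop_atTop
  have h3 := (h1.comp h2).eventually_lt_const (u := 1 / 168) (by norm_num)
  filter_upwards [h3, eventually_ge_atTop 1] with N hN hN1
  have hN' : (0 : ℝ) < N := by exact_mod_cast hN1
  simp only [Function.comp] at hN
  rw [← Real.rpow_mul hN'.le, mul_div_cancel₀ _ hb.ne', Real.rpow_add hN'] at hN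
  rw [Real.rpow_neg hN'.le, inv_eq_one_div, le_div_iff₀ (by positivity)]
  have h5 : (N : ℝ) ^ (5 : ℝ) = N ^ 5 := by exact_mod_cast Real.rpow_natCast (N : ℝ) 5
  have h6 : -(N : ℝ) ^ b / 8 = -(1 / 8) * N ^ b := by ring
  rw [h5] at hN
  rw [h6]
  nlinarith

end Asymptotics

/-- Proposition `prop:ev`: with overwhelming probability the extremal
eigenvalues of the GOE matrix `H` and of its zero-diagonal version `M` (coupled so that
`M_{ij} = H_{ij}` for `i ≠ j`) agree up to `N^{ε-1}`. -/
theorem zero_diagonal_eigenvalue_comparison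
    (ε : ℝ) (hε : 0 < ε) :
    ∀ D : ℝ, 0 < D → ∃ N₀ : ℕ, ∀ N : ℕ, N₀ ≤ N →
      ((gMeasure N) {g : Fin N → Fin N → ℝ |
          ¬ ∀ i : Fin N, ((i:ℕ) + 1 : ℝ) ≤ (N:ℝ) ^ ((1:ℝ)/20) →
              |evalsH N g i - evalsM N g i| ≤ (N:ℝ) ^ ε / N}).toReal
        ≤ (N:ℝ) ^ (-D) := by
  intro D hD
  set b : ℝ := min ε 1 / 2000 with hb
  have hb0 : 0 < b := by positivity
  have hbε : b ≤ ε / 2000 := by rw [hb]; gcongr; exact min_le_left _ _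
  have hb1 : b ≤ 1 / 2000 := by rw [hb]; gcongr; exact min_le_right _ _
  have hT : ∀ᶠ N : ℕ in Filter.atTop, (100 : ℝ) ≤ (N : ℝ) ^ b :=
    ((tendsto_rpow_atTop hb0).comp tendsto_natCast_atTop_atTop).eventually_ge_atTop 100
  rw [← Filter.eventually_atTop]
  filter_upwards [hT, eventually_natLog_le_rpow (a := b * 7) (by positivity),
    eventually_pow_mul_exp_neg_rpow_le hb0 (D := D), Filter.eventually_ge_atTop 1] with N hN1 hN2 hN3 hN4
  have hN' : (1 : ℝ) ≤ N := by exact_mod_cast hN4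
  have hN0 : (0 : ℝ) < N := by linarith
  set T : ℝ := (N : ℝ) ^ b with hTdef
  have hT0 : 0 < T := by linarith
  have hTpow : ∀ n : ℕ, T ^ n = (N : ℝ) ^ (b * n) := fun n => by
    rw [hTdef, ← Real.rpow_natCast, ← Real.rpow_mul hN0.le]
  have key := measure_eigenvalue_deviation_le hN1
    (by
      rw [hTpow]
      calc (N : ℝ) ^ (b * (500 : ℕ)) ≤ (N : ℝ) ^ (1 : ℝ) :=
            Real.rpow_le_rpow_of_exponent_le hN' (by push_cast; linarith)
        _ = N := Real.rpow_one _)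
    (by rw [hTpow]; exact_mod_cast hN2)
  have hmono := measure_mono (μ := gMeasure N) (s := {g : Fin N → Fin N → ℝ |
        ¬ ∀ i : Fin N, ((i : ℕ) + 1 : ℝ) ≤ (N : ℝ) ^ ((1 : ℝ) / 20) →
          |evalsH N g i - evalsM N g i| ≤ (N : ℝ) ^ ε / N}) (t := {g | ¬ ∀ i : Fin N,
          ((i : ℕ) + 1 : ℝ) ≤ N * T⁻¹ ^ 72 →
        |evalsH N g i - evalsM N g i| ≤ (16 * T ^ 64 + 1) * (T ^ 64 / N)}) (by
    intro g hg hall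
    refine hg fun i hi => (hall i (hi.trans ?_)).trans ?_
    · rw [inv_pow, ← div_eq_mul_inv, le_div_iff₀ (by positivity), hTpow, ← Real.rpow_add hN0]
      calc _ ≤ (N : ℝ) ^ (1 : ℝ) :=
            Real.rpow_le_rpow_of_exponent_le hN' (by push_cast; linarith)
        _ = N := Real.rpow_one _
    · rw [← mul_div_assoc]
      gcongr
      have h1 : 1 ≤ T ^ 64 := one_le_pow₀ (by linarith)
      calc (16 * T ^ 64 + 1) * T ^ 64 ≤ (T * T ^ 64) * T ^ 64 := by
            gcongr; nlinarith
        _ = T ^ 129 := by ring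
        _ = (N : ℝ) ^ (b * (129 : ℕ)) := hTpow 129
        _ ≤ (N : ℝ) ^ ε := Real.rpow_le_rpow_of_exponent_le hN' (by push_cast; linarith))
  refine (ENNReal.toReal_mono ENNReal.ofReal_ne_top (hmono.trans key)).trans ?_
  rw [ENNReal.toReal_ofReal (by positivity)]
  exact hN3

end
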